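/- Let n ≥ 2, p ≥ 2, let Ω ⊆ ℝⁿ be open, and let (u_j) be a sequence of energy minimizing maps into the unit sphere S^{p−1} on Ω, with weak gradients g_j, such that sup_j ∫_{B_ρ(y)} |Du_j|² < ∞ for every ball B_ρ(y) with closure in Ω. Then there exist a subsequence (u_{j'}) and an energy minimizing map u : Ω → ℝ^p into S^{p−1} with weak gradient g such that for every ball B with closure in Ω, u_{j'} → u in L²(B; ℝ^p) and g_{j'} → g in L²(B). -/

import Mathlib

open MeasureTheory Metric Filter Set

noncomputable section

/-- The pointwise energy density `|Du|²(x) = ∑_{i,j} ((g(x)eᵢ)_j)²` associated to a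
(weak) gradient `g`. -/
def energyDensity (n p : ℕ)
    (g : EuclideanSpace ℝ (Fin n) →
      (EuclideanSpace ℝ (Fin n) →L[ℝ] EuclideanSpace ℝ (Fin p)))
    (x : EuclideanSpace ℝ (Fin n)) : ℝ :=
  ∑ i : Fin n, ∑ j : Fin p, (g x (EuclideanSpace.single i 1) j) ^ 2

/-- `u` has weak gradient `g` on `Ω`: both are locally integrable on `Ω` and the
integration-by-parts identity holds against every smooth compactly supported test
function with support in `Ω`. -/
def HasWeakGradient (n p : ℕ) (Ω : Set (EuclideanSpace ℝ (Fin n)))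
    (u : EuclideanSpace ℝ (Fin n) → EuclideanSpace ℝ (Fin p))
    (g : EuclideanSpace ℝ (Fin n) →
      (EuclideanSpace ℝ (Fin n) →L[ℝ] EuclideanSpace ℝ (Fin p))) : Prop :=
  LocallyIntegrableOn u Ω volume ∧ LocallyIntegrableOn g Ω volume ∧
  ∀ φ : EuclideanSpace ℝ (Fin n) → ℝ, ContDiff ℝ (⊤ : ℕ∞) φ → HasCompactSupport φ →
    tsupport φ ⊆ Ω → ∀ i : Fin n, ∀ j : Fin p,
      ∫ x in Ω, u x j * fderiv ℝ φ x (EuclideanSpace.single i 1) =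
        - ∫ x in Ω, φ x * g x (EuclideanSpace.single i 1) j

/-- `u : Ω → ℝᵖ` is an energy minimizing map into the unit sphere `S^(p-1)` with weak
gradient `g`: `u` has weak gradient `g` with locally integrable energy density,
`‖u‖ = 1` a.e. on `Ω`, and `u` minimizes energy in every ball `B_ρ(y)` with closure in
`Ω` among sphere-valued competitors `w` agreeing with `u` a.e. outside a smaller
concentric ball. -/
def IsEnergyMinimizingToSphere (n p : ℕ) (Ω : Set (EuclideanSpace ℝ (Fin n)))
    (u : EuclideanSpace ℝ (Fin n) → EuclideanSpace ℝ (Fin p))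
    (g : EuclideanSpace ℝ (Fin n) →
      (EuclideanSpace ℝ (Fin n) →L[ℝ] EuclideanSpace ℝ (Fin p))) : Prop :=
  HasWeakGradient n p Ω u g ∧
  LocallyIntegrableOn (energyDensity n p g) Ω volume ∧
  (∀ᵐ x ∂volume.restrict Ω, ‖u x‖ = 1) ∧
  ∀ (y : EuclideanSpace ℝ (Fin n)) (ρ : ℝ), 0 < ρ → closedBall y ρ ⊆ Ω →
    ∀ (w : EuclideanSpace ℝ (Fin n) → EuclideanSpace ℝ (Fin p))
      (h : EuclideanSpace ℝ (Fin n) →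
        (EuclideanSpace ℝ (Fin n) →L[ℝ] EuclideanSpace ℝ (Fin p))),
      HasWeakGradient n p Ω w h →
      LocallyIntegrableOn (energyDensity n p h) Ω volume →
      (∀ᵐ x ∂volume.restrict Ω, ‖w x‖ = 1) →
      (∃ σ : ℝ, σ < ρ ∧ ∀ᵐ x ∂volume.restrict (Ω \ ball y σ), w x = u x) →
      ∫ x in ball y ρ, energyDensity n p g x ≤ ∫ x in ball y ρ, energyDensity n p h x

/-- The regular set of `u`: points of `Ω` having an open neighborhood (inside `Ω`) on
which `u` agrees almost everywhere with a `C^∞` map. -/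
def regSet (n p : ℕ) (Ω : Set (EuclideanSpace ℝ (Fin n)))
    (u : EuclideanSpace ℝ (Fin n) → EuclideanSpace ℝ (Fin p)) :
    Set (EuclideanSpace ℝ (Fin n)) :=
  {x | x ∈ Ω ∧ ∃ V : Set (EuclideanSpace ℝ (Fin n)), IsOpen V ∧ x ∈ V ∧ V ⊆ Ω ∧
    ∃ v : EuclideanSpace ℝ (Fin n) → EuclideanSpace ℝ (Fin p),
      ContDiffOn ℝ (⊤ : ℕ∞) v V ∧ ∀ᵐ z ∂volume.restrict V, u z = v z}

namespace CT

set_option linter.unusedSectionVars false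
open scoped ENNReal Topology Convolution

section Moll
variable {X : Type*} [NormedAddCommGroup X] [InnerProductSpace ℝ X] [FiniteDimensional ℝ X]
  [MeasurableSpace X] [BorelSpace X]
variable {E : Type*} [NormedAddCommGroup E] [NormedSpace ℝ E]

def dl (k : ℕ) : ℝ := 1 / ((k : ℝ) + 1)

lemma dl_pos (k : ℕ) : 0 < dl k := by unfold dl; positivity

lemma dl_tendsto : Tendsto dl atTop (𝓝 0) := tendsto_one_div_add_atTop_nhds_zero_nat

variable (X) in
def bmp (k : ℕ) : ContDiffBump (0 : X) where
  rIn := dl k / 2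
  rOut := dl k
  rIn_pos := by have := dl_pos k; positivity
  rIn_lt_rOut := by have := dl_pos k; linarith

def ker (k : ℕ) : X → ℝ := (bmp X k).normed volume

lemma ker_nonneg (k : ℕ) (x : X) : 0 ≤ ker k x := (bmp X k).nonneg_normed x
lemma ker_integral (k : ℕ) : ∫ x : X, ker k x = 1 := (bmp X k).integral_normed
lemma ker_contDiff (k : ℕ) : ContDiff ℝ (⊤ : ℕ∞) (ker k : X → ℝ) := (bmp X k).contDiff_normed
lemma ker_cont (k : ℕ) : Continuous (ker k : X → ℝ) := (bmp X k).continuous_normed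
lemma ker_cs (k : ℕ) : HasCompactSupport (ker k : X → ℝ) := (bmp X k).hasCompactSupport_normed
lemma ker_tsupport (k : ℕ) : tsupport (ker k : X → ℝ) = closedBall 0 (dl k) :=
  (bmp X k).tsupport_normed_eq
lemma ker_neg (k : ℕ) (x : X) : ker k (-x) = ker k x := (bmp X k).normed_neg x
lemma ker_integrable (k : ℕ) : Integrable (ker k : X → ℝ) := (bmp X k).integrable_normed

lemma ker_eq_zero {k : ℕ} {x : X} (h : dl k < ‖x‖) : ker k x = 0 := by
  apply image_eq_zero_of_notMem_tsupport
  rw [ker_tsupport]; simpa using h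

lemma ker_lintegral (k : ℕ) : ∫⁻ x : X, ENNReal.ofReal (ker k x) = 1 := by
  rw [← ofReal_integral_eq_lintegral_ofReal (ker_integrable k)
    (ae_of_all _ (ker_nonneg k)), ker_integral]; simp

def mol (k : ℕ) (f : X → E) : X → E := ker k ⋆[ContinuousLinearMap.lsmul ℝ ℝ, volume] f

lemma mol_eq (k : ℕ) (f : X → E) (x : X) : mol k f x = ∫ t, ker k t • f (x - t) := rfl
lemma mol_eq' (k : ℕ) (f : X → E) (x : X) : mol k f x = ∫ t, ker k (x - t) • f t := by
  unfold mol; rw [convolution_eq_swap]; rfl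

lemma mol_contDiff (k : ℕ) {f : X → E} (hf : LocallyIntegrable f volume) :
    ContDiff ℝ (⊤ : ℕ∞) (mol k f) :=
  (ker_cs k).contDiff_convolution_left _ (ker_contDiff k) hf

lemma mol_integrand (k : ℕ) {f : X → E} (hf : LocallyIntegrable f volume) (x : X) :
    Integrable (fun t => ker k t • f (x - t)) volume :=
  ((ker_cs k).convolutionExists_left (ContinuousLinearMap.lsmul ℝ ℝ) (ker_cont k) hf x)

lemma mol_integrand' (k : ℕ) {f : X → E} (hf : LocallyIntegrable f volume) (x : X) :
    Integrable (fun t => ker k (x - t) • f t) volume :=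
  ((ker_cs k).convolutionExists_left (ContinuousLinearMap.lsmul ℝ ℝ)
    (ker_cont k) hf x).integrable_swap

lemma mol_fderiv (k : ℕ) {f : X → E} [CompleteSpace E] (hf : LocallyIntegrable f volume) (x e : X) :
    fderiv ℝ (mol k f) x e = ∫ t, fderiv ℝ (ker k) (x - t) e • f t := by
  have h1 := (ker_cs k).hasFDerivAt_convolution_left (ContinuousLinearMap.lsmul ℝ ℝ)
    ((ker_contDiff k).of_le (by simp)) hf x (μ := volume)
  have : fderiv ℝ (mol k f) x = _ := h1.fderiv
  rw [this, convolution_eq_swap]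
  rw [ContinuousLinearMap.integral_apply]
  · simp
  · have h2 := ((ker_cs k).fderiv ℝ).convolutionExists_left
      ((ContinuousLinearMap.lsmul ℝ ℝ : ℝ →L[ℝ] E →L[ℝ] E).precompL X) (μ := volume)
      ((ker_contDiff k).continuous_fderiv (by simp)) hf x
    exact h2.integrable_swap

lemma mol_ae (f : X → E) [CompleteSpace E] (hf : LocallyIntegrable f volume) :
    ∀ᵐ x, Tendsto (fun k => mol k f x) atTop (𝓝 (f x)) :=
  ContDiffBump.ae_convolution_tendsto_right_of_locallyIntegrable (φ := fun k => bmp X k)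
    (K := 2) dl_tendsto (Eventually.of_forall fun k => by
      show dl k ≤ 2 * (dl k / 2); linarith) hf

/-- Jensen / Cauchy-Schwarz for the mollifier -/
lemma mol_sq_le (k : ℕ) (F : X → E) (hF : AEStronglyMeasurable F volume) :
    ‖∫ t, ker k t • F t‖ₑ ^ 2 ≤ ∫⁻ t, ENNReal.ofReal (ker k t) * ‖F t‖ₑ ^ 2 := by
  have h1 : ‖∫ t, ker k t • F t‖ₑ ≤ ∫⁻ t, ENNReal.ofReal (ker k t) * ‖F t‖ₑ := by
    refine (enorm_integral_le_lintegral_enorm _).trans (le_of_eq ?_)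
    refine lintegral_congr fun t => ?_
    rw [enorm_smul, Real.enorm_eq_ofReal (ker_nonneg k t)]
  have hm : AEMeasurable (fun t : X => ENNReal.ofReal (ker k t)) volume :=
    (ker_cont k).measurable.ennreal_ofReal.aemeasurable
  have h2 := ENNReal.lintegral_mul_le_Lp_mul_Lq volume (p := 2) (q := 2)
    (by constructor <;> norm_num) (f := fun t => ENNReal.ofReal (ker k t) ^ (1/2 : ℝ))
    (g := fun t => ENNReal.ofReal (ker k t) ^ (1/2 : ℝ) * ‖F t‖ₑ)
    (hm.pow_const _) ((hm.pow_const _).mul hF.enorm)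
  have e1 : ∀ t : X, (ENNReal.ofReal (ker k t) ^ (1/2 : ℝ)) ^ (2:ℝ) = ENNReal.ofReal (ker k t) := by
    intro t; rw [← ENNReal.rpow_mul]; norm_num
  have e2 : ∀ t : X, ENNReal.ofReal (ker k t) ^ (1/2 : ℝ) * ENNReal.ofReal (ker k t) ^ (1/2 : ℝ)
      = ENNReal.ofReal (ker k t) := by
    intro t; rw [← ENNReal.rpow_add_of_nonneg _ _ (by norm_num) (by norm_num)]; norm_num
  simp only [Pi.mul_apply, ← mul_assoc, e2] at h2
  simp only [ENNReal.mul_rpow_of_nonneg _ _ (by norm_num : (0:ℝ) ≤ 2), e1, ker_lintegral,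
    ENNReal.one_rpow, one_mul] at h2
  calc ‖∫ t, ker k t • F t‖ₑ ^ 2 ≤ ((∫⁻ (a : X), ENNReal.ofReal (ker k a) * ‖F a‖ₑ ^ (2:ℝ)) ^ (1 / 2 : ℝ)) ^ 2 := by
        gcongr; exact h1.trans h2
    _ = _ := by
      rw [← ENNReal.rpow_natCast, ← ENNReal.rpow_mul]; norm_num

lemma shift_lint_le (φ : X → ℝ≥0∞) {A A' : Set X} (hA : MeasurableSet A) (hA' : MeasurableSet A')
    {t : X} (h : ∀ x ∈ A, x - t ∈ A') : ∫⁻ x in A, φ (x - t) ≤ ∫⁻ x in A', φ x := by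
  rw [← lintegral_indicator hA, ← lintegral_indicator hA']
  rw [← lintegral_sub_right_eq_self (A'.indicator φ) t]
  refine lintegral_mono fun x => ?_
  by_cases hx : x ∈ A
  · rw [indicator_of_mem hx, indicator_of_mem (h x hx)]
  · rw [indicator_of_notMem hx]; positivity

/-- local contraction -/
lemma mol_lint_le (k : ℕ) {f : X → E} (hf : AEStronglyMeasurable f volume) {A A' : Set X}
    (hA : MeasurableSet A) (hA' : MeasurableSet A')
    (hAA : ∀ x ∈ A, closedBall x (dl k) ⊆ A') :
    ∫⁻ x in A, ‖mol k f x‖ₑ ^ 2 ≤ ∫⁻ x in A', ‖f x‖ₑ ^ 2 := by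
  have hm : Measurable (fun t : X => ENNReal.ofReal (ker k t)) :=
    (ker_cont k).measurable.ennreal_ofReal
  have hfm : ∀ x, AEStronglyMeasurable (fun t => f (x - t)) volume := fun x =>
    hf.comp_quasiMeasurePreserving (quasiMeasurePreserving_sub_left volume x)
  have hprod : AEStronglyMeasurable (fun z : X × X => f (z.1 - z.2)) (volume.prod volume) :=
    hf.comp_quasiMeasurePreserving (quasiMeasurePreserving_sub volume volume)
  have hint : AEMeasurable (fun z : X × X => ENNReal.ofReal (ker k z.2) * ‖f (z.1 - z.2)‖ₑ ^ 2)
      (((volume : Measure X).restrict A).prod volume) := by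
    refine AEMeasurable.fun_mul ?_ ?_
    · exact (hm.comp measurable_snd).aemeasurable
    · refine (hprod.mono_ac ?_).enorm.pow_const _
      exact Measure.AbsolutelyContinuous.prod Measure.restrict_le_self.absolutelyContinuous
        (Measure.AbsolutelyContinuous.refl _)
  calc ∫⁻ x in A, ‖mol k f x‖ₑ ^ 2
      ≤ ∫⁻ x in A, ∫⁻ t, ENNReal.ofReal (ker k t) * ‖f (x - t)‖ₑ ^ 2 := by
        refine lintegral_mono fun x => ?_
        exact mol_sq_le k _ (hfm x)
    _ = ∫⁻ t, ∫⁻ x in A, ENNReal.ofReal (ker k t) * ‖f (x - t)‖ₑ ^ 2 :=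
        lintegral_lintegral_swap hint
    _ ≤ ∫⁻ t, ENNReal.ofReal (ker k t) * ∫⁻ x in A', ‖f x‖ₑ ^ 2 := by
        refine lintegral_mono fun t => ?_
        by_cases ht : dl k < ‖t‖
        · simp [ker_eq_zero ht]
        · rw [lintegral_const_mul' _ _ ENNReal.ofReal_ne_top]
          refine mul_le_mul_right ?_ _
          exact shift_lint_le (fun x => ‖f x‖ₑ ^ 2) hA hA'
            fun x hx => hAA x hx (by simpa [dist_eq_norm] using ht)
    _ = _ := by
        rw [lintegral_mul_const _ hm, ker_lintegral, one_mul]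

lemma eLpNorm_two_sq {μ : Measure X} (f : X → E) : eLpNorm f 2 μ ^ 2 = ∫⁻ x, ‖f x‖ₑ ^ 2 ∂μ := by
  have := eLpNorm_nnreal_pow_eq_lintegral (p := 2) (f := f) (μ := μ) (by norm_num)
  simpa using this

lemma mol_eLp_le (k : ℕ) {f : X → E} (hf : AEStronglyMeasurable f volume) {A A' : Set X}
    (hA : MeasurableSet A) (hA' : MeasurableSet A')
    (hAA : ∀ x ∈ A, closedBall x (dl k) ⊆ A') :
    eLpNorm (mol k f) 2 (volume.restrict A) ≤ eLpNorm f 2 (volume.restrict A') := by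
  have := mol_lint_le k hf hA hA' hAA
  rw [← eLpNorm_two_sq, ← eLpNorm_two_sq] at this
  exact (ENNReal.pow_le_pow_left_iff (by norm_num)).1 this

lemma mol_norm_le [CompleteSpace E] (k : ℕ) {f : X → E} {R : ℝ} (hR : ∀ᵐ x, ‖f x‖ ≤ R) (x : X) : ‖mol k f x‖ ≤ R := by
  rw [mol_eq']
  calc ‖∫ t, ker k (x - t) • f t‖ ≤ ∫ t, ker k (x - t) * R := by
        apply norm_integral_le_of_norm_le
        · exact ((ker_integrable k).comp_sub_left x).mul_const R
        · filter_upwards [hR] with t ht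
          rw [norm_smul, Real.norm_of_nonneg (ker_nonneg _ _)]
          gcongr
          exact ker_nonneg _ _
    _ = R := by rw [integral_mul_const, integral_sub_left_eq_self (ker k), ker_integral, one_mul]

lemma mol_sub [CompleteSpace E] (k : ℕ) {f g : X → E} (hf : LocallyIntegrable f volume)
    (hg : LocallyIntegrable g volume) : mol k (f - g) = mol k f - mol k g := by
  ext x
  simp only [mol_eq', Pi.sub_apply, smul_sub]
  exact integral_sub (mol_integrand' k hf x) (mol_integrand' k hg x)

lemma memLp_locallyIntegrable {f : X → E} (hf : MemLp f 2 (volume : Measure X)) : LocallyIntegrable f volume :=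
  hf.locallyIntegrable (by norm_num)

lemma mol_tendsto_L2 [CompleteSpace E] {f : X → E} (hf : MemLp f 2 (volume : Measure X)) :
    Tendsto (fun k => eLpNorm (mol k f - f) 2 volume) atTop (𝓝 0) := by
  rw [ENNReal.tendsto_atTop_zero]
  intro ε hε
  wlog hε1 : ε < ⊤ generalizing ε
  · obtain ⟨N, hN⟩ := this 1 (by norm_num) (by norm_num)
    exact ⟨N, fun k hk => (hN k hk).trans (by simp at hε1; simp [hε1])⟩
  have hε3 : ε / 3 ≠ 0 := by simp [hε.ne']
  obtain ⟨g, hgc, hgn, hgcont, hgmem⟩ := hf.exists_hasCompactSupport_eLpNorm_sub_le (by norm_num) hε3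
  obtain ⟨R, hR⟩ := hgc.isCompact.isBounded.subset_closedBall (0:X)
  have huc := hgc.uniformContinuous_of_continuous hgcont
  -- uniform convergence for g
  set V := volume (closedBall (0:X) (R + 1)) with hV
  have hVt : V ≠ ⊤ := measure_closedBall_lt_top.ne
  obtain ⟨η, hη0, hη⟩ : ∃ η : ℝ, 0 < η ∧ ENNReal.ofReal η * V ^ (1/2 : ℝ) ≤ ε / 3 := by
    have ht : Tendsto (fun η : ℝ => ENNReal.ofReal η * V ^ (1/2:ℝ)) (𝓝[>] 0) (𝓝 0) := by
      have : Tendsto (fun η : ℝ => ENNReal.ofReal η * V ^ (1/2:ℝ)) (𝓝 0) (𝓝 (ENNReal.ofReal 0 * V ^ (1/2:ℝ))) := by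
        refine ENNReal.Tendsto.mul_const ((ENNReal.continuous_ofReal.tendsto 0)) (Or.inr ?_)
        exact ENNReal.rpow_ne_top_of_nonneg (by norm_num) hVt
      simpa using this.mono_left nhdsWithin_le_nhds
    have h1 := ht.eventually (ge_mem_nhds (lt_of_le_of_ne bot_le (Ne.symm hε3) : 0 < ε/3))
    obtain ⟨η, h2, h3⟩ := (h1.and self_mem_nhdsWithin).exists
    exact ⟨η, h3, h2⟩
  obtain ⟨δ, hδ, hδg⟩ := Metric.uniformContinuous_iff.1 huc η hη0
  have hev : ∀ᶠ k in atTop, dl k < δ ∧ dl k ≤ 1 :=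
    (dl_tendsto.eventually (gt_mem_nhds hδ)).and (dl_tendsto.eventually (ge_mem_nhds one_pos))
  obtain ⟨N, hN⟩ := eventually_atTop.1 hev
  refine ⟨N, fun k hk => ?_⟩
  obtain ⟨hk1, hk2⟩ := hN k hk
  have hfl := memLp_locallyIntegrable hf
  have hgl := memLp_locallyIntegrable hgmem
  have hdec : mol k f - f = mol k (f - g) + ((mol k g - g) - (f - g)) := by
    rw [mol_sub k hfl hgl]; abel
  have hA : eLpNorm (mol k (f - g)) 2 volume ≤ ε / 3 := by
    have := mol_eLp_le k (f := f - g) (hf.1.sub hgmem.1) MeasurableSet.univ MeasurableSet.univ (by simp)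
    simp only [Measure.restrict_univ] at this
    exact this.trans hgn
  have hB : eLpNorm (mol k g - g) 2 volume ≤ ε / 3 := by
    have hpt : ∀ x, ‖(mol k g - g) x‖ ≤ η := by
      intro x
      rw [← dist_zero_right]; simp only [Pi.sub_apply]
      rw [dist_zero_right, ← dist_eq_norm]
      apply ContDiffBump.dist_normed_convolution_le hgcont.aestronglyMeasurable
      intro z hz
      exact (hδg ((mem_ball.1 hz).trans hk1)).le
    have hsup : ∀ x, x ∉ closedBall (0:X) (R+1) → (mol k g - g) x = 0 := by
      intro x hx
      have hx' : R + 1 < ‖x‖ := by simpa using hx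
      have hz : ∀ y, R < ‖y‖ → g y = 0 := fun y hy => by
        apply image_eq_zero_of_notMem_tsupport
        intro h; have := hR h; simp at this; linarith
      simp only [Pi.sub_apply, hz x (by linarith), sub_zero, mol_eq]
      rw [integral_eq_zero_of_ae]
      refine ae_of_all _ fun t => ?_
      by_cases ht : dl k < ‖t‖
      · simp [ker_eq_zero ht]
      · have : R < ‖x - t‖ := by have := norm_sub_norm_le x t; linarith
        simp [hz _ this]
    have : eLpNorm (mol k g - g) 2 volume = eLpNorm (mol k g - g) 2 (volume.restrict (closedBall (0:X) (R+1))) := by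
      rw [← eLpNorm_indicator_eq_eLpNorm_restrict measurableSet_closedBall]
      congr 1; ext x
      by_cases hx : x ∈ closedBall (0:X) (R+1)
      · simp [hx]
      · rw [indicator_of_notMem hx, hsup x hx]
    rw [this]
    refine (eLpNorm_le_of_ae_bound (C := η) (ae_of_all _ hpt)).trans ?_
    rw [mul_comm]
    simpa [hV] using hη
  rw [hdec]
  have m1 : AEStronglyMeasurable (mol k (f - g)) volume :=
    (mol_contDiff k (hfl.sub hgl)).continuous.aestronglyMeasurable
  have m2 : AEStronglyMeasurable (mol k g) volume :=
    (mol_contDiff k hgl).continuous.aestronglyMeasurable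
  calc _ ≤ eLpNorm (mol k (f - g)) 2 volume + eLpNorm ((mol k g - g) - (f - g)) 2 volume :=
        eLpNorm_add_le m1 ((m2.sub hgmem.1).sub (hf.1.sub hgmem.1)) (by norm_num)
    _ ≤ eLpNorm (mol k (f - g)) 2 volume + (eLpNorm (mol k g - g) 2 volume + eLpNorm (f - g) 2 volume) := by
        gcongr
        exact eLpNorm_sub_le (m2.sub hgmem.1) (hf.1.sub hgmem.1) (by norm_num)
    _ ≤ ε / 3 + (ε / 3 + ε / 3) := by gcongr
    _ = ε := by rw [← add_assoc]; exact ENNReal.add_thirds ε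

end Moll
end CT

namespace CT
set_option linter.unusedSectionVars false
open scoped ENNReal Topology Convolution

section WDsec
variable {X : Type*} [NormedAddCommGroup X] [InnerProductSpace ℝ X] [FiniteDimensional ℝ X]
  [MeasurableSpace X] [BorelSpace X]
variable {E : Type*} [NormedAddCommGroup E] [NormedSpace ℝ E]
variable {E' : Type*} [NormedAddCommGroup E'] [NormedSpace ℝ E']

/-- locally square integrable -/
def LL (Ω : Set X) (f : X → E) : Prop :=
  ∀ K ⊆ Ω, IsCompact K → MemLp f 2 (volume.restrict K)

def WD (Ω : Set X) (e : X) (f h : X → E) : Prop :=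
  LL Ω f ∧ LL Ω h ∧ ∀ φ : X → ℝ, ContDiff ℝ (⊤ : ℕ∞) φ → HasCompactSupport φ →
    tsupport φ ⊆ Ω → ∫ x, fderiv ℝ φ x e • f x = - ∫ x, φ x • h x

lemma LL.mono {Ω Ω' : Set X} {f : X → E} (h : LL Ω f) (hs : Ω' ⊆ Ω) : LL Ω' f :=
  fun K hK hc => h K (hK.trans hs) hc

lemma LL.integrableOn {Ω : Set X} {f : X → E} (h : LL Ω f) {K : Set X} (hK : K ⊆ Ω)
    (hc : IsCompact K) : IntegrableOn f K volume := by
  have : IsFiniteMeasure (volume.restrict K : Measure X) := ⟨by simpa using hc.measure_lt_top⟩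
  exact (h K hK hc).integrable (by norm_num)

lemma LL.congr {Ω : Set X} {f g : X → E} (h : LL Ω f)
    (hfg : ∀ᵐ x ∂(volume.restrict Ω), f x = g x) : LL Ω g :=
  fun K hK hc => (h K hK hc).ae_eq (ae_restrict_of_ae_restrict_of_subset hK hfg)

lemma LL.add {Ω : Set X} {f g : X → E} (hf : LL Ω f) (hg : LL Ω g) : LL Ω (fun x => f x + g x) :=
  fun K hK hc => (hf K hK hc).add (hg K hK hc)

lemma LL.clm {Ω : Set X} {f : X → E} (hf : LL Ω f) (L : E →L[ℝ] E') : LL Ω (fun x => L (f x)) :=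
  fun K hK hc => L.comp_memLp' (hf K hK hc)

lemma LL.of_continuous {Ω : Set X} {f : X → E} (hf : Continuous f) : LL Ω f := by
  intro K _ hc
  have : IsFiniteMeasure (volume.restrict K : Measure X) := ⟨by simpa using hc.measure_lt_top⟩
  obtain ⟨C, hC⟩ := hc.exists_bound_of_continuousOn hf.continuousOn
  exact MemLp.of_bound hf.aestronglyMeasurable C
    ((ae_restrict_iff' hc.measurableSet).2 (ae_of_all _ hC))

/-- bounded by L2 function -/
lemma LL.of_le {Ω : Set X} {f : X → E} {F : X → E'} (hF : LL Ω F)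
    (hm : ∀ K ⊆ Ω, IsCompact K → AEStronglyMeasurable f (volume.restrict K)) {C : ℝ}
    (hle : ∀ᵐ x ∂(volume.restrict Ω), ‖f x‖ ≤ C * ‖F x‖) : LL Ω f :=
  fun K hK hc => (hF K hK hc).of_le_mul (hm K hK hc) (ae_restrict_of_ae_restrict_of_subset hK hle)

lemma LL.of_bdd {Ω : Set X} {f : X → E}
    (hm : ∀ K ⊆ Ω, IsCompact K → AEStronglyMeasurable f (volume.restrict K)) {C : ℝ}
    (hle : ∀ᵐ x ∂(volume.restrict Ω), ‖f x‖ ≤ C) : LL Ω f := by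
  intro K hK hc
  have : IsFiniteMeasure (volume.restrict K : Measure X) := ⟨by simpa using hc.measure_lt_top⟩
  exact MemLp.of_bound (hm K hK hc) C (ae_restrict_of_ae_restrict_of_subset hK hle)

/-- integral against a compactly supported continuous function -/
lemma LL.integrable_smul {Ω : Set X} {f : X → E} (hf : LL Ω f) {φ : X → ℝ} (hφ : Continuous φ)
    (hc : HasCompactSupport φ) (hs : tsupport φ ⊆ Ω) : Integrable (fun x => φ x • f x) := by
  have h2 : IntegrableOn (fun x => φ x • f x) (tsupport φ) := by
    refine Integrable.bdd_smul (hf.integrableOn hs hc) _ hφ.aestronglyMeasurable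
      (ae_of_all _ (hφ.bounded_above_of_compact_support hc).choose_spec)
  exact (integrableOn_iff_integrable_of_support_subset (fun x hx => by
    apply subset_tsupport; intro h; simp [h] at hx)).1 h2

lemma tsupport_fderiv_sub (φ : X → ℝ) (e : X) : tsupport (fun x => fderiv ℝ φ x e) ⊆ tsupport φ :=
  tsupport_fderiv_apply_subset ℝ e

lemma LL.integrable_fderiv_smul {Ω : Set X} {f : X → E} (hf : LL Ω f) {φ : X → ℝ}
    (hφ : ContDiff ℝ (⊤ : ℕ∞) φ)
    (hc : HasCompactSupport φ) (hs : tsupport φ ⊆ Ω) (e : X) :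
    Integrable (fun x => fderiv ℝ φ x e • f x) :=
  hf.integrable_smul ((hφ.continuous_fderiv (by simp)).clm_apply continuous_const)
    (hc.fderiv_apply ℝ e) ((tsupport_fderiv_sub φ e).trans hs)

lemma WD.mono {Ω Ω' : Set X} {e : X} {f h : X → E} (H : WD Ω e f h) (hs : Ω' ⊆ Ω) : WD Ω' e f h :=
  ⟨H.1.mono hs, H.2.1.mono hs, fun φ h1 h2 h3 => H.2.2 φ h1 h2 (h3.trans hs)⟩

lemma integral_smul_congr {Ω : Set X} (hΩ : MeasurableSet Ω) {f g : X → E} {φ : X → ℝ}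
    (hfg : ∀ᵐ x ∂(volume.restrict Ω), f x = g x)
    (hs : tsupport φ ⊆ Ω) : ∫ x, φ x • f x = ∫ x, φ x • g x := by
  apply integral_congr_ae
  rw [ae_restrict_iff' hΩ] at hfg
  filter_upwards [hfg] with x hx
  by_cases h : x ∈ Ω
  · rw [hx h]
  · rw [image_eq_zero_of_notMem_tsupport (fun h' => h (hs h'))]; simp

lemma WD.congr {Ω : Set X} (hΩ : MeasurableSet Ω) {e : X} {f h f' h' : X → E} (H : WD Ω e f h)
    (hf : ∀ᵐ x ∂(volume.restrict Ω), f x = f' x) (hh : ∀ᵐ x ∂(volume.restrict Ω), h x = h' x) :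
    WD Ω e f' h' := by
  refine ⟨H.1.congr hf, H.2.1.congr hh, fun φ h1 h2 h3 => ?_⟩
  rw [← integral_smul_congr hΩ hh h3, ← H.2.2 φ h1 h2 h3]
  exact (integral_smul_congr hΩ hf ((tsupport_fderiv_sub φ e).trans h3)).symm

lemma WD.add {Ω : Set X} {e : X} {f h f' h' : X → E} (H : WD Ω e f h) (H' : WD Ω e f' h') :
    WD Ω e (fun x => f x + f' x) (fun x => h x + h' x) := by
  refine ⟨H.1.add H'.1, H.2.1.add H'.2.1, fun φ h1 h2 h3 => ?_⟩
  simp only [smul_add]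
  rw [integral_add (H.1.integrable_fderiv_smul h1 h2 h3 e) (H'.1.integrable_fderiv_smul h1 h2 h3 e),
    integral_add (H.2.1.integrable_smul h1.continuous h2 h3)
      (H'.2.1.integrable_smul h1.continuous h2 h3), H.2.2 φ h1 h2 h3, H'.2.2 φ h1 h2 h3]
  abel

lemma WD.clm [CompleteSpace E] [CompleteSpace E'] {Ω : Set X} {e : X} {f h : X → E} (H : WD Ω e f h) (L : E →L[ℝ] E') :
    WD Ω e (fun x => L (f x)) (fun x => L (h x)) := by
  refine ⟨H.1.clm L, H.2.1.clm L, fun φ h1 h2 h3 => ?_⟩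
  simp only [← map_smul]
  rw [L.integral_comp_comm (H.1.integrable_fderiv_smul h1 h2 h3 e),
    L.integral_comp_comm (H.2.1.integrable_smul h1.continuous h2 h3), H.2.2 φ h1 h2 h3, map_neg]

lemma WD.prodMk [CompleteSpace E] [CompleteSpace E'] {Ω : Set X} {e : X} {f h : X → E} {f' h' : X → E'} (H : WD Ω e f h)
    (H' : WD Ω e f' h') : WD Ω e (fun x => (f x, f' x)) (fun x => (h x, h' x)) := by
  have := (H.clm (ContinuousLinearMap.inl ℝ E E')).add (H'.clm (ContinuousLinearMap.inr ℝ E E'))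
  simpa using this

lemma ibp_C1 {f : X → E} (hf : ContDiff ℝ 1 f) {φ : X → ℝ} (hφ : ContDiff ℝ (⊤ : ℕ∞) φ)
    (hc : HasCompactSupport φ) (e : X) :
    ∫ x, fderiv ℝ φ x e • f x = - ∫ x, φ x • fderiv ℝ f x e := by
  have hcf : Continuous (fun x => fderiv ℝ f x e) :=
    (hf.continuous_fderiv (by simp)).clm_apply continuous_const
  have := integral_smul_fderiv_eq_neg_fderiv_smul_of_integrable (μ := (volume : Measure X)) (f := φ) (g := f) (v := e)
    ((LL.of_continuous (Ω := univ) hf.continuous).integrable_fderiv_smul hφ hc (subset_univ _) e)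
    ((LL.of_continuous (Ω := univ) hcf).integrable_smul hφ.continuous hc (subset_univ _))
    ((LL.of_continuous (Ω := univ) hf.continuous).integrable_smul hφ.continuous hc (subset_univ _))
    (fun x _ => hφ.differentiable (by simp) x) (fun x _ => hf.differentiable (by simp) x)
  rw [this, neg_neg]

lemma WD.of_C1 {Ω : Set X} {f : X → E} (hf : ContDiff ℝ 1 f) (e : X) :
    WD Ω e f (fun x => fderiv ℝ f x e) :=
  ⟨LL.of_continuous hf.continuous, LL.of_continuous
    ((hf.continuous_fderiv (by simp)).clm_apply continuous_const),
    fun _ h1 h2 _ => ibp_C1 hf h1 h2 e⟩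

/-- derivative of the mollification -/
lemma mol_WD [CompleteSpace E] {O : Set X} {e : X} {f h : X → E} (H : WD O e f h)
    (hf : LocallyIntegrable f volume) {k : ℕ} {x : X}
    (hx : closedBall x (dl k) ⊆ O) : fderiv ℝ (mol k f) x e = mol k h x := by
  rw [mol_fderiv k hf, mol_eq']
  have hd : ∀ t, fderiv ℝ (fun t => ker k (x - t)) t e = - fderiv ℝ (ker k) (x - t) e := by
    intro t
    have h1 : HasFDerivAt (fun t => x - t) (-(ContinuousLinearMap.id ℝ X)) t := by
      simpa using (hasFDerivAt_id t).const_sub x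
    have h2 := (((ker_contDiff k).differentiable (by simp)) (x - t)).hasFDerivAt
    have h3 := (h2.comp t h1).fderiv
    have : (fun t => ker k (x - t)) = (ker k) ∘ (fun t => x - t) := rfl
    rw [this, h3]; simp
  have hts : tsupport (fun t => ker k (x - t)) ⊆ closedBall x (dl k) := by
    apply closure_minimal _ isClosed_closedBall
    intro t ht
    by_contra hcon
    apply ht
    apply ker_eq_zero
    simpa [dist_eq_norm, norm_sub_rev] using hcon
  have := H.2.2 (fun t => ker k (x - t)) ((ker_contDiff k).comp (contDiff_const.sub contDiff_id))
    (HasCompactSupport.of_support_subset_isCompact (isCompact_closedBall x (dl k))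
      ((subset_tsupport _).trans hts))
    (hts.trans hx)
  simp only [hd, neg_smul, integral_neg, neg_inj] at this
  exact this

/-- localisation -/
lemma LL.indicator {Ω : Set X} {f : X → E} (hf : LL Ω f) {K : Set X} (hK : K ⊆ Ω)
    (hc : IsCompact K) : MemLp (K.indicator f) 2 (volume : Measure X) :=
  (memLp_indicator_iff_restrict hc.measurableSet).2 (hf K hK hc)

lemma WD.indicator {Ω : Set X} {e : X} {f h : X → E} (H : WD Ω e f h) {K : Set X} (hK : K ⊆ Ω) :
    WD (interior K) e (K.indicator f) (K.indicator h) := by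
  refine (H.mono (interior_subset.trans hK)).congr isOpen_interior.measurableSet ?_ ?_
  all_goals
    refine (ae_restrict_iff' isOpen_interior.measurableSet).2 (ae_of_all _ fun x hx => ?_)
    rw [indicator_of_mem (interior_subset hx)]

lemma exists_dl {K O : Set X} (hK : IsCompact K) (hO : IsOpen O) (h : K ⊆ O) :
    ∀ᶠ k in atTop, ∀ x ∈ K, closedBall x (dl k) ⊆ O := by
  obtain ⟨δ, hδ, hs⟩ := hK.exists_cthickening_subset_open hO h
  filter_upwards [dl_tendsto.eventually (gt_mem_nhds hδ)] with k hk x hx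
  exact (closedBall_subset_closedBall hk.le).trans
    ((closedBall_subset_cthickening hx δ).trans hs)

end WDsec
end CT

namespace CT
set_option linter.unusedSectionVars false
open scoped ENNReal Topology Convolution

section WD3
variable {X : Type*} [NormedAddCommGroup X] [InnerProductSpace ℝ X] [FiniteDimensional ℝ X]
  [MeasurableSpace X] [BorelSpace X]
variable {E : Type*} [NormedAddCommGroup E] [NormedSpace ℝ E]
variable {E' : Type*} [NormedAddCommGroup E'] [NormedSpace ℝ E']

/-- L2 convergence on a set of finite measure implies L1 convergence -/
lemma L1_of_L2 {K : Set X} (hK : volume K ≠ ⊤) {F : ℕ → X → E}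
    (hm : ∀ k, AEStronglyMeasurable (F k) (volume.restrict K))
    (h : Tendsto (fun k => eLpNorm (F k) 2 (volume.restrict K)) atTop (𝓝 0)) :
    Tendsto (fun k => ∫ x in K, ‖F k x‖) atTop (𝓝 0) := by
  have h1 : ∀ k, eLpNorm (F k) 1 (volume.restrict K) ≤
      eLpNorm (F k) 2 (volume.restrict K) * volume K ^ (1/2 : ℝ) := by
    intro k
    have := eLpNorm_le_eLpNorm_mul_rpow_measure_univ (p := 1) (q := 2) (by norm_num) (hm k)
    simp only [Measure.restrict_apply_univ] at this
    refine this.trans (le_of_eq ?_)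
    norm_num
  have h2 : Tendsto (fun k => eLpNorm (F k) 2 (volume.restrict K) * volume K ^ (1/2 : ℝ)) atTop
      (𝓝 0) := by
    have := ENNReal.Tendsto.mul_const (b := volume K ^ (1/2 : ℝ)) h
      (Or.inr (ENNReal.rpow_ne_top_of_nonneg (by norm_num) hK))
    simpa using this
  have h3 := tendsto_of_tendsto_of_tendsto_of_le_of_le tendsto_const_nhds h2 (fun _ => bot_le) h1
  have h4 := (ENNReal.tendsto_toReal (by simp)).comp h3
  refine h4.congr fun k => ?_
  simp only [Function.comp_apply, eLpNorm_one_eq_lintegral_enorm]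
  rw [integral_norm_eq_lintegral_enorm (hm k)]

/-- Chain rule -/
lemma WD.chain [CompleteSpace E] [CompleteSpace E'] [FiniteDimensional ℝ E] {Ω : Set X} (hΩ : IsOpen Ω) {e : X} {f h : X → E}
    (H : WD Ω e f h) {R : ℝ} (hR : ∀ᵐ x ∂(volume.restrict Ω), ‖f x‖ ≤ R) {F : E → E'}
    (hF : ContDiff ℝ 1 F) : WD Ω e (fun x => F (f x)) (fun x => fderiv ℝ F (f x) (h x)) := by
  have hcF : Continuous (fun y => fderiv ℝ F y) := hF.continuous_fderiv (by simp)
  have : ProperSpace E := FiniteDimensional.proper ℝ E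
  obtain ⟨C0, hC0⟩ := (isCompact_closedBall (0:E) R).exists_bound_of_continuousOn hF.continuous.continuousOn
  obtain ⟨C1, hC1⟩ := (isCompact_closedBall (0:E) R).exists_bound_of_continuousOn hcF.continuousOn
  simp only [mem_closedBall, dist_zero_right] at hC0 hC1
  have hm0 : ∀ K ⊆ Ω, IsCompact K → AEStronglyMeasurable (fun x => F (f x)) (volume.restrict K) :=
    fun K hK hc => hF.continuous.comp_aestronglyMeasurable (H.1 K hK hc).1
  have hm1 : ∀ K ⊆ Ω, IsCompact K →
      AEStronglyMeasurable (fun x => fderiv ℝ F (f x) (h x)) (volume.restrict K) :=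
    fun K hK hc => (isBoundedBilinearMap_apply (𝕜 := ℝ) (E := E) (F := E')).continuous.comp_aestronglyMeasurable
      ((hcF.comp_aestronglyMeasurable (H.1 K hK hc).1).prodMk (H.2.1 K hK hc).1)
  have hL0 : LL Ω (fun x => F (f x)) := LL.of_bdd hm0 (C := C0) (by
    filter_upwards [hR] with x hx using hC0 _ hx)
  have hL1 : LL Ω (fun x => fderiv ℝ F (f x) (h x)) := H.2.1.of_le hm1 (C := C1) (by
    filter_upwards [hR] with x hx
    exact ContinuousLinearMap.le_of_opNorm_le _ (hC1 _ hx) _)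
  refine ⟨hL0, hL1, fun φ h1 h2 h3 => ?_⟩
  obtain ⟨K', hK'c, hKK', hK'Ω⟩ := exists_compact_between h2 hΩ h3
  set K := tsupport φ with hKdef
  have hKc : IsCompact K := h2
  set f' := K'.indicator f with hf'
  set h' := K'.indicator h with hh'
  have H' : WD (interior K') e f' h' := H.indicator hK'Ω
  have mf' : MemLp f' 2 (volume : Measure X) := H.1.indicator hK'Ω hK'c
  have mh' : MemLp h' 2 (volume : Measure X) := H.2.1.indicator hK'Ω hK'c
  have lf' := memLp_locallyIntegrable mf'
  have lh' := memLp_locallyIntegrable mh'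
  -- values on K
  have eqK : ∀ x ∈ K, f' x = f x ∧ h' x = h x := fun x hx => by
    have : x ∈ K' := interior_subset (hKK' hx)
    simp [hf', hh', this]
  have hR0 : 0 ≤ max R 0 := le_max_right _ _
  have hbd' : ∀ᵐ x, ‖f' x‖ ≤ max R 0 := by
    rw [ae_restrict_iff' hΩ.measurableSet] at hR
    filter_upwards [hR] with x hx
    by_cases hxK : x ∈ K'
    · simp only [hf', indicator_of_mem hxK]; exact (hx (hK'Ω hxK)).trans (le_max_left _ _)
    · simp [hf', indicator_of_notMem hxK]
  obtain ⟨D0, hD0⟩ := (isCompact_closedBall (0:E) (max R 0)).exists_bound_of_continuousOn hF.continuous.continuousOn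
  obtain ⟨D1, hD1⟩ := (isCompact_closedBall (0:E) (max R 0)).exists_bound_of_continuousOn hcF.continuousOn
  simp only [mem_closedBall, dist_zero_right] at hD0 hD1
  have hbk : ∀ k x, ‖mol k f' x‖ ≤ max R 0 := fun k x => mol_norm_le k hbd' x
  have hae := mol_ae f' lf'
  obtain ⟨M, hM⟩ := h1.continuous.bounded_above_of_compact_support h2
  have hcfd : Continuous (fun x => fderiv ℝ φ x e) :=
    (h1.continuous_fderiv (by simp)).clm_apply continuous_const
  obtain ⟨M', hM'⟩ := hcfd.bounded_above_of_compact_support (h2.fderiv_apply ℝ e)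
  have hsm : ∀ k, ContDiff ℝ 1 (mol k f') := fun k => (mol_contDiff k lf').of_le (by simp)
  have z0 : ∀ x, x ∉ K → φ x = 0 := fun x hx => image_eq_zero_of_notMem_tsupport hx
  have z1 : ∀ x, x ∉ K → fderiv ℝ φ x e = 0 := fun x hx => by
    apply image_eq_zero_of_notMem_tsupport (f := fun x => fderiv ℝ φ x e)
    exact fun h => hx (tsupport_fderiv_sub φ e h)
  have s0 : ∀ G : X → E', ∫ x in K, φ x • G x = ∫ x, φ x • G x := fun G =>
    setIntegral_eq_integral_of_forall_compl_eq_zero fun x hx => by rw [z0 x hx, zero_smul]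
  have s1 : ∀ G : X → E', ∫ x in K, fderiv ℝ φ x e • G x = ∫ x, fderiv ℝ φ x e • G x := fun G =>
    setIntegral_eq_integral_of_forall_compl_eq_zero fun x hx => by rw [z1 x hx, zero_smul]
  have hfinK : IsFiniteMeasure (volume.restrict K : Measure X) := ⟨by simpa using hKc.measure_lt_top⟩
  have hKm : MeasurableSet K := hKc.measurableSet
  -- LHS limit
  have hl : Tendsto (fun k => ∫ x in K, fderiv ℝ φ x e • F (mol k f' x)) atTop
      (𝓝 (∫ x in K, fderiv ℝ φ x e • F (f x))) := by
    refine tendsto_integral_of_dominated_convergence (fun _ => M' * D0) ?_ (integrable_const _) ?_ ?_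
    · exact fun k => (hcfd.smul (hF.continuous.comp (hsm k).continuous)).aestronglyMeasurable
    · intro k
      refine ae_of_all _ fun x => ?_
      rw [norm_smul]
      exact mul_le_mul (hM' x) (hD0 _ (hbk k x)) (norm_nonneg _) ((norm_nonneg _).trans (hM' x))
    · refine (ae_restrict_iff' hKm).2 ?_
      filter_upwards [hae] with x hx hxK
      rw [(eqK x hxK).1] at hx
      exact (((hF.continuous.tendsto _).comp hx).const_smul _)
  -- RHS
  have hr1 : Tendsto (fun k => ∫ x in K, φ x • fderiv ℝ F (mol k f' x) (h' x)) atTop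
      (𝓝 (∫ x in K, φ x • fderiv ℝ F (f x) (h x))) := by
    refine tendsto_integral_of_dominated_convergence (fun x => M * (D1 * ‖h' x‖)) ?_ ?_ ?_ ?_
    · intro k
      refine (h1.continuous.aestronglyMeasurable).smul ?_
      exact (isBoundedBilinearMap_apply (𝕜 := ℝ) (E := E) (F := E')).continuous.comp_aestronglyMeasurable
        ((hcF.comp (hsm k).continuous).aestronglyMeasurable.prodMk mh'.1.restrict)
    · exact ((lh'.integrableOn_isCompact hKc).norm.const_mul _).const_mul _
    · intro k
      refine ae_of_all _ fun x => ?_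
      rw [norm_smul]
      refine mul_le_mul (hM x) ?_ (norm_nonneg _) ((norm_nonneg _).trans (hM x))
      exact ContinuousLinearMap.le_of_opNorm_le _ (hD1 _ (hbk k x)) _
    · refine (ae_restrict_iff' hKm).2 ?_
      filter_upwards [hae] with x hx hxK
      rw [(eqK x hxK).1] at hx
      rw [(eqK x hxK).2]
      have h5 : Tendsto (fun k => fderiv ℝ F (mol k f' x)) atTop (𝓝 (fderiv ℝ F (f x))) :=
        (hcF.tendsto _).comp hx
      exact (((ContinuousLinearMap.apply ℝ E' (h x)).continuous.tendsto _).comp h5).const_smul _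
  have hr2 : Tendsto (fun k => ∫ x in K, ‖(mol k h' - h') x‖) atTop (𝓝 0) := by
    refine L1_of_L2 hKc.measure_lt_top.ne (fun k => ?_) ?_
    · exact ((mol_contDiff k lh').continuous.aestronglyMeasurable.sub mh'.1).restrict
    · exact tendsto_of_tendsto_of_tendsto_of_le_of_le tendsto_const_nhds (mol_tendsto_L2 mh')
        (fun _ => bot_le) (fun k => eLpNorm_mono_measure _ Measure.restrict_le_self)
  have iK : ∀ k, Integrable (fun x => (mol k h' - h') x) (volume.restrict K) := fun k =>
    ((mol_contDiff k lh').continuous.locallyIntegrable.sub lh').integrableOn_isCompact hKc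
  have iA : ∀ k (G : X → E), Integrable G (volume.restrict K) → Integrable (fun x => φ x • fderiv ℝ F (mol k f' x) (G x)) (volume.restrict K) := by
    intro k G hG
    refine Integrable.mono' ((hG.norm.const_mul D1).const_mul M) ?_ ?_
    · refine (h1.continuous.aestronglyMeasurable).smul ?_
      exact (isBoundedBilinearMap_apply (𝕜 := ℝ) (E := E) (F := E')).continuous.comp_aestronglyMeasurable
        ((hcF.comp (hsm k).continuous).aestronglyMeasurable.prodMk hG.1)
    · refine ae_of_all _ fun x => ?_
      rw [norm_smul]
      refine mul_le_mul (hM x) ?_ (norm_nonneg _) ((norm_nonneg _).trans (hM x))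
      exact ContinuousLinearMap.le_of_opNorm_le _ (hD1 _ (hbk k x)) _
  have hr3 : Tendsto (fun k => ∫ x in K, φ x • fderiv ℝ F (mol k f' x) ((mol k h' - h') x)) atTop
      (𝓝 0) := by
    rw [tendsto_zero_iff_norm_tendsto_zero]
    have hb : Tendsto (fun k => M * (D1 * ∫ x in K, ‖(mol k h' - h') x‖)) atTop (𝓝 0) := by
      simpa using (hr2.const_mul D1).const_mul M
    refine tendsto_of_tendsto_of_tendsto_of_le_of_le tendsto_const_nhds hb
        (fun _ => norm_nonneg _) (fun k => ?_)
    dsimp only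
    rw [← integral_const_mul, ← integral_const_mul]
    refine norm_integral_le_of_norm_le (((iK k).norm.const_mul D1).const_mul M) ?_
    refine ae_of_all _ fun x => ?_
    rw [norm_smul]
    refine mul_le_mul (hM x) ?_ (norm_nonneg _) ((norm_nonneg _).trans (hM x))
    exact ContinuousLinearMap.le_of_opNorm_le _ (hD1 _ (hbk k x)) _
  have hr4 := hr1.add hr3
  rw [add_zero] at hr4
  have heq : ∀ᶠ k in atTop, ∫ x in K, fderiv ℝ φ x e • F (mol k f' x) =
      -((∫ x in K, φ x • fderiv ℝ F (mol k f' x) (h' x)) +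
        ∫ x in K, φ x • fderiv ℝ F (mol k f' x) ((mol k h' - h') x)) := by
    filter_upwards [exists_dl hKc isOpen_interior hKK'] with k hk
    have hib : ∫ x, fderiv ℝ φ x e • F (mol k f' x) = -∫ x, φ x • fderiv ℝ (F ∘ mol k f') x e :=
      ibp_C1 (hF.comp (hsm k)) h1 h2 e
    rw [s1 (fun x => F (mol k f' x)), hib,
      ← integral_add (iA k h' (lh'.integrableOn_isCompact hKc)) (iA k _ (iK k)), ← s0]
    congr 1
    refine setIntegral_congr_fun hKm fun x hx => ?_
    have hd : fderiv ℝ (F ∘ mol k f') x e = fderiv ℝ F (mol k f' x) (mol k h' x) := by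
      rw [fderiv_comp x (hF.differentiable (by simp) _) ((hsm k).differentiable (by simp) _)]
      simp [mol_WD H' lf' (hk x hx)]
    have hd2 : fderiv ℝ (F ∘ mol k f') x e = fderiv ℝ F (mol k f' x) (h' x) + fderiv ℝ F (mol k f' x) ((mol k h' - h') x) := by
      rw [hd, ← map_add]; simp
    rw [hd2, smul_add]
  have hfin := tendsto_nhds_unique (hl.congr' heq) hr4.neg
  rw [s1 (fun x => F (f x)), s0] at hfin
  exact hfin

end WD3
end CT

namespace CT
set_option linter.unusedSectionVars false
open scoped ENNReal Topology Convolution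

section WD4
variable {X : Type*} [NormedAddCommGroup X] [InnerProductSpace ℝ X] [FiniteDimensional ℝ X]
  [MeasurableSpace X] [BorelSpace X]
variable {E : Type*} [NormedAddCommGroup E] [NormedSpace ℝ E]
variable {ι : Type*} [Fintype ι]

lemma LL.of_le' {Ω : Set X} {f : X → E} {B : X → ℝ} (hF : LL Ω B)
    (hm : ∀ K ⊆ Ω, IsCompact K → AEStronglyMeasurable f (volume.restrict K))
    (hle : ∀ᵐ x ∂(volume.restrict Ω), ‖f x‖ ≤ B x) : LL Ω f := by
  refine hF.of_le hm (C := 1) ?_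
  filter_upwards [hle] with x hx
  rw [one_mul]; exact hx.trans (le_abs_self _)

/-- dominated limits of weak derivatives -/
lemma WD.limit [CompleteSpace E] {Ω : Set X} (hΩ : MeasurableSet Ω) {e : X} {f h : ℕ → X → E} {f0 h0 : X → E}
    (H : ∀ k, WD Ω e (f k) (h k)) {B B' : X → ℝ} (hB : LL Ω B) (hB' : LL Ω B')
    (hf : ∀ k, ∀ᵐ x ∂(volume.restrict Ω), ‖f k x‖ ≤ B x)
    (hh : ∀ k, ∀ᵐ x ∂(volume.restrict Ω), ‖h k x‖ ≤ B' x)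
    (tf : ∀ᵐ x ∂(volume.restrict Ω), Tendsto (fun k => f k x) atTop (𝓝 (f0 x)))
    (th : ∀ᵐ x ∂(volume.restrict Ω), Tendsto (fun k => h k x) atTop (𝓝 (h0 x))) :
    WD Ω e f0 h0 := by
  have L : ∀ {f : ℕ → X → E} {f0 : X → E} {B : X → ℝ}, LL Ω B → (∀ k, LL Ω (f k)) →
      (∀ k, ∀ᵐ x ∂(volume.restrict Ω), ‖f k x‖ ≤ B x) →
      (∀ᵐ x ∂(volume.restrict Ω), Tendsto (fun k => f k x) atTop (𝓝 (f0 x))) →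
      LL Ω f0 ∧ ∀ φ : X → ℝ, Continuous φ → HasCompactSupport φ → tsupport φ ⊆ Ω →
        Tendsto (fun k => ∫ x, φ x • f k x) atTop (𝓝 (∫ x, φ x • f0 x)) := by
    intro f f0 B hB hL hf tf
    constructor
    · refine hB.of_le' (fun K hK hc => ?_) ?_
      · exact aestronglyMeasurable_of_tendsto_ae atTop (fun k => (hL k K hK hc).1)
          (ae_restrict_of_ae_restrict_of_subset hK tf)
      · filter_upwards [ae_all_iff.2 hf, tf] with x h1 h2
        exact le_of_tendsto h2.norm (Eventually.of_forall h1)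
    · intro φ h1 h2 h3
      have := (hB.integrable_smul h1 h2 h3).norm
      rw [ae_restrict_iff' hΩ] at tf
      have hf' := fun k => (ae_restrict_iff' hΩ).1 (hf k)
      refine tendsto_integral_of_dominated_convergence _
        (fun k => ((hL k).integrable_smul h1 h2 h3).1) this (fun k => ?_) ?_
      · filter_upwards [hf' k] with x hx
        by_cases hx' : x ∈ Ω
        · rw [norm_smul, norm_smul]
          exact mul_le_mul_of_nonneg_left ((hx hx').trans (le_abs_self _)) (norm_nonneg _)
        · have : φ x = 0 := image_eq_zero_of_notMem_tsupport (fun h => hx' (h3 h))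
          simp [this]
      · filter_upwards [tf] with x hx
        by_cases hx' : x ∈ Ω
        · exact (hx hx').const_smul _
        · have : φ x = 0 := image_eq_zero_of_notMem_tsupport (fun h => hx' (h3 h))
          simp [this]
  obtain ⟨a1, a2⟩ := L hB (fun k => (H k).1) hf tf
  obtain ⟨b1, b2⟩ := L hB' (fun k => (H k).2.1) hh th
  refine ⟨a1, b1, fun φ h1 h2 h3 => ?_⟩
  have t1 := a2 (fun x => fderiv ℝ φ x e) ((h1.continuous_fderiv (by simp)).clm_apply continuous_const)
    (h2.fderiv_apply ℝ e) ((tsupport_fderiv_sub φ e).trans h3)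
  have t2 := b2 φ h1.continuous h2 h3
  refine tendsto_nhds_unique t1 (t2.neg.congr fun k => ?_)
  exact ((H k).2.2 φ h1 h2 h3).symm

lemma opnorm_sq_le (b : OrthonormalBasis ι ℝ X) (L : X →L[ℝ] E) (t : X) :
    ‖L t‖ ^ 2 ≤ ‖t‖ ^ 2 * ∑ i, ‖L (b i)‖ ^ 2 := by
  have h1 : ‖L t‖ ≤ ∑ i, |inner ℝ (b i) t| * ‖L (b i)‖ := by
    conv_lhs => rw [← b.sum_repr' t]
    rw [map_sum]
    refine (norm_sum_le _ _).trans (Finset.sum_le_sum fun i _ => ?_)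
    rw [map_smul, norm_smul, Real.norm_eq_abs]
  have h2 := Finset.sum_mul_sq_le_sq_mul_sq Finset.univ (fun i => |inner ℝ (b i) t|) (fun i => ‖L (b i)‖)
  have h3 : ∑ i, |inner ℝ (b i) t| ^ 2 = ‖t‖ ^ 2 := by
    rw [← b.sum_sq_norm_inner_right t]; simp
  rw [h3] at h2
  exact (pow_le_pow_left₀ (norm_nonneg _) h1 2).trans h2

lemma opnorm_sq_le_e (b : OrthonormalBasis ι ℝ X) (L : X →L[ℝ] E) (t : X) :
    ‖L t‖ₑ ^ 2 ≤ ‖t‖ₑ ^ 2 * ∑ i, ‖L (b i)‖ₑ ^ 2 := by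
  have := ENNReal.ofReal_le_ofReal (opnorm_sq_le b L t)
  rw [ENNReal.ofReal_mul (by positivity), ENNReal.ofReal_sum_of_nonneg (fun i _ => by positivity)] at this
  simpa only [ENNReal.ofReal_pow (norm_nonneg _), ofReal_norm] using this

lemma line_sq_le [CompleteSpace E] (b : OrthonormalBasis ι ℝ X) {f : X → E} (hf : ContDiff ℝ 1 f) (x t : X) :
    ‖f (x - t) - f x‖ₑ ^ 2 ≤
      ‖t‖ₑ ^ 2 * ∫⁻ s in Ioc (0:ℝ) 1, ∑ i, ‖fderiv ℝ f (x - s • t) (b i)‖ₑ ^ 2 := by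
  have hd : ∀ s : ℝ, HasDerivAt (fun s : ℝ => f (x - s • t)) (fderiv ℝ f (x - s • t) (-t)) s := by
    intro s
    have h1 : HasDerivAt (fun s : ℝ => x - s • t) (-t) s := by
      simpa using ((hasDerivAt_id s).smul_const t).const_sub x
    exact ((hf.differentiable (by simp) _).hasFDerivAt).comp_hasDerivAt s h1
  have hc : Continuous (fun s : ℝ => fderiv ℝ f (x - s • t) (-t)) :=
    ((hf.continuous_fderiv (by simp)).comp (by fun_prop)).clm_apply continuous_const
  have h1 : f (x - t) - f x = ∫ s in Ioc (0:ℝ) 1, fderiv ℝ f (x - s • t) (-t) := by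
    have := intervalIntegral.integral_eq_sub_of_hasDerivAt (a := 0) (b := 1) (fun s _ => hd s)
      (hc.intervalIntegrable _ _)
    rw [intervalIntegral.integral_of_le zero_le_one] at this
    rw [this]; simp
  have hp : IsProbabilityMeasure (volume.restrict (Ioc (0:ℝ) 1)) := ⟨by simp⟩
  have h2 : ‖f (x - t) - f x‖ₑ ≤ eLpNorm (fun s : ℝ => fderiv ℝ f (x - s • t) (-t)) 2 (volume.restrict (Ioc (0:ℝ) 1)) := by
    rw [h1]
    refine (enorm_integral_le_lintegral_enorm _).trans ?_
    rw [← eLpNorm_one_eq_lintegral_enorm]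
    exact eLpNorm_le_eLpNorm_of_exponent_le (by norm_num) hc.aestronglyMeasurable
  calc ‖f (x - t) - f x‖ₑ ^ 2 ≤ (eLpNorm (fun s : ℝ => fderiv ℝ f (x - s • t) (-t)) 2 (volume.restrict (Ioc (0:ℝ) 1)))^2 := by gcongr
    _ = ∫⁻ s in Ioc (0:ℝ) 1, ‖fderiv ℝ f (x - s • t) (-t)‖ₑ ^ 2 := eLpNorm_two_sq _
    _ ≤ ∫⁻ s in Ioc (0:ℝ) 1, ‖t‖ₑ ^ 2 * ∑ i, ‖fderiv ℝ f (x - s • t) (b i)‖ₑ ^ 2 := by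
        refine lintegral_mono fun s => ?_
        have := opnorm_sq_le_e b (fderiv ℝ f (x - s • t)) (-t)
        rwa [enorm_neg] at this
    _ = _ := lintegral_const_mul' _ _ (by simp)

lemma trans_C1 [CompleteSpace E] (b : OrthonormalBasis ι ℝ X) {f : X → E} (hf : ContDiff ℝ 1 f) (k : ℕ)
    {A A' : Set X} (hA : MeasurableSet A) (hA' : MeasurableSet A')
    (hAA : ∀ x ∈ A, closedBall x (dl k) ⊆ A') :
    ∫⁻ x in A, ‖mol k f x - f x‖ₑ ^ 2 ≤
      ENNReal.ofReal (dl k) ^ 2 * ∫⁻ x in A', ∑ i, ‖fderiv ℝ f x (b i)‖ₑ ^ 2 := by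
  set S : X → ℝ≥0∞ := fun x => ∑ i, ‖fderiv ℝ f x (b i)‖ₑ ^ 2 with hS
  have hSc : Continuous S := by
    refine continuous_finsetSum _ fun i _ => ?_
    have : Continuous (fun x => fderiv ℝ f x (b i)) :=
      (hf.continuous_fderiv (by simp)).clm_apply continuous_const
    exact (ENNReal.continuous_pow 2).comp this.enorm
  have h1 : ∀ x, mol k f x - f x = ∫ t, ker k t • (f (x - t) - f x) := by
    intro x
    simp_rw [smul_sub]
    rw [integral_sub (mol_integrand k hf.continuous.locallyIntegrable x)
      ((ker_integrable k).smul_const _), integral_smul_const, ker_integral, one_smul, mol_eq]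
  have h2 : ∀ x, ‖mol k f x - f x‖ₑ ^ 2 ≤ ∫⁻ t, ENNReal.ofReal (ker k t) *
      (ENNReal.ofReal (dl k) ^ 2 * ∫⁻ s in Ioc (0:ℝ) 1, S (x - s • t)) := by
    intro x
    rw [h1 x]
    refine (mol_sq_le k (fun t => f (x - t) - f x) ?_).trans (lintegral_mono fun t => ?_)
    · exact ((hf.continuous.comp (by fun_prop)).sub continuous_const).aestronglyMeasurable
    · by_cases ht : dl k < ‖t‖
      · simp [ker_eq_zero ht]
      · refine mul_le_mul_right ?_ _
        refine (line_sq_le b hf x t).trans ?_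
        refine mul_le_mul_left ?_ _
        gcongr
        rw [← ofReal_norm]; exact ENNReal.ofReal_le_ofReal (not_lt.1 ht)
  have hkm : Measurable (fun t : X => ENNReal.ofReal (ker k t)) := (ker_cont k).measurable.ennreal_ofReal
  have hm2 : Measurable (fun q : X × X => ∫⁻ s in Ioc (0:ℝ) 1, S (q.1 - s • q.2)) := by
    refine Measurable.lintegral_prod_right' (f := fun z : (X × X) × ℝ => S (z.1.1 - z.2 • z.1.2)) ?_
    exact (hSc.comp (by fun_prop)).measurable
  calc ∫⁻ x in A, ‖mol k f x - f x‖ₑ ^ 2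
      ≤ ∫⁻ x in A, ∫⁻ t, ENNReal.ofReal (ker k t) *
      (ENNReal.ofReal (dl k) ^ 2 * ∫⁻ s in Ioc (0:ℝ) 1, S (x - s • t)) := lintegral_mono h2
    _ = ∫⁻ t, ∫⁻ x in A, ENNReal.ofReal (ker k t) *
      (ENNReal.ofReal (dl k) ^ 2 * ∫⁻ s in Ioc (0:ℝ) 1, S (x - s • t)) := by
        refine lintegral_lintegral_swap ?_
        refine Measurable.aemeasurable ?_
        exact (hkm.comp measurable_snd).mul (hm2.const_mul _)
    _ ≤ ∫⁻ t, ENNReal.ofReal (ker k t) * (ENNReal.ofReal (dl k) ^ 2 * ∫⁻ x in A', S x) := by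
        refine lintegral_mono fun t => ?_
        dsimp only
        rw [lintegral_const_mul' _ _ (by simp), lintegral_const_mul' _ _ (by simp)]
        by_cases ht : dl k < ‖t‖
        · simp [ker_eq_zero ht]
        · refine mul_le_mul_right (mul_le_mul_right ?_ _) _
          rw [lintegral_lintegral_swap]
          · calc _ ≤ ∫⁻ s in Ioc (0:ℝ) 1, ∫⁻ x in A', S x := by
                  refine setLIntegral_mono measurable_const fun s hs => ?_
                  refine shift_lint_le S hA hA' fun x hx => hAA x hx ?_
                  rw [mem_closedBall, dist_eq_norm]
                  have : ‖s • t‖ ≤ ‖t‖ := by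
                    rw [norm_smul, Real.norm_eq_abs, abs_of_pos hs.1]
                    exact mul_le_of_le_one_left (norm_nonneg _) hs.2
                  simpa using this.trans (not_lt.1 ht)
              _ = _ := by simp
          · exact (hSc.comp (by fun_prop : Continuous fun q : X × ℝ => q.1 - q.2 • t)).measurable.aemeasurable
    _ = _ := by
        rw [lintegral_mul_const _ hkm, ker_lintegral, one_mul]

lemma trans_WD [CompleteSpace E] (b : OrthonormalBasis ι ℝ X) {O : Set X} (hO : IsOpen O) {f : X → E} {h : ι → X → E}
    (hf : MemLp f 2 (volume : Measure X)) (hh : ∀ i, MemLp (h i) 2 (volume : Measure X))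
    (H : ∀ i, WD O (b i) f (h i)) {k : ℕ} {A A' : Set X} (hA : MeasurableSet A) (hA' : IsCompact A')
    (hAO : A' ⊆ O) (hAA : ∀ x ∈ A, closedBall x (dl k) ⊆ A') :
    eLpNorm (mol k f - f) 2 (volume.restrict A) ≤
      ENNReal.ofReal (dl k) * (∑ i, ∫⁻ x in O, ‖h i x‖ₑ ^ 2) ^ (1/2 : ℝ) := by
  have lf := memLp_locallyIntegrable hf
  have mc : ∀ m, Continuous (mol m f) := fun m => (mol_contDiff m lf).continuous
  have lm : ∀ m, LocallyIntegrable (mol m f) volume := fun m => (mc m).locallyIntegrable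
  have key : ∀ᶠ m in atTop, eLpNorm (mol k (mol m f) - mol m f) 2 (volume.restrict A) ≤
      ENNReal.ofReal (dl k) * (∑ i, ∫⁻ x in O, ‖h i x‖ₑ ^ 2) ^ (1/2 : ℝ) := by
    filter_upwards [exists_dl hA' hO hAO] with m hm
    have h1 := trans_C1 b ((mol_contDiff m lf).of_le (by simp)) k hA hA'.measurableSet hAA
    have h2 : ∫⁻ x in A', ∑ i, ‖fderiv ℝ (mol m f) x (b i)‖ₑ ^ 2 ≤ ∑ i, ∫⁻ x in O, ‖h i x‖ₑ ^ 2 := by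
      rw [lintegral_finsetSum]
      · refine Finset.sum_le_sum fun i _ => ?_
        calc ∫⁻ x in A', ‖fderiv ℝ (mol m f) x (b i)‖ₑ ^ 2 = ∫⁻ x in A', ‖mol m (h i) x‖ₑ ^ 2 := by
              refine setLIntegral_congr_fun hA'.measurableSet fun x hx => ?_
              rw [mol_WD (H i) lf (hm x hx)]
          _ ≤ _ := mol_lint_le m (hh i).1 hA'.measurableSet hO.measurableSet hm
      · intro i _
        have : Continuous (fun x => fderiv ℝ (mol m f) x (b i)) :=
          ((mol_contDiff m lf).continuous_fderiv (by simp)).clm_apply continuous_const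
        exact ((ENNReal.continuous_pow 2).comp this.enorm).measurable
    have h3 : eLpNorm (mol k (mol m f) - mol m f) 2 (volume.restrict A) ^ 2 ≤
       (ENNReal.ofReal (dl k) * (∑ i, ∫⁻ x in O, ‖h i x‖ₑ ^ 2) ^ (1/2 : ℝ)) ^ 2 := by
      rw [eLpNorm_two_sq, mul_pow, ← ENNReal.rpow_natCast (_ ^ (1/2 : ℝ)), ← ENNReal.rpow_mul]
      norm_num
      exact h1.trans (mul_le_mul_right h2 _)
    exact (ENNReal.pow_le_pow_left_iff two_ne_zero).1 h3
  set C := ENNReal.ofReal (dl k) * (∑ i, ∫⁻ x in O, ‖h i x‖ₑ ^ 2) ^ (1/2 : ℝ)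
  have hT := mol_tendsto_L2 hf
  have hlim : Tendsto (fun m => eLpNorm (mol m f - f) 2 volume + C + eLpNorm (mol m f - f) 2 volume) atTop (𝓝 C) := by
    have := (hT.add (tendsto_const_nhds (x := C))).add hT
    simpa using this
  refine ge_of_tendsto hlim ?_
  filter_upwards [key] with m hm
  have e1 : mol k f - f = (mol k (f - mol m f)) + (mol k (mol m f) - mol m f) + (mol m f - f) := by
    rw [mol_sub k lf (lm m)]; abel
  have s1 : AEStronglyMeasurable (mol k (f - mol m f)) (volume.restrict A) :=
    (mol_contDiff k (lf.sub (lm m))).continuous.aestronglyMeasurable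
  have s2 : AEStronglyMeasurable (mol k (mol m f) - mol m f) (volume.restrict A) :=
    ((mol_contDiff k (lm m)).continuous.sub (mc m)).aestronglyMeasurable
  have s3 : AEStronglyMeasurable (mol m f - f) volume := (mc m).aestronglyMeasurable.sub hf.1
  rw [e1]
  refine (eLpNorm_add_le (s1.add s2) s3.restrict (by norm_num)).trans ?_
  refine add_le_add ((eLpNorm_add_le s1 s2 (by norm_num)).trans (add_le_add ?_ hm))
    (eLpNorm_mono_measure _ Measure.restrict_le_self)
  have := mol_eLp_le k (f := f - mol m f) (hf.1.sub (mc m).aestronglyMeasurable) hA MeasurableSet.univ (fun x _ => subset_univ _)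
  rw [Measure.restrict_univ, eLpNorm_sub_comm] at this
  exact this

/-- strong convergence from weak convergence + uniform mollification estimate -/
lemma strong_of_weak {f : ℕ → X → ℝ} {f0 : X → ℝ} (hf : ∀ j, MemLp (f j) 2 (volume : Measure X))
    (hf0 : MemLp f0 2 (volume : Measure X)) {C : ℝ≥0∞} (hC : C ≠ ⊤) (hbd : ∀ j, eLpNorm (f j) 2 volume ≤ C)
    (hw : ∀ ψ : X → ℝ, MemLp ψ 2 volume → Tendsto (fun j => ∫ x, ψ x * f j x) atTop (𝓝 (∫ x, ψ x * f0 x)))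
    {A : Set X} (hA : volume A ≠ ⊤) {c : ℕ → ℝ≥0∞} (hc : Tendsto c atTop (𝓝 0))
    (hu : ∀ᶠ k in atTop, ∀ j, eLpNorm (mol k (f j) - f j) 2 (volume.restrict A) ≤ c k) :
    Tendsto (fun j => eLpNorm (f j - f0) 2 (volume.restrict A)) atTop (𝓝 0) := by
  have lf := fun j => memLp_locallyIntegrable (hf j)
  have lf0 := memLp_locallyIntegrable hf0
  -- pointwise bound
  have hpb : ∀ k, ∃ M : ℝ≥0∞, M ≠ ⊤ ∧ ∀ g : X → ℝ, MemLp g 2 (volume : Measure X) → ∀ x,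
      ‖mol k g x‖ₑ ^ 2 ≤ M * eLpNorm g 2 volume ^ 2 := by
    intro k
    obtain ⟨M, hM⟩ := (ker_cont (X := X) k).bounded_above_of_compact_support (ker_cs k)
    refine ⟨ENNReal.ofReal M, by simp, fun g hg x => ?_⟩
    rw [mol_eq]
    refine (mol_sq_le k (fun t => g (x - t)) ?_).trans ?_
    · exact hg.1.comp_quasiMeasurePreserving (quasiMeasurePreserving_sub_left volume x)
    · calc _ ≤ ∫⁻ t, ENNReal.ofReal M * ‖g (x - t)‖ₑ ^ 2 := by
            refine lintegral_mono fun t => mul_le_mul_left ?_ _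
            exact ENNReal.ofReal_le_ofReal ((le_abs_self _).trans (hM t))
        _ = ENNReal.ofReal M * ∫⁻ t, ‖g (x - t)‖ₑ ^ 2 := lintegral_const_mul' _ _ (by simp)
        _ = _ := by
          rw [eLpNorm_two_sq, lintegral_sub_left_eq_self (fun t => ‖g t‖ₑ ^ 2) x]
  have hk : ∀ k, Tendsto (fun j => eLpNorm (mol k (f j) - mol k f0) 2 (volume.restrict A)) atTop (𝓝 0) := by
    intro k
    obtain ⟨M, hM, hMb⟩ := hpb k
    have hpt : ∀ x, Tendsto (fun j => mol k (f j) x) atTop (𝓝 (mol k f0 x)) := by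
      intro x
      have h1 : MemLp (fun t => ker k (x - t)) 2 (volume : Measure X) := by
        have hcs : HasCompactSupport (fun t : X => ker k (x - t)) :=
          (ker_cs k).comp_homeomorph (Homeomorph.subLeft x)
        exact ((ker_cont k).comp (by fun_prop)).memLp_of_hasCompactSupport hcs
      have := hw _ h1
      simpa only [mol_eq', smul_eq_mul] using this
    have h2 : Tendsto (fun j => ∫⁻ x in A, ‖(mol k (f j) - mol k f0) x‖ₑ ^ 2) atTop (𝓝 (∫⁻ x in A, 0)) := by
      refine tendsto_lintegral_of_dominated_convergence
        (fun _ => M * (C + eLpNorm f0 2 volume) ^ 2) (fun j => ?_) (fun j => ?_) ?_ ?_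
      · exact ((ENNReal.continuous_pow 2).comp (((mol_contDiff k (lf j)).continuous.sub (mol_contDiff k lf0).continuous).enorm)).measurable
      · refine ae_of_all _ fun x => ?_
        rw [← mol_sub k (lf j) lf0]
        refine (hMb _ ((hf j).sub hf0) x).trans ?_
        refine mul_le_mul_right (pow_le_pow_left' ?_ 2) _
        exact (eLpNorm_sub_le (hf j).1 hf0.1 (by norm_num)).trans (by gcongr; exact hbd j)
      · rw [lintegral_const, Measure.restrict_apply_univ]
        exact ENNReal.mul_ne_top (ENNReal.mul_ne_top hM (ENNReal.pow_ne_top (ENNReal.add_ne_top.2 ⟨hC, hf0.2.ne⟩))) hA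
      · refine ae_of_all _ fun x => ?_
        have h3 : Tendsto (fun j => (mol k (f j) - mol k f0) x) atTop (𝓝 0) := by
          simpa using (hpt x).sub_const (mol k f0 x)
        have h4 := ((ENNReal.continuous_pow 2).comp continuous_enorm).tendsto (0:ℝ)
        have h5 := h4.comp h3
        simpa [Function.comp_def] using h5
    rw [lintegral_zero] at h2
    have h6 := ((ENNReal.continuous_rpow_const (y := 1/2)).tendsto 0).comp h2
    have h7 : (0:ℝ≥0∞) ^ (1/2:ℝ) = 0 := ENNReal.zero_rpow_of_pos (by norm_num)
    rw [h7] at h6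
    refine h6.congr fun j => ?_
    simp only [Function.comp_apply]
    rw [← eLpNorm_two_sq, ← ENNReal.rpow_natCast, ← ENNReal.rpow_mul]
    norm_num
  rw [ENNReal.tendsto_nhds_zero]
  intro ε hε
  have hε3 : 0 < ε / 3 := ENNReal.div_pos hε.ne' (by norm_num)
  have g1 := (ENNReal.tendsto_nhds_zero.1 hc) _ hε3
  have g2 := (ENNReal.tendsto_nhds_zero.1 (mol_tendsto_L2 hf0)) _ hε3
  obtain ⟨k, k1, k2, k3⟩ := (hu.and (g1.and g2)).exists
  filter_upwards [(ENNReal.tendsto_nhds_zero.1 (hk k)) _ hε3] with j hj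
  have e1 : f j - f0 = -(mol k (f j) - f j) + (mol k (f j) - mol k f0) + (mol k f0 - f0) := by abel
  have s1 : AEStronglyMeasurable (mol k (f j) - f j) (volume.restrict A) :=
    ((mol_contDiff k (lf j)).continuous.aestronglyMeasurable.sub (hf j).1).restrict
  have s2 : AEStronglyMeasurable (mol k (f j) - mol k f0) (volume.restrict A) :=
    ((mol_contDiff k (lf j)).continuous.sub (mol_contDiff k lf0).continuous).aestronglyMeasurable
  have s3 : AEStronglyMeasurable (mol k f0 - f0) (volume.restrict A) :=
    ((mol_contDiff k lf0).continuous.aestronglyMeasurable.sub hf0.1).restrict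
  rw [e1]
  calc _ ≤ ε / 3 + ε / 3 + ε / 3 := by
        refine (eLpNorm_add_le (s1.neg.add s2) s3 (by norm_num)).trans ?_
        refine add_le_add ((eLpNorm_add_le s1.neg s2 (by norm_num)).trans (add_le_add ?_ hj)) ?_
        · rw [eLpNorm_neg]; exact (k1 j).trans k2
        · exact (eLpNorm_mono_measure _ Measure.restrict_le_self).trans k3
    _ = ε := ENNReal.add_thirds ε

end WD4
end CT

namespace CT
set_option linter.unusedSectionVars false
open scoped ENNReal Topology Convolution NNReal

section Ext
variable {X : Type*} [NormedAddCommGroup X] [InnerProductSpace ℝ X] [FiniteDimensional ℝ X]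
  [MeasurableSpace X] [BorelSpace X]

/-- weak sequential compactness in Hilbert spaces -/
lemma hilbert_weak {H : Type*} [NormedAddCommGroup H] [InnerProductSpace ℝ H] [CompleteSpace H]
    [TopologicalSpace.SeparableSpace H] (g : ℕ → H) {R : ℝ} (hR : ∀ j, ‖g j‖ ≤ R) :
    ∃ (G : H) (φ : ℕ → ℕ), StrictMono φ ∧ ∀ L : H →L[ℝ] ℝ, Tendsto (fun j => L (g (φ j))) atTop (𝓝 (L G)) := by
  have hc := WeakDual.isSeqCompact_closedBall ℝ H (0 : StrongDual ℝ H) R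
  obtain ⟨a, -, φ, hφ, ht⟩ := hc (x := fun j => StrongDual.toWeakDual (InnerProductSpace.toDual ℝ H (g j)))
    (fun j => by simpa using hR j)
  refine ⟨(InnerProductSpace.toDual ℝ H).symm (WeakDual.toStrongDual a), φ, hφ, fun L => ?_⟩
  have h1 : Continuous (fun z : WeakDual ℝ H => z ((InnerProductSpace.toDual ℝ H).symm L)) :=
    WeakDual.eval_continuous _
  have h2 := (h1.tendsto a).comp ht
  have h3 : ∀ x : H, L x = inner ℝ x ((InnerProductSpace.toDual ℝ H).symm L) := by
    intro x
    rw [real_inner_comm, InnerProductSpace.toDual_symm_apply]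
  rw [h3, InnerProductSpace.toDual_symm_apply]
  refine h2.congr fun j => ?_
  rw [h3]
  rfl

lemma exists_exhaustion {Ω : Set X} (hΩ : IsOpen Ω) : ∃ K : ℕ → Set X, (∀ m, IsCompact (K m)) ∧
    (∀ m, K m ⊆ Ω) ∧ ∀ K' ⊆ Ω, IsCompact K' → ∃ m, K' ⊆ K m := by
  have := hΩ.locallyCompactSpace
  set ce := CompactExhaustion.choice Ω
  refine ⟨fun m => (↑) '' (ce m), fun m => (ce.isCompact m).image continuous_subtype_val, fun m => ?_, fun K' h1 h2 => ?_⟩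
  · rintro _ ⟨x, -, rfl⟩; exact x.2
  · have h3 : IsCompact ((↑) ⁻¹' K' : Set Ω) := by
      rw [Subtype.isCompact_iff, Subtype.image_preimage_coe, inter_eq_self_of_subset_right h1]
      exact h2
    obtain ⟨m, hm⟩ := ce.exists_superset_of_isCompact h3
    exact ⟨m, fun x hx => ⟨⟨x, h1 hx⟩, hm hx, rfl⟩⟩

/-- `f j` converges weakly in `L²_loc(Ω)` -/
def WC (Ω : Set X) (f : ℕ → X → ℝ) (f0 : X → ℝ) : Prop :=
  LL Ω f0 ∧ ∀ K ⊆ Ω, IsCompact K → ∀ ψ : X → ℝ, MemLp ψ 2 (volume.restrict K) →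
    Tendsto (fun j => ∫ x in K, ψ x * f j x) atTop (𝓝 (∫ x in K, ψ x * f0 x))

lemma WC.subseq {Ω : Set X} {f : ℕ → X → ℝ} {f0 : X → ℝ} (h : WC Ω f f0) {φ : ℕ → ℕ} (hφ : StrictMono φ) :
    WC Ω (fun j => f (φ j)) f0 :=
  ⟨h.1, fun K h1 h2 ψ h3 => (h.2 K h1 h2 ψ h3).comp hφ.tendsto_atTop⟩

lemma weak_extract1 {Ω : Set X} (hΩ : IsOpen Ω) {f : ℕ → X → ℝ} (hf : ∀ j, LL Ω (f j))
    (hb : ∀ K ⊆ Ω, IsCompact K → ∃ C : ℝ≥0, ∀ j, ∫⁻ x in K, ‖f j x‖ₑ ^ 2 ≤ C) :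
    ∃ φ : ℕ → ℕ, StrictMono φ ∧ ∃ f0 : X → ℝ, WC Ω (fun j => f (φ j)) f0 := by
  obtain ⟨K, hKc, hKΩ, hKs⟩ := exists_exhaustion hΩ
  choose B hB using fun m => hb (K m) (hKΩ m) (hKc m)
  set c : ℕ → ℝ≥0 := fun m => (2⁻¹ : ℝ≥0) ^ m / (B m + 1) with hc
  have hcpos : ∀ m, 0 < c m := fun m => by positivity
  set μ : Measure X := Measure.sum (fun m => (c m : ℝ≥0∞) • volume.restrict (K m)) with hμ
  have hle : ∀ m, volume.restrict (K m) ≤ ((c m : ℝ≥0∞)⁻¹) • μ := by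
    intro m
    have h1 : (c m : ℝ≥0∞) • volume.restrict (K m) ≤ μ :=
      Measure.le_sum (fun m => (c m : ℝ≥0∞) • volume.restrict (K m)) m
    have h2 : volume.restrict (K m) = ((c m : ℝ≥0∞)⁻¹) • ((c m : ℝ≥0∞) • volume.restrict (K m)) := by
      rw [smul_smul, ENNReal.inv_mul_cancel (by exact_mod_cast (hcpos m).ne') (by simp), one_smul]
    rw [h2]
    intro s
    simp only [Measure.smul_apply, smul_eq_mul]
    exact mul_le_mul_right (h1 s) _
  have hci : ∀ m, ((c m : ℝ≥0∞)⁻¹) ≠ ⊤ := fun m => by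
    rw [ENNReal.inv_ne_top]; exact_mod_cast (hcpos m).ne'
  have hmeas : ∀ j, AEStronglyMeasurable (f j) μ := by
    intro j
    rw [hμ, aestronglyMeasurable_sum_measure_iff]
    intro m
    exact (hf j (K m) (hKΩ m) (hKc m)).1.smul_measure _
  have hnorm : ∀ j, eLpNorm (f j) 2 μ ^ 2 ≤ 2 := by
    intro j
    rw [eLpNorm_two_sq, hμ, lintegral_sum_measure]
    calc _ ≤ ∑' m : ℕ, (2⁻¹ : ℝ≥0∞) ^ m := by
          refine ENNReal.tsum_le_tsum fun m => ?_
          rw [lintegral_smul_measure, smul_eq_mul]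
          refine (mul_le_mul_right (hB m j) _).trans ?_
          have : c m * B m ≤ (2⁻¹ : ℝ≥0) ^ m := by
            rw [hc]; dsimp only
            rw [div_mul_eq_mul_div, div_le_iff₀ (by positivity)]
            exact mul_le_mul_right (le_add_of_nonneg_right zero_le_one) _
          have h2 : ((c m * B m : ℝ≥0) : ℝ≥0∞) ≤ (((2⁻¹ : ℝ≥0) ^ m : ℝ≥0) : ℝ≥0∞) := by exact_mod_cast this
          rw [ENNReal.coe_mul, ENNReal.coe_pow, ENNReal.coe_inv two_ne_zero] at h2
          exact h2
      _ = 2 := by rw [ENNReal.tsum_geometric]; norm_num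
  have hmem : ∀ j, MemLp (f j) 2 μ := fun j => ⟨hmeas j, by
    have : eLpNorm (f j) 2 μ ^ 2 < ⊤ := lt_of_le_of_lt (hnorm j) (by norm_num)
    simpa using this⟩
  have hn2 : ∀ j, ‖(hmem j).toLp (f j)‖ ≤ 2 := by
    intro j
    rw [Lp.norm_toLp]
    refine ENNReal.toReal_le_of_le_ofReal (by norm_num) ?_
    have : eLpNorm (f j) 2 μ ^ 2 ≤ 2 ^ 2 := (hnorm j).trans (by norm_num)
    simpa using (ENNReal.pow_le_pow_left_iff two_ne_zero).1 this
  have : Fact ((2:ℝ≥0∞) ≠ ⊤) := ⟨by norm_num⟩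
  have : TopologicalSpace.SeparableSpace (Lp ℝ 2 μ) := inferInstance
  obtain ⟨G, φ, hφ, hG⟩ := hilbert_weak (fun j => (hmem j).toLp (f j)) hn2
  refine ⟨φ, hφ, G, ?_, ?_⟩
  · intro K' h1 h2
    obtain ⟨m, hm⟩ := hKs K' h1 h2
    exact ((Lp.memLp G).of_measure_le_smul (hci m) (hle m)).mono_measure (Measure.restrict_mono hm le_rfl)
  · intro K' h1 h2 ψ hψ
    obtain ⟨m, hm⟩ := hKs K' h1 h2
    have hle' : volume.restrict K' ≤ ((c m : ℝ≥0∞)⁻¹) • μ := (Measure.restrict_mono hm le_rfl).trans (hle m)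
    have hac : volume.restrict K' ≪ μ := Measure.absolutelyContinuous_of_le_smul hle'
    set T := Lp.LpToLpOfMeasureLeSMul (E := ℝ) (p := 2) (hci m) hle'
    have hL : ∀ (g : X → ℝ) (hg : MemLp g 2 μ), ((innerSL ℝ (hψ.toLp ψ)).comp T) (hg.toLp g) = ∫ x in K', ψ x * g x := by
      intro g hg
      simp only [ContinuousLinearMap.comp_apply, innerSL_apply_apply, L2.inner_def]
      refine integral_congr_ae ?_
      filter_upwards [hψ.coeFn_toLp, Lp.coeFn_LpToLpOfMeasureLeSMul (hci m) hle' (hg.toLp g), hac.ae_le hg.coeFn_toLp] with x a1 a2 a3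
      rw [a1, a2, a3]; simp [mul_comm]
    have := hG ((innerSL ℝ (hψ.toLp ψ)).comp T)
    have e1 := hL G (Lp.memLp G)
    rw [Lp.toLp_coeFn] at e1
    rw [e1] at this
    exact this.congr fun j => hL _ (hmem (φ j))

lemma weak_extract {ι : Type*} [Fintype ι] {Ω : Set X} (hΩ : IsOpen Ω) {f : ℕ → ι → X → ℝ} (hf : ∀ j i, LL Ω (f j i))
    (hb : ∀ K ⊆ Ω, IsCompact K → ∃ C : ℝ≥0, ∀ j i, ∫⁻ x in K, ‖f j i x‖ₑ ^ 2 ≤ C) :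
    ∃ φ : ℕ → ℕ, StrictMono φ ∧ ∃ f0 : ι → X → ℝ, ∀ i, WC Ω (fun j => f (φ j) i) (f0 i) := by
  classical
  have key : ∀ s : Finset ι, ∃ φ : ℕ → ℕ, StrictMono φ ∧ ∀ i ∈ s, ∃ f0 : X → ℝ, WC Ω (fun j => f (φ j) i) f0 := by
    intro s
    induction s using Finset.induction_on with
    | empty => exact ⟨id, strictMono_id, by simp⟩
    | insert a s ha ih =>
      obtain ⟨φ, hφ, h⟩ := ih
      obtain ⟨φ', hφ', f0, h0⟩ := weak_extract1 hΩ (f := fun j => f (φ j) a) (fun j => hf _ _) (fun K h1 h2 => by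
        obtain ⟨C, hC⟩ := hb K h1 h2
        exact ⟨C, fun j => hC _ _⟩)
      refine ⟨φ ∘ φ', hφ.comp hφ', fun i hi => ?_⟩
      rcases Finset.mem_insert.1 hi with rfl | hi
      · exact ⟨f0, h0⟩
      · obtain ⟨f1, h1⟩ := h i hi
        exact ⟨f1, h1.subseq hφ'⟩
  obtain ⟨φ, hφ, h⟩ := key Finset.univ
  choose f0 h0 using fun i => h i (Finset.mem_univ i)
  exact ⟨φ, hφ, f0, h0⟩

end Ext
end CT

namespace CT
set_option linter.unusedSectionVars false
open scoped ENNReal Topology Convolution NNReal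

section GMsec
variable {X : Type*} [NormedAddCommGroup X] [InnerProductSpace ℝ X] [FiniteDimensional ℝ X]
  [MeasurableSpace X] [BorelSpace X]
variable {Y : Type*} [NormedAddCommGroup Y] [NormedSpace ℝ Y]
variable {ι : Type*} [Fintype ι]

/-- energy density -/
def ed (D : ι → X → Y) (x : X) : ℝ := ∑ i, ‖D i x‖ ^ 2

/-- sphere valued Sobolev maps -/
def GM (b : OrthonormalBasis ι ℝ X) (Ω : Set X) (u : X → Y) (D : ι → X → Y) : Prop :=
  (∀ i, WD Ω (b i) u (D i)) ∧ ∀ᵐ x ∂(volume.restrict Ω), ‖u x‖ = 1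

/-- minimizers -/
def Mz (b : OrthonormalBasis ι ℝ X) (Ω : Set X) (u : X → Y) (D : ι → X → Y) : Prop :=
  GM b Ω u D ∧ ∀ (y : X) (ρ : ℝ), 0 < ρ → closedBall y ρ ⊆ Ω → ∀ (w : X → Y) (Dw : ι → X → Y),
    GM b Ω w Dw → (∃ σ : ℝ, σ < ρ ∧ ∀ᵐ x ∂volume.restrict (Ω \ ball y σ), w x = u x) →
      ∫ x in ball y ρ, ed D x ≤ ∫ x in ball y ρ, ed Dw x

lemma ed_nonneg (D : ι → X → Y) (x : X) : 0 ≤ ed D x := Finset.sum_nonneg fun _ _ => by positivity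

lemma LL.integrableOn_sq {Ω : Set X} {f : X → Y} (h : LL Ω f) {K : Set X} (hK : K ⊆ Ω)
    (hc : IsCompact K) : IntegrableOn (fun x => ‖f x‖ ^ 2) K volume :=
  (h K hK hc).integrable_norm_pow two_ne_zero

lemma GM.ed_int {b : OrthonormalBasis ι ℝ X} {Ω : Set X} {u : X → Y} {D : ι → X → Y} (h : GM b Ω u D)
    {K : Set X} (hK : K ⊆ Ω) (hc : IsCompact K) : IntegrableOn (ed D) K volume :=
  integrable_finsetSum _ fun i _ => (h.1 i).2.1.integrableOn_sq hK hc

end GMsec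

section Conv
variable {n p : ℕ}

lemma ed_eq (g : EuclideanSpace ℝ (Fin n) → (EuclideanSpace ℝ (Fin n) →L[ℝ] EuclideanSpace ℝ (Fin p))) :
    energyDensity n p g = ed (fun i x => g x (EuclideanSpace.single i 1)) := by
  funext x
  simp only [energyDensity, ed, EuclideanSpace.real_norm_sq_eq]

lemma comp_integral {f : EuclideanSpace ℝ (Fin n) → EuclideanSpace ℝ (Fin p)} (hf : Integrable f volume) (j : Fin p) :
    (∫ x, f x) j = ∫ x, f x j := by
  have := (EuclideanSpace.proj j : EuclideanSpace ℝ (Fin p) →L[ℝ] ℝ).integral_comp_comm hf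
  simpa using this.symm

lemma conv1 {Ω : Set (EuclideanSpace ℝ (Fin n))}
    {u : EuclideanSpace ℝ (Fin n) → EuclideanSpace ℝ (Fin p)}
    {g : EuclideanSpace ℝ (Fin n) → (EuclideanSpace ℝ (Fin n) →L[ℝ] EuclideanSpace ℝ (Fin p))}
    (h1 : HasWeakGradient n p Ω u g) (h2 : LocallyIntegrableOn (energyDensity n p g) Ω volume)
    (h3 : ∀ᵐ x ∂volume.restrict Ω, ‖u x‖ = 1) :
    GM (EuclideanSpace.basisFun (Fin n) ℝ) Ω u (fun i x => g x (EuclideanSpace.single i 1)) := by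
  refine ⟨fun i => ?_, h3⟩
  have hLu : LL Ω u := LL.of_bdd (fun K hK hc => (h1.1.integrableOn_compact_subset hK hc).1) (C := 1)
    (h3.mono fun x hx => hx.le)
  have hLg : LL Ω (fun x => g x (EuclideanSpace.single i 1)) := by
    intro K hK hc
    have hm : AEStronglyMeasurable (fun x => g x (EuclideanSpace.single i 1)) (volume.restrict K) :=
      (ContinuousLinearMap.apply ℝ (EuclideanSpace ℝ (Fin p)) (EuclideanSpace.single i (1:ℝ))).continuous.comp_aestronglyMeasurable
        (h1.2.1.integrableOn_compact_subset hK hc).1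
    rw [memLp_two_iff_integrable_sq_norm hm]
    refine (h2.integrableOn_compact_subset hK hc).mono' (hm.norm.pow 2) (ae_of_all _ fun x => ?_)
    rw [ed_eq, ed, Real.norm_eq_abs, abs_of_nonneg (by positivity)]
    exact Finset.single_le_sum (f := fun i => ‖g x (EuclideanSpace.single i 1)‖ ^ 2) (fun _ _ => by positivity) (Finset.mem_univ i)
  refine ⟨hLu, hLg, fun φ a1 a2 a3 => ?_⟩
  simp only [EuclideanSpace.basisFun_apply]
  ext j
  have i1 := hLu.integrable_fderiv_smul a1 a2 a3 (EuclideanSpace.single i 1)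
  have i2 := hLg.integrable_smul a1.continuous a2 a3
  rw [comp_integral i1, PiLp.neg_apply, comp_integral i2]
  have := h1.2.2 φ a1 a2 a3 i j
  rw [setIntegral_eq_integral_of_forall_compl_eq_zero, setIntegral_eq_integral_of_forall_compl_eq_zero] at this
  · simpa [mul_comm] using this
  · intro x hx
    rw [image_eq_zero_of_notMem_tsupport (fun h => hx (a3 h)), zero_mul]
  · intro x hx
    rw [image_eq_zero_of_notMem_tsupport (f := fun x => fderiv ℝ φ x (EuclideanSpace.single i 1))
      (fun h => hx (a3 (tsupport_fderiv_sub φ _ h))), mul_zero]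

/-- rank one maps -/
def mkL (i : Fin n) : EuclideanSpace ℝ (Fin p) →L[ℝ] (EuclideanSpace ℝ (Fin n) →L[ℝ] EuclideanSpace ℝ (Fin p)) :=
  ContinuousLinearMap.smulRightL ℝ _ _ (EuclideanSpace.proj i : EuclideanSpace ℝ (Fin n) →L[ℝ] ℝ)

/-- assemble a gradient -/
def mkg (D : Fin n → EuclideanSpace ℝ (Fin n) → EuclideanSpace ℝ (Fin p)) (x : EuclideanSpace ℝ (Fin n)) :
    EuclideanSpace ℝ (Fin n) →L[ℝ] EuclideanSpace ℝ (Fin p) :=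
  ∑ i, mkL i (D i x)

lemma mkg_apply (D : Fin n → EuclideanSpace ℝ (Fin n) → EuclideanSpace ℝ (Fin p)) (x : EuclideanSpace ℝ (Fin n)) (i : Fin n) :
    mkg D x (EuclideanSpace.single i 1) = D i x := by
  simp [mkg, mkL]

lemma conv2 {Ω : Set (EuclideanSpace ℝ (Fin n))} (hΩ : IsOpen Ω)
    {u : EuclideanSpace ℝ (Fin n) → EuclideanSpace ℝ (Fin p)}
    {D : Fin n → EuclideanSpace ℝ (Fin n) → EuclideanSpace ℝ (Fin p)}
    (h : GM (EuclideanSpace.basisFun (Fin n) ℝ) Ω u D) (hn : 0 < n) :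
    HasWeakGradient n p Ω u (mkg D) ∧ LocallyIntegrableOn (energyDensity n p (mkg D)) Ω volume := by
  have hlc := hΩ.isLocallyClosed
  have hLu := (h.1 ⟨0, hn⟩).1
  refine ⟨⟨?_, ?_, ?_⟩, ?_⟩
  · rw [locallyIntegrableOn_iff hlc]
    exact fun K hK hc => hLu.integrableOn hK hc
  · rw [locallyIntegrableOn_iff hlc]
    intro K hK hc
    have hi : ∀ i ∈ (Finset.univ : Finset (Fin n)), Integrable (fun x => mkL i (D i x)) (volume.restrict K) :=
      fun i _ => (mkL i).integrable_comp ((h.1 i).2.1.integrableOn hK hc)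
    have e : mkg D = fun x => ∑ i, mkL i (D i x) := rfl
    have hs := integrable_finsetSum (f := fun i x => mkL i (D i x)) Finset.univ hi
    rw [e]
    exact hs
  · intro φ a1 a2 a3 i j
    have i1 := hLu.integrable_fderiv_smul a1 a2 a3 (EuclideanSpace.single i 1)
    have i2 := (h.1 i).2.1.integrable_smul a1.continuous a2 a3
    have := (h.1 i).2.2 φ a1 a2 a3
    simp only [EuclideanSpace.basisFun_apply] at this
    have := congrArg (fun v => v j) this
    dsimp only at this
    rw [comp_integral i1, PiLp.neg_apply, comp_integral i2] at this
    rw [setIntegral_eq_integral_of_forall_compl_eq_zero, setIntegral_eq_integral_of_forall_compl_eq_zero]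
    · simpa [mul_comm, mkg_apply] using this
    · intro x hx
      rw [image_eq_zero_of_notMem_tsupport (fun h => hx (a3 h)), zero_mul]
    · intro x hx
      rw [image_eq_zero_of_notMem_tsupport (f := fun x => fderiv ℝ φ x (EuclideanSpace.single i 1))
        (fun h => hx (a3 (tsupport_fderiv_sub φ _ h))), mul_zero]
  · rw [locallyIntegrableOn_iff hlc, ed_eq]
    simp only [mkg_apply]
    exact fun K hK hc => h.ed_int hK hc

lemma em_to_Mz {Ω : Set (EuclideanSpace ℝ (Fin n))} (hΩ : IsOpen Ω) (hn : 0 < n)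
    {u : EuclideanSpace ℝ (Fin n) → EuclideanSpace ℝ (Fin p)}
    {g : EuclideanSpace ℝ (Fin n) → (EuclideanSpace ℝ (Fin n) →L[ℝ] EuclideanSpace ℝ (Fin p))}
    (h : IsEnergyMinimizingToSphere n p Ω u g) :
    Mz (EuclideanSpace.basisFun (Fin n) ℝ) Ω u (fun i x => g x (EuclideanSpace.single i 1)) := by
  refine ⟨conv1 h.1 h.2.1 h.2.2.1, fun y ρ hρ hB w Dw hw hs => ?_⟩
  obtain ⟨c1, c2⟩ := conv2 hΩ hw hn
  have := h.2.2.2 y ρ hρ hB w (mkg Dw) c1 c2 hw.2 hs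
  rw [ed_eq, ed_eq] at this
  simpa only [mkg_apply] using this

lemma Mz_to_em {Ω : Set (EuclideanSpace ℝ (Fin n))} (hΩ : IsOpen Ω) (hn : 0 < n)
    {u : EuclideanSpace ℝ (Fin n) → EuclideanSpace ℝ (Fin p)}
    {D : Fin n → EuclideanSpace ℝ (Fin n) → EuclideanSpace ℝ (Fin p)}
    (h : Mz (EuclideanSpace.basisFun (Fin n) ℝ) Ω u D) :
    IsEnergyMinimizingToSphere n p Ω u (mkg D) := by
  obtain ⟨c1, c2⟩ := conv2 hΩ h.1 hn
  refine ⟨c1, c2, h.1.2, fun y ρ hρ hB w g a1 a2 a3 hs => ?_⟩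
  have := h.2 y ρ hρ hB w _ (conv1 a1 a2 a3) hs
  rw [ed_eq, ed_eq]
  simpa only [mkg_apply] using this

end Conv
end CT

namespace CT
set_option linter.unusedSectionVars false
open scoped ENNReal Topology Convolution NNReal

section Extr
variable {X : Type*} [NormedAddCommGroup X] [InnerProductSpace ℝ X] [FiniteDimensional ℝ X]
  [MeasurableSpace X] [BorelSpace X]
variable {E : Type*} [NormedAddCommGroup E] [NormedSpace ℝ E]
variable {ι κ : Type*} [Fintype ι] [Fintype κ]

lemma WD.zero {Ω : Set X} {e : X} : WD Ω e (fun _ => (0:E)) (fun _ => 0) :=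
  ⟨LL.of_continuous continuous_const, LL.of_continuous continuous_const, fun φ _ _ _ => by simp⟩

lemma WD.sum {Ω : Set X} {e : X} {f h : κ → X → E} (H : ∀ a, WD Ω e (f a) (h a)) (s : Finset κ) :
    WD Ω e (fun x => ∑ a ∈ s, f a x) (fun x => ∑ a ∈ s, h a x) := by
  classical
  induction s using Finset.induction_on with
  | empty => simpa using WD.zero
  | insert a s ha ih =>
    simp only [Finset.sum_insert ha]
    exact (H a).add ih

lemma toLp_sum [DecidableEq κ] (v : EuclideanSpace ℝ κ) :
    ∑ a, (ContinuousLinearMap.toSpanSingleton ℝ (EuclideanSpace.single a (1:ℝ))) (v a) = v := by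
  have := (EuclideanSpace.basisFun κ ℝ).sum_repr v
  simpa [ContinuousLinearMap.toSpanSingleton_apply] using this

lemma WD.of_comp {Ω : Set X} {e : X} {f h : X → EuclideanSpace ℝ κ}
    (H : ∀ a, WD Ω e (fun x => f x a) (fun x => h x a)) : WD Ω e f h := by
  classical
  have := WD.sum (fun a => (H a).clm (ContinuousLinearMap.toSpanSingleton ℝ (EuclideanSpace.single a (1:ℝ)))) Finset.univ
  simpa only [toLp_sum] using this

lemma WD.comp_a {Ω : Set X} {e : X} {f h : X → EuclideanSpace ℝ κ} (H : WD Ω e f h) (a : κ) :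
    WD Ω e (fun x => f x a) (fun x => h x a) :=
  H.clm (EuclideanSpace.proj a : EuclideanSpace ℝ κ →L[ℝ] ℝ)

lemma WC.WD {Ω : Set X} {e : X} {f h : ℕ → X → ℝ} {f0 h0 : X → ℝ}
    (H : ∀ j, WD Ω e (f j) (h j)) (hf : WC Ω f f0) (hh : WC Ω h h0) : WD Ω e f0 h0 := by
  have L : ∀ {f : ℕ → X → ℝ} {f0 : X → ℝ}, WC Ω f f0 →
       ∀ φ : X → ℝ, Continuous φ → HasCompactSupport φ → tsupport φ ⊆ Ω →
        Tendsto (fun k => ∫ x, φ x • f k x) atTop (𝓝 (∫ x, φ x • f0 x)) := by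
    intro f f0 hf φ h1 h2 h3
    have := hf.2 (tsupport φ) h3 h2 φ ((h1.memLp_of_hasCompactSupport h2).restrict _)
    have z0 : ∀ G : X → ℝ, ∫ x in tsupport φ, φ x * G x = ∫ x, φ x • G x := fun G =>
      setIntegral_eq_integral_of_forall_compl_eq_zero fun x hx => by
        rw [image_eq_zero_of_notMem_tsupport hx, zero_mul]
    simpa only [z0] using this
  refine ⟨hf.1, hh.1, fun φ h1 h2 h3 => ?_⟩
  have t1 := L hf (fun x => fderiv ℝ φ x e) ((h1.continuous_fderiv (by simp)).clm_apply continuous_const)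
    (h2.fderiv_apply ℝ e) ((tsupport_fderiv_sub φ e).trans h3)
  have t2 := L hh φ h1.continuous h2 h3
  exact tendsto_nhds_unique t1 (t2.neg.congr fun k => ((H k).2.2 φ h1 h2 h3).symm)

lemma enorm_sq_le_ed {Y : Type*} [NormedAddCommGroup Y] (D : ι → X → Y) (i : ι) (x : X) :
    ‖D i x‖ₑ ^ 2 ≤ ENNReal.ofReal (ed D x) := by
  rw [← ofReal_norm, ← ENNReal.ofReal_pow (norm_nonneg _)]
  exact ENNReal.ofReal_le_ofReal (Finset.single_le_sum (f := fun i => ‖D i x‖ ^ 2) (fun _ _ => by positivity) (Finset.mem_univ i))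

lemma compact_bound {b : OrthonormalBasis ι ℝ X} {Ω : Set X} (hΩ : IsOpen Ω) {u : ℕ → X → E} {D : ℕ → ι → X → E}
    (h : ∀ j, GM b Ω (u j) (D j))
    (hbd : ∀ (y : X) (ρ : ℝ), 0 < ρ → closedBall y ρ ⊆ Ω → ∃ C : ℝ, ∀ j, ∫ x in ball y ρ, ed (D j) x ≤ C)
    {K : Set X} (hK : K ⊆ Ω) (hc : IsCompact K) : ∃ C : ℝ≥0, ∀ j, ∫⁻ x in K, ENNReal.ofReal (ed (D j) x) ≤ C := by
  refine hc.induction_on (p := fun s => ∃ C : ℝ≥0, ∀ j, ∫⁻ x in s, ENNReal.ofReal (ed (D j) x) ≤ C) ⟨0, by simp⟩ ?_ ?_ ?_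
  · rintro s t hst ⟨C, hC⟩
    exact ⟨C, fun j => (lintegral_mono_set hst).trans (hC j)⟩
  · rintro s t ⟨C, hC⟩ ⟨C', hC'⟩
    refine ⟨C + C', fun j => (lintegral_union_le _ _ _).trans ?_⟩
    rw [ENNReal.coe_add]
    exact add_le_add (hC j) (hC' j)
  · intro x hx
    obtain ⟨r, hr, hrΩ⟩ := nhds_basis_closedBall.mem_iff.1 (hΩ.mem_nhds (hK hx))
    obtain ⟨C, hC⟩ := hbd x r hr hrΩ
    refine ⟨ball x r, mem_nhdsWithin_of_mem_nhds (ball_mem_nhds x hr), C.toNNReal, fun j => ?_⟩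
    rw [← ofReal_integral_eq_lintegral_ofReal]
    · exact ENNReal.ofReal_le_ofReal (hC j)
    · exact ((h j).ed_int hrΩ (isCompact_closedBall x r)).mono_set ball_subset_closedBall
    · exact ae_of_all _ fun x => ed_nonneg _ _

lemma eLp_comp_le {μ : Measure X} {f : X → EuclideanSpace ℝ κ} (hf : ∀ a, AEStronglyMeasurable (fun x => f x a) μ) :
    eLpNorm f 2 μ ≤ ∑ a, eLpNorm (fun x => f x a) 2 μ := by
  classical
  refine le_trans (le_of_eq ?_) ((eLpNorm_sum_le (p := 2) (μ := μ) (s := Finset.univ)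
    (f := fun a x => (ContinuousLinearMap.toSpanSingleton ℝ (EuclideanSpace.single a (1:ℝ))) (f x a)) (fun a _ => ?_) (by norm_num)).trans
    (Finset.sum_le_sum fun a _ => le_of_eq ?_))
  · congr 1; funext x; rw [Finset.sum_apply, toLp_sum]
  · exact (ContinuousLinearMap.toSpanSingleton ℝ (EuclideanSpace.single a (1:ℝ))).continuous.comp_aestronglyMeasurable (hf a)
  · refine eLpNorm_congr_norm_ae (ae_of_all _ fun x => ?_)
    simp [ContinuousLinearMap.toSpanSingleton_apply, norm_smul]

lemma strong_u {b : OrthonormalBasis ι ℝ X} {Ω : Set X} (hΩ : IsOpen Ω) {f : ℕ → X → ℝ} {D : ℕ → ι → X → ℝ} {f0 : X → ℝ}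
    (H : ∀ j i, WD Ω (b i) (f j) (D j i))
    (hb : ∀ K ⊆ Ω, IsCompact K → ∃ C : ℝ≥0, ∀ j, ∫⁻ x in K, ‖f j x‖ₑ ^ 2 ≤ C)
    (hb' : ∀ K ⊆ Ω, IsCompact K → ∃ C : ℝ≥0, ∀ j i, ∫⁻ x in K, ‖D j i x‖ₑ ^ 2 ≤ C)
    (hLf : ∀ j, LL Ω (f j))
    (hw : WC Ω f f0) {K : Set X} (hK : K ⊆ Ω) (hKc : IsCompact K) :
    Tendsto (fun j => eLpNorm (f j - f0) 2 (volume.restrict K)) atTop (𝓝 0) := by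
  obtain ⟨K1, K1c, hKK1, hK1⟩ := exists_compact_between hKc hΩ hK
  obtain ⟨K2, K2c, hK12, hK2⟩ := exists_compact_between K1c hΩ hK1
  obtain ⟨C, hC⟩ := hb K2 hK2 K2c
  obtain ⟨C', hC'⟩ := hb' K2 hK2 K2c
  have mf : ∀ j, MemLp (K2.indicator (f j)) 2 volume := fun j => (hLf j).indicator hK2 K2c
  have key := strong_of_weak (f := fun j => K2.indicator (f j)) (f0 := K2.indicator f0) mf
    (hw.1.indicator hK2 K2c) (C := (C : ℝ≥0∞) + 1) (by simp) (fun j => ?_) (fun ψ hψ => ?_) (A := K) hKc.measure_lt_top.ne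
    (c := fun k => ENNReal.ofReal (dl k) * (Fintype.card ι * C') ^ (1/2 : ℝ)) ?_ ?_
  · refine key.congr fun j => eLpNorm_congr_ae ?_
    refine (ae_restrict_iff' hKc.measurableSet).2 (ae_of_all _ fun x hx => ?_)
    have : x ∈ K2 := interior_subset (hK12 (interior_subset (hKK1 hx)))
    simp [this]
  · have h1 : eLpNorm (K2.indicator (f j)) 2 volume ^ 2 ≤ C := by
      rw [eLpNorm_indicator_eq_eLpNorm_restrict K2c.measurableSet, eLpNorm_two_sq]; exact hC j
    refine (ENNReal.pow_le_pow_left_iff two_ne_zero).1 (h1.trans ?_)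
    have : (1:ℝ≥0∞) ≤ (C:ℝ≥0∞) + 1 := le_add_self
    calc (C:ℝ≥0∞) ≤ (C + 1) * 1 := by rw [mul_one]; exact le_self_add
      _ ≤ (C+1) * (C+1) := mul_le_mul_right this _
      _ = _ := by ring
  · have z0 : ∀ G : X → ℝ, ∫ x, ψ x * K2.indicator G x = ∫ x in K2, ψ x * G x := by
      intro G
      rw [← integral_indicator K2c.measurableSet]
      congr 1; funext x
      by_cases hx : x ∈ K2 <;> simp [hx]
    simp only [z0]
    exact hw.2 K2 hK2 K2c ψ (hψ.restrict _)
  · have h1 : Tendsto (fun k => ENNReal.ofReal (dl k)) atTop (𝓝 0) := by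
      simpa using ENNReal.tendsto_ofReal dl_tendsto
    have := ENNReal.Tendsto.mul_const (b := ((Fintype.card ι : ℝ≥0∞) * C') ^ (1/2 : ℝ)) h1
      (Or.inr (ENNReal.rpow_ne_top_of_nonneg (by norm_num) (ENNReal.mul_ne_top (by simp) (by simp))))
    simpa using this
  · filter_upwards [exists_dl hKc isOpen_interior hKK1] with k hk j
    have := trans_WD b isOpen_interior (mf j) (h := fun i => K2.indicator (D j i)) (fun i => (H j i).2.1.indicator hK2 K2c)
      (fun i => (H j i).indicator hK2) (k := k) hKc.measurableSet K1c hK12 (fun x hx => (hk x hx).trans interior_subset)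
    refine this.trans (mul_le_mul_right (ENNReal.rpow_le_rpow ?_ (by norm_num)) _)
    calc _ ≤ ∑ i : ι, (C' : ℝ≥0∞) := by
          refine Finset.sum_le_sum fun i _ => ?_
          refine le_trans (le_trans (lintegral_mono_set interior_subset) (le_of_eq ?_)) (hC' j i)
          refine setLIntegral_congr_fun K2c.measurableSet fun x hx => ?_
          simp [hx]
      _ = _ := by simp

lemma extract {b : OrthonormalBasis ι ℝ X} [Nonempty ι] {Ω : Set X} (hΩ : IsOpen Ω) {u : ℕ → X → EuclideanSpace ℝ κ}
    {D : ℕ → ι → X → EuclideanSpace ℝ κ}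
    (h : ∀ j, GM b Ω (u j) (D j))
    (hbd : ∀ (y : X) (ρ : ℝ), 0 < ρ → closedBall y ρ ⊆ Ω → ∃ C : ℝ, ∀ j, ∫ x in ball y ρ, ed (D j) x ≤ C) :
    ∃ φ : ℕ → ℕ, StrictMono φ ∧ ∃ (u0 : X → EuclideanSpace ℝ κ) (D0 : ι → X → EuclideanSpace ℝ κ),
      GM b Ω u0 D0 ∧ (∀ K ⊆ Ω, IsCompact K → Tendsto (fun j => eLpNorm (u (φ j) - u0) 2 (volume.restrict K)) atTop (𝓝 0)) ∧
      ∀ i a, WC Ω (fun j x => D (φ j) i x a) (fun x => D0 i x a) := by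
  have i0 : ι := Classical.arbitrary ι
  have hcmp : ∀ (v : EuclideanSpace ℝ κ) a, ‖v a‖ₑ ≤ ‖v‖ₑ := fun v a => by
    rw [← ofReal_norm, ← ofReal_norm]; exact ENNReal.ofReal_le_ofReal (PiLp.norm_apply_le v a)
  have bu : ∀ K ⊆ Ω, IsCompact K → ∃ C : ℝ≥0, ∀ j a, ∫⁻ x in K, ‖u j x a‖ₑ ^ 2 ≤ C := by
    intro K hK hc
    refine ⟨(volume K).toNNReal, fun j a => ?_⟩
    rw [ENNReal.coe_toNNReal hc.measure_lt_top.ne]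
    calc _ ≤ ∫⁻ x in K, 1 := by
          refine lintegral_mono_ae ?_
          filter_upwards [ae_restrict_of_ae_restrict_of_subset hK (h j).2] with x hx
          refine (pow_le_one₀ bot_le ((hcmp _ a).trans ?_))
          rw [← ofReal_norm, hx]; simp
      _ = _ := by simp
  have bD : ∀ K ⊆ Ω, IsCompact K → ∃ C : ℝ≥0, ∀ j i a, ∫⁻ x in K, ‖D j i x a‖ₑ ^ 2 ≤ C := by
    intro K hK hc
    obtain ⟨C, hC⟩ := compact_bound hΩ h hbd hK hc
    refine ⟨C, fun j i a => le_trans (lintegral_mono fun x => ?_) (hC j)⟩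
    exact (pow_le_pow_left' (hcmp _ a) 2).trans (enorm_sq_le_ed _ i x)
  have LLu : ∀ j a, LL Ω (fun x => u j x a) := fun j a => (((h j).1 i0).comp_a a).1
  obtain ⟨φ, hφ, f0, hf0⟩ := weak_extract (ι := Option ι × κ) hΩ
    (f := fun j q => match q.1 with
      | none => fun x => u j x q.2
      | some i => fun x => D j i x q.2) (by
      rintro j ⟨_ | i, a⟩
      · exact LLu j a
      · exact (((h j).1 i).comp_a a).2.1) (by
      intro K hK hc
      obtain ⟨C, hC⟩ := bu K hK hc
      obtain ⟨C', hC'⟩ := bD K hK hc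
      refine ⟨max C C', ?_⟩
      rintro j ⟨_ | i, a⟩
      · exact (hC j a).trans (by simp)
      · exact (hC' j i a).trans (by simp))
  have wu : ∀ a, WC Ω (fun j x => u (φ j) x a) (f0 (none, a)) := fun a => hf0 (none, a)
  have wD : ∀ i a, WC Ω (fun j x => D (φ j) i x a) (f0 (some i, a)) := fun i a => hf0 (some i, a)
  set u0 : X → EuclideanSpace ℝ κ := fun x => WithLp.toLp 2 (fun a => f0 (none, a) x) with hu0
  set D0 : ι → X → EuclideanSpace ℝ κ := fun i x => WithLp.toLp 2 (fun a => f0 (some i, a) x) with hD0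
  have sK : ∀ K ⊆ Ω, IsCompact K → Tendsto (fun j => eLpNorm (u (φ j) - u0) 2 (volume.restrict K)) atTop (𝓝 0) := by
    intro K hK hc
    have h1 : ∀ a, Tendsto (fun j => eLpNorm ((fun x => u (φ j) x a) - f0 (none, a)) 2 (volume.restrict K)) atTop (𝓝 0) := by
      intro a
      refine strong_u hΩ (D := fun j i x => D (φ j) i x a) (fun j i => ((h (φ j)).1 i).comp_a a) ?_ ?_ (fun j => LLu _ a) (wu a) hK hc
      · intro K hK hc
        obtain ⟨C, hC⟩ := bu K hK hc
        exact ⟨C, fun j => hC _ _⟩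
      · intro K hK hc
        obtain ⟨C, hC⟩ := bD K hK hc
        exact ⟨C, fun j i => hC _ _ _⟩
    have h2 := tendsto_finsetSum Finset.univ (fun a _ => h1 a)
    simp only [Finset.sum_const_zero] at h2
    refine tendsto_of_tendsto_of_tendsto_of_le_of_le tendsto_const_nhds h2 (fun _ => bot_le) (fun j => ?_)
    refine (eLp_comp_le fun a => ?_)
    exact ((LLu (φ j) a K hK hc).1.sub ((wu a).1 K hK hc).1)
  have hWD : ∀ i, WD Ω (b i) u0 (D0 i) := fun i => WD.of_comp fun a =>
    WC.WD (fun j => ((h (φ j)).1 i).comp_a a) (wu a) (wD i a)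
  refine ⟨φ, hφ, u0, D0, ⟨hWD, ?_⟩, sK, wD⟩
  obtain ⟨K, hKc, hKΩ, hKs⟩ := exists_exhaustion hΩ
  have hU : Ω = ⋃ m, K m := by
    refine subset_antisymm (fun x hx => ?_) (iUnion_subset hKΩ)
    obtain ⟨m, hm⟩ := hKs {x} (by simpa using hx) isCompact_singleton
    exact mem_iUnion.2 ⟨m, hm rfl⟩
  rw [hU, ae_restrict_iUnion_iff]
  intro m
  have tm := tendstoInMeasure_of_tendsto_eLpNorm (p := 2) (by norm_num)
    (fun j => (((h (φ j)).1 i0).1 (K m) (hKΩ m) (hKc m)).1) ((hWD i0).1 (K m) (hKΩ m) (hKc m)).1 (sK (K m) (hKΩ m) (hKc m))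
  obtain ⟨ns, -, hns⟩ := tm.exists_seq_tendsto_ae
  have hall := ae_all_iff.2 fun j => ae_restrict_of_ae_restrict_of_subset (hKΩ m) (h j).2
  filter_upwards [hns, hall] with x h1 h2
  refine tendsto_nhds_unique h1.norm ?_
  simp only [h2]
  exact tendsto_const_nhds

end Extr
end CT

namespace CT
set_option linter.unusedSectionVars false
open scoped ENNReal Topology Convolution NNReal

section Nrm
variable {X : Type*} [NormedAddCommGroup X] [InnerProductSpace ℝ X] [FiniteDimensional ℝ X]
  [MeasurableSpace X] [BorelSpace X]
variable {Y : Type*} [NormedAddCommGroup Y] [InnerProductSpace ℝ Y] [FiniteDimensional ℝ Y]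

/-- regularized normalization -/
def Nr (ε : ℝ) (v : Y) : Y := (√(‖v‖ ^ 2 + ε ^ 2))⁻¹ • v

lemma Nr_pos {ε : ℝ} (hε : 0 < ε) (v : Y) : 0 < ‖v‖ ^ 2 + ε ^ 2 := by positivity

lemma Nr_contDiff {ε : ℝ} (hε : 0 < ε) : ContDiff ℝ 1 (Nr ε : Y → Y) := by
  unfold Nr
  refine ContDiff.smul (ContDiff.inv (ContDiff.sqrt ?_ fun v => (Nr_pos hε v).ne') fun v => (Real.sqrt_pos.2 (Nr_pos hε v)).ne') contDiff_id
  exact (contDiff_norm_sq ℝ).add contDiff_const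

lemma line_deriv {E F : Type*} [NormedAddCommGroup E] [NormedSpace ℝ E] [NormedAddCommGroup F] [NormedSpace ℝ F]
    {f : E → F} {v h : E} (hf : DifferentiableAt ℝ f v) {d : F}
    (hd : HasDerivAt (fun s : ℝ => f (v + s • h)) d 0) : fderiv ℝ f v h = d := by
  have h1 : HasDerivAt (fun s : ℝ => v + s • h) h 0 := by
    simpa using ((hasDerivAt_id (0:ℝ)).smul_const h).const_add v
  have h2 : HasFDerivAt f (fderiv ℝ f v) (v + (0:ℝ) • h) := by simpa using hf.hasFDerivAt
  exact (h2.comp_hasDerivAt 0 h1).unique hd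

lemma line_hasDeriv {E : Type*} [NormedAddCommGroup E] [NormedSpace ℝ E] (v h : E) :
    HasDerivAt (fun s : ℝ => v + s • h) h 0 := by
  simpa using ((hasDerivAt_id (0:ℝ)).smul_const h).const_add v

lemma Nr_fderiv {ε : ℝ} (hε : 0 < ε) (v h : Y) :
    fderiv ℝ (Nr ε) v h = (√(‖v‖ ^ 2 + ε ^ 2))⁻¹ • h - (inner ℝ v h / (√(‖v‖ ^ 2 + ε ^ 2)) ^ 3) • v := by
  refine line_deriv ((Nr_contDiff hε).differentiable (by simp) v) ?_
  have h1 := line_hasDeriv v h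
  have h2 : HasDerivAt (fun s : ℝ => ‖v + s • h‖ ^ 2 + ε ^ 2) (2 * inner ℝ v h) 0 := by
    simpa using h1.norm_sq.add_const (ε ^ 2)
  have h3 := (h2.sqrt (by simpa using (Nr_pos hε v).ne')).inv (by simpa using (Real.sqrt_pos.2 (Nr_pos hε v)).ne')
  have h4 := h3.smul h1
  refine h4.congr_deriv ?_
  have := (Real.sqrt_pos.2 (Nr_pos hε v)).ne'
  simp only [zero_smul, add_zero, Pi.inv_apply]
  rw [sub_eq_add_neg, ← neg_smul]
  congr 2
  field_simp

lemma Nr_fderiv_le {ε : ℝ} (hε : 0 < ε) (v h : Y) (hv : v ≠ 0) :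
    ‖fderiv ℝ (Nr ε) v h‖ ≤ 2 * (‖h‖ / ‖v‖) := by
  rw [Nr_fderiv hε]
  have h0 : 0 < ‖v‖ := norm_pos_iff.2 hv
  set r := √(‖v‖ ^ 2 + ε ^ 2)
  have hr : ‖v‖ ≤ r := Real.le_sqrt_of_sq_le (by nlinarith [sq_nonneg ε])
  have hr0 : 0 < r := h0.trans_le hr
  refine (norm_sub_le _ _).trans ?_
  rw [norm_smul, norm_smul, norm_div, norm_pow, norm_inv, Real.norm_of_nonneg hr0.le, two_mul]
  refine add_le_add ?_ ?_
  · rw [div_eq_mul_inv, mul_comm]; gcongr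
  · have h1 : ‖inner ℝ v h‖ ≤ ‖v‖ * ‖h‖ := norm_inner_le_norm v h
    calc ‖inner ℝ v h‖ / r ^ 3 * ‖v‖ ≤ (‖v‖ * ‖h‖) / (‖v‖ ^ 3) * ‖v‖ := by gcongr
      _ = ‖h‖ / ‖v‖ := by field_simp

/-- derivative of the normalization -/
def Lr (v h : Y) : Y := ‖v‖⁻¹ • h - (inner ℝ v h / ‖v‖ ^ 3) • v

lemma Lr_le (v h : Y) (hv : v ≠ 0) : ‖Lr v h‖ ≤ ‖h‖ / ‖v‖ := by
  have h0 : 0 < ‖v‖ := norm_pos_iff.2 hv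
  have : ‖Lr v h‖ ^ 2 ≤ (‖h‖ / ‖v‖) ^ 2 := by
    unfold Lr
    rw [norm_sub_sq_real, norm_smul, norm_smul, inner_smul_left, inner_smul_right, real_inner_comm h v]
    simp only [norm_inv, norm_div, norm_pow, conj_trivial, mul_pow, div_pow, Real.norm_eq_abs, sq_abs, abs_norm]
    have e : (‖v‖⁻¹) ^ 2 * ‖h‖ ^ 2 - 2 * (‖v‖⁻¹ * (inner ℝ h v / ‖v‖ ^ 3 * inner ℝ h v)) + inner ℝ h v ^ 2 / (‖v‖ ^ 3) ^ 2 * ‖v‖ ^ 2 = ‖h‖ ^ 2 / ‖v‖ ^ 2 - (inner ℝ h v / ‖v‖ ^ 2) ^ 2 := by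
      field_simp; ring
    nlinarith [sq_nonneg (inner ℝ h v / ‖v‖ ^ 2)]
  exact (sq_le_sq₀ (norm_nonneg _) (by positivity)).1 this

lemma WD.normalize {Ω : Set X} (hΩ : IsOpen Ω) {e : X} {v h : X → Y} (H : WD Ω e v h) {R : ℝ}
    (hR : ∀ᵐ x ∂(volume.restrict Ω), ‖v x‖ ≤ R) (h0 : ∀ᵐ x ∂(volume.restrict Ω), v x ≠ 0)
    (hL : LL Ω (fun x => ‖h x‖ / ‖v x‖)) :
    WD Ω e (fun x => ‖v x‖⁻¹ • v x) (fun x => Lr (v x) (h x)) := by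
  have hε : ∀ k : ℕ, 0 < 1 / ((k:ℝ) + 1) := fun k => by positivity
  have ts : ∀ x, v x ≠ 0 → Tendsto (fun k : ℕ => (√(‖v x‖ ^ 2 + (1 / ((k:ℝ) + 1)) ^ 2))) atTop (𝓝 ‖v x‖) := by
    intro x hx
    have h1 : Tendsto (fun k : ℕ => 1 / ((k:ℝ) + 1)) atTop (𝓝 0) := tendsto_one_div_add_atTop_nhds_zero_nat
    have h2 := (((h1.pow 2).const_add (‖v x‖ ^ 2))).sqrt
    simpa using h2
  refine WD.limit hΩ.measurableSet (fun k => WD.chain hΩ H hR (Nr_contDiff (hε k)))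
    (B := fun _ => 1) (B' := fun x => 2 * (‖h x‖ / ‖v x‖)) (LL.of_continuous continuous_const)
    (hL.clm ((2:ℝ) • ContinuousLinearMap.id ℝ ℝ)) ?_ ?_ ?_ ?_
  · intro k
    refine ae_of_all _ fun x => ?_
    have hp := Nr_pos (hε k) (v x)
    rw [Nr, norm_smul, norm_inv, Real.norm_of_nonneg (Real.sqrt_nonneg _), inv_mul_le_iff₀ (Real.sqrt_pos.2 hp), mul_one]
    exact Real.le_sqrt_of_sq_le (by nlinarith [sq_nonneg (1 / ((k:ℝ) + 1))])
  · intro k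
    filter_upwards [h0] with x hx using Nr_fderiv_le (hε k) _ _ hx
  · filter_upwards [h0] with x hx
    exact ((ts x hx).inv₀ (norm_ne_zero_iff.2 hx)).smul_const _
  · filter_upwards [h0] with x hx
    simp only [Nr_fderiv (hε _)]
    have := norm_ne_zero_iff.2 hx
    exact (((ts x hx).inv₀ this).smul_const _).sub
      ((tendsto_const_nhds.div ((ts x hx).pow 3) (pow_ne_zero 3 this)).smul_const _)

/-- interpolation -/
def Vi (a : Y) (q : ℝ × Y × Y) : Y :=
  (1 - q.1) • q.2.1 + q.1 • q.2.2 + (1 / 2 * (q.1 * (1 - q.1)) * ‖q.2.1 - q.2.2‖ ^ 2) • a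

lemma Vi_contDiff (a : Y) : ContDiff ℝ 1 (Vi a) := by
  unfold Vi
  have := contDiff_fst (𝕜 := ℝ) (E := ℝ) (F := Y × Y) (n := 1)
  have h2 := contDiff_snd (𝕜 := ℝ) (E := ℝ) (F := Y × Y) (n := 1)
  have h3 := h2.fst
  have h4 := h2.snd
  exact (((contDiff_const.sub this).smul h3).add (this.smul h4)).add
    (((contDiff_const.mul (this.mul (contDiff_const.sub this))).mul ((h3.sub h4).norm_sq ℝ)).smul contDiff_const)

lemma Vi_fderiv (a : Y) (t : ℝ) (w z : Y) (dt : ℝ) (dw dz : Y) :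
    fderiv ℝ (Vi a) (t, w, z) (dt, dw, dz) = ((1 - t) • dw + (-dt) • w) + (t • dz + dt • z) +
      (1 / 2 * (dt * (1 - t) - t * dt) * ‖w - z‖ ^ 2 + 1 / 2 * (t * (1 - t)) * (2 * inner ℝ (w - z) (dw - dz))) • a := by
  refine line_deriv ((Vi_contDiff a).differentiable (by simp) _) ?_
  have ht := line_hasDeriv t dt
  have hw := line_hasDeriv w dw
  have hz := line_hasDeriv z dz
  have h1 := (((ht.const_sub 1).smul hw).add (ht.smul hz)).add
    ((((ht.mul (ht.const_sub 1)).const_mul (1/2)).mul ((hw.sub hz).norm_sq)).smul_const a)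
  refine HasDerivAt.congr_deriv (h1 :) ?_
  simp only [Pi.sub_apply, Pi.mul_apply, zero_smul, add_zero]
  ring_nf

lemma Vi_fderiv_le {a : Y} (ha : ‖a‖ ≤ 1) {t : ℝ} (h0 : 0 ≤ t) (h1 : t ≤ 1) {w z : Y} (hw : ‖w‖ = 1) (hz : ‖z‖ = 1)
    (dt : ℝ) (dw dz : Y) :
    ‖fderiv ℝ (Vi a) (t, w, z) (dt, dw, dz)‖ ≤ 2 * (‖dw‖ + ‖dz‖ + |dt| * ‖w - z‖) := by
  rw [Vi_fderiv]
  have e : ((1 - t) • dw + (-dt) • w) + (t • dz + dt • z) = (1 - t) • dw + t • dz - dt • (w - z) := by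
    module
  rw [e]
  have hwz : ‖w - z‖ ≤ 2 := (norm_sub_le _ _).trans (by rw [hw, hz]; norm_num)
  have hn := norm_nonneg (w - z)
  have hi : |inner ℝ (w - z) (dw - dz)| ≤ ‖w - z‖ * (‖dw‖ + ‖dz‖) :=
    (abs_real_inner_le_norm _ _).trans (by gcongr; exact norm_sub_le _ _)
  have hi2 : |inner ℝ (w - z) (dw - dz)| ≤ 2 * (‖dw‖ + ‖dz‖) := hi.trans (by gcongr)
  have hA : ‖(1 - t) • dw + t • dz - dt • (w - z)‖ ≤ (1 - t) * ‖dw‖ + t * ‖dz‖ + |dt| * ‖w - z‖ := by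
    refine (norm_sub_le _ _).trans (add_le_add ((norm_add_le _ _).trans (le_of_eq ?_)) (by rw [norm_smul, Real.norm_eq_abs]))
    rw [norm_smul, norm_smul, Real.norm_of_nonneg h0, Real.norm_of_nonneg (by linarith)]
  have hB : ‖(1 / 2 * (dt * (1 - t) - t * dt) * ‖w - z‖ ^ 2 + 1 / 2 * (t * (1 - t)) * (2 * inner ℝ (w - z) (dw - dz))) • a‖
      ≤ |dt| * ‖w - z‖ + t * (1 - t) * (2 * (‖dw‖ + ‖dz‖)) := by
    rw [norm_smul, Real.norm_eq_abs]
    refine (mul_le_of_le_one_right (abs_nonneg _) ha).trans ((abs_add_le _ _).trans (add_le_add ?_ ?_))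
    · have : 1 / 2 * (dt * (1 - t) - t * dt) * ‖w - z‖ ^ 2 = dt * ((1 - 2 * t) * (1 / 2 * ‖w - z‖ ^ 2)) := by ring
      rw [this, abs_mul, abs_mul]
      gcongr
      have h3 : |1 - 2 * t| ≤ 1 := abs_le.2 ⟨by linarith, by linarith⟩
      rw [abs_of_nonneg (by positivity : 0 ≤ 1 / 2 * ‖w - z‖ ^ 2)]
      calc _ ≤ 1 * (1 / 2 * ‖w - z‖ ^ 2) := by gcongr
        _ ≤ _ := by nlinarith
    · have : 1 / 2 * (t * (1 - t)) * (2 * inner ℝ (w - z) (dw - dz)) = t * (1 - t) * inner ℝ (w - z) (dw - dz) := by ring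
      have h3 : 0 ≤ t * (1 - t) := mul_nonneg h0 (by linarith)
      rw [this, abs_mul, abs_of_nonneg h3]
      gcongr
  refine (norm_add_le _ _).trans ((add_le_add hA hB).trans ?_)
  have h3 : t * (1 - t) ≤ 1 / 4 := by nlinarith [sq_nonneg (t - 1/2)]
  have h4 := mul_le_mul_of_nonneg_right h3 (by positivity : 0 ≤ 2 * (‖dw‖ + ‖dz‖))
  have h5 := mul_nonneg h0 (norm_nonneg dw)
  have h6 := mul_nonneg (sub_nonneg.2 h1) (norm_nonneg dz)
  nlinarith [norm_nonneg dw, norm_nonneg dz]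

lemma Vi_sq {t : ℝ} {w z : Y} (hw : ‖w‖ = 1) (hz : ‖z‖ = 1) :
    ‖(1 - t) • w + t • z‖ ^ 2 = 1 - t * (1 - t) * ‖w - z‖ ^ 2 := by
  rw [norm_add_sq_real, norm_sub_sq_real, norm_smul, norm_smul, inner_smul_left, inner_smul_right, hw, hz]
  simp only [Real.norm_eq_abs, mul_pow, sq_abs, conj_trivial]
  ring

end Nrm
end CT

namespace CT
set_option linter.unusedSectionVars false
open scoped ENNReal Topology Convolution NNReal

section Avg
variable {X : Type*} [NormedAddCommGroup X] [InnerProductSpace ℝ X] [FiniteDimensional ℝ X]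
  [MeasurableSpace X] [BorelSpace X]
variable {Y : Type*} [NormedAddCommGroup Y] [InnerProductSpace ℝ Y] [FiniteDimensional ℝ Y]
  [MeasurableSpace Y] [BorelSpace Y]

lemma sing_int (h3 : 3 ≤ Module.finrank ℝ Y) : ∫⁻ a in closedBall (0:Y) 1, (‖a‖ₑ ^ 2)⁻¹ < ∞ := by
  have : Nontrivial Y := Module.nontrivial_of_finrank_pos (R := ℝ) (by omega)
  have h1 : Integrable (fun a : Y => (Iic (1:ℝ)).indicator (fun r => (r ^ 2)⁻¹) ‖a‖) volume := by
    rw [integrable_fun_norm_addHaar (volume : Measure Y) (f := (Iic (1:ℝ)).indicator (fun r => (r ^ 2)⁻¹))]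
    have : IntegrableOn ((Iic (1:ℝ)).indicator (fun _ => (1:ℝ))) (Ioi 0) := by
      rw [IntegrableOn, integrable_indicator_iff measurableSet_Iic]
      rw [IntegrableOn, Measure.restrict_restrict measurableSet_Iic, inter_comm, Ioi_inter_Iic]
      exact integrable_const _
    refine Integrable.mono this ?_ ?_
    · refine Measurable.aestronglyMeasurable ?_
      refine (measurable_id.pow_const _).smul (Measurable.indicator ?_ measurableSet_Iic)
      exact (measurable_id.pow_const _).inv
    · filter_upwards [ae_restrict_mem measurableSet_Ioi] with r hr
      have hr : 0 < r := hr
      by_cases h : r ≤ 1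
      · simp only [indicator_of_mem (show r ∈ Iic (1:ℝ) from h), smul_eq_mul, norm_mul, norm_inv, norm_pow, norm_one,
          Real.norm_of_nonneg hr.le]
        rw [mul_inv_le_iff₀ (by positivity), one_mul]
        exact pow_le_pow_of_le_one hr.le h (by omega)
      · simp [indicator_of_notMem (show r ∉ Iic (1:ℝ) from h)]
  refine lt_of_le_of_lt ?_ h1.2
  rw [← lintegral_indicator measurableSet_closedBall]
  refine lintegral_mono_ae ?_
  filter_upwards [(measure_eq_zero_iff_ae_notMem.1 (measure_singleton (μ := (volume : Measure Y)) 0))] with a ha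
  have ha : ‖a‖ ≠ 0 := by simpa using ha
  by_cases h : ‖a‖ ≤ 1
  · rw [indicator_of_mem (by simpa using h), indicator_of_mem (show ‖a‖ ∈ Iic (1:ℝ) from h)]
    rw [enorm_inv (pow_ne_zero 2 ha), enorm_pow, enorm_norm]
  · rw [indicator_of_notMem (by simpa using h)]; exact bot_le

lemma sing_shift (c : Y) : ∫⁻ a in closedBall (0:Y) 1, (‖c + a‖ₑ ^ 2)⁻¹ ≤
    (∫⁻ a in closedBall (0:Y) 1, (‖a‖ₑ ^ 2)⁻¹) + volume (closedBall (0:Y) 1) := by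
  have hm : Measurable ((closedBall (0:Y) 1).indicator (fun a => (‖a‖ₑ ^ 2)⁻¹)) :=
    Measurable.indicator ((measurable_enorm.pow_const _).inv) measurableSet_closedBall
  have h1 : ∀ a, (‖c + a‖ₑ ^ 2)⁻¹ ≤ (closedBall (0:Y) 1).indicator (fun a => (‖a‖ₑ ^ 2)⁻¹) (c + a) + 1 := by
    intro a
    by_cases h : ‖c + a‖ ≤ 1
    · rw [indicator_of_mem (by simpa using h)]; exact le_self_add
    · refine le_add_left ?_
      rw [ENNReal.inv_le_one]
      refine one_le_pow₀ ?_
      rw [← ofReal_norm, ← ENNReal.ofReal_one]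
      exact ENNReal.ofReal_le_ofReal (not_le.1 h).le
  calc _ ≤ ∫⁻ a in closedBall (0:Y) 1, ((closedBall (0:Y) 1).indicator (fun a => (‖a‖ₑ ^ 2)⁻¹) (c + a) + 1) :=
        lintegral_mono h1
    _ = (∫⁻ a in closedBall (0:Y) 1, (closedBall (0:Y) 1).indicator (fun a => (‖a‖ₑ ^ 2)⁻¹) (c + a)) + volume (closedBall (0:Y) 1) := by
        rw [lintegral_add_right _ measurable_const]; simp
    _ ≤ _ := by
        refine add_le_add_left ?_ _
        refine (setLIntegral_le_lintegral _ _).trans (le_of_eq ?_)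
        rw [lintegral_add_left_eq_self, lintegral_indicator measurableSet_closedBall]

lemma avg_pt (h3 : 3 ≤ Module.finrank ℝ Y) : ∃ C : ℝ≥0, ∀ (t : ℝ) (w z : Y), 0 ≤ t → t ≤ 1 → ‖w‖ = 1 → ‖z‖ = 1 →
    ∫⁻ a in closedBall (0:Y) 1, (‖Vi a (t, w, z)‖ₑ ^ 2)⁻¹ ≤ C := by
  set S := (∫⁻ a in closedBall (0:Y) 1, (‖a‖ₑ ^ 2)⁻¹) + volume (closedBall (0:Y) 1) with hS
  have hv : volume (closedBall (0:Y) 1) < ∞ := measure_closedBall_lt_top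
  have hSf : S < ∞ := ENNReal.add_lt_top.2 ⟨sing_int h3, hv⟩
  refine ⟨(16 * S).toNNReal, fun t w z h0 h1 hw hz => ?_⟩
  rw [ENNReal.coe_toNNReal (ENNReal.mul_lt_top (by norm_num) hSf).ne]
  set V := (1 - t) • w + t • z with hV
  set τ := t * (1 - t) * ‖w - z‖ ^ 2 with hτ
  have hτ0 : 0 ≤ τ := by have := mul_nonneg h0 (sub_nonneg.2 h1); positivity
  have hVs : ‖V‖ ^ 2 = 1 - τ := Vi_sq hw hz
  have hVi : ∀ a, Vi a (t, w, z) = V + (τ / 2) • a := fun a => by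
    simp only [Vi, hV, hτ]; congr 2; ring
  simp only [hVi]
  by_cases hc : τ ≤ 1 / 2
  · calc _ ≤ ∫⁻ a in closedBall (0:Y) 1, 16 := by
          refine setLIntegral_mono measurable_const fun a ha => ?_
          have ha : ‖a‖ ≤ 1 := by simpa using ha
          have h4 : 1 / 4 ≤ ‖V + (τ / 2) • a‖ := by
            have h5 : ‖V‖ - ‖(τ / 2) • a‖ ≤ ‖V + (τ / 2) • a‖ := norm_sub_le_norm_add _ _
            have h6 : ‖(τ / 2) • a‖ ≤ 1 / 4 := by
              rw [norm_smul, Real.norm_of_nonneg (by positivity)]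
              nlinarith [norm_nonneg a]
            have h7 : 1 / 2 ≤ ‖V‖ := by nlinarith [norm_nonneg V]
            linarith
          rw [ENNReal.inv_le_iff_inv_le, ← ofReal_norm]
          calc (16:ℝ≥0∞)⁻¹ = (ENNReal.ofReal (1/4)) ^ 2 := by
                rw [← ENNReal.ofReal_pow (by norm_num), ← ENNReal.ofReal_ofNat, ← ENNReal.ofReal_inv_of_pos (by norm_num)]; norm_num
            _ ≤ _ := pow_le_pow_left' (ENNReal.ofReal_le_ofReal h4) 2
      _ = 16 * volume (closedBall (0:Y) 1) := by simp
      _ ≤ _ := by gcongr; exact le_add_self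
  · push Not at hc
    have hs : (0:ℝ) < τ / 2 := by linarith
    calc _ ≤ ∫⁻ a in closedBall (0:Y) 1, 16 * (‖(τ/2)⁻¹ • V + a‖ₑ ^ 2)⁻¹ := by
          refine lintegral_mono fun a => ?_
          have : V + (τ / 2) • a = (τ / 2) • ((τ/2)⁻¹ • V + a) := by
            rw [smul_add, smul_smul, mul_inv_cancel₀ hs.ne', one_smul]
          rw [this, enorm_smul, mul_pow, ENNReal.mul_inv (Or.inl (pow_ne_zero 2 (by simpa using hs.ne'))) (Or.inl (by simp))]
          gcongr
          rw [ENNReal.inv_le_iff_inv_le, ← ofReal_norm]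
          calc (16:ℝ≥0∞)⁻¹ = (ENNReal.ofReal (1/4)) ^ 2 := by
                rw [← ENNReal.ofReal_pow (by norm_num), ← ENNReal.ofReal_ofNat, ← ENNReal.ofReal_inv_of_pos (by norm_num)]; norm_num
            _ ≤ _ := pow_le_pow_left' (ENNReal.ofReal_le_ofReal (by rw [Real.norm_of_nonneg hs.le]; linarith)) 2
      _ = 16 * ∫⁻ a in closedBall (0:Y) 1, (‖(τ/2)⁻¹ • V + a‖ₑ ^ 2)⁻¹ := by
          rw [lintegral_const_mul' _ _ (by norm_num)]
      _ ≤ _ := by gcongr; exact sing_shift _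

lemma avg_choose (h3 : 3 ≤ Module.finrank ℝ Y) : ∃ C : ℝ≥0, ∀ (T : Set X) (η : X → ℝ) (w u : X → Y) (Q : X → ℝ≥0∞),
    Continuous η → (∀ x, 0 ≤ η x ∧ η x ≤ 1) → AEStronglyMeasurable w (volume.restrict T) →
    AEStronglyMeasurable u (volume.restrict T) → (∀ᵐ x ∂(volume.restrict T), ‖w x‖ = 1) →
    (∀ᵐ x ∂(volume.restrict T), ‖u x‖ = 1) → AEMeasurable Q (volume.restrict T) →
    ∃ a : Y, ‖a‖ ≤ 1 ∧ ∫⁻ x in T, Q x * (‖Vi a (η x, w x, u x)‖ₑ ^ 2)⁻¹ ≤ C * ∫⁻ x in T, Q x := by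
  obtain ⟨C, hC⟩ := avg_pt h3
  have hv : volume (closedBall (0:Y) 1) < ∞ := measure_closedBall_lt_top
  have hv0 : volume (closedBall (0:Y) 1) ≠ 0 := (measure_closedBall_pos _ _ one_pos).ne'
  refine ⟨C / (volume (closedBall (0:Y) 1)).toNNReal, fun T η w u Q hη hη1 hw hu hw1 hu1 hQ => ?_⟩
  have hVm : AEMeasurable (fun q : Y × X => (‖Vi q.1 (η q.2, w q.2, u q.2)‖ₑ ^ 2)⁻¹)
      ((volume.restrict (closedBall (0:Y) 1)).prod (volume.restrict T)) := by
    have h1 : Continuous (fun q : Y × (ℝ × Y × Y) => Vi q.1 q.2) := by unfold Vi; fun_prop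
    have h2 : AEStronglyMeasurable (fun x => (η x, w x, u x)) (volume.restrict T) :=
      hη.aestronglyMeasurable.prodMk (hw.prodMk hu)
    have h4 := h1.comp_aestronglyMeasurable (continuous_fst.aestronglyMeasurable.prodMk
      (h2.comp_snd (μ := volume.restrict (closedBall (0:Y) 1))))
    exact (h4.enorm.pow_const _).inv
  have hm : AEMeasurable (Function.uncurry fun (a : Y) (x : X) => Q x * (‖Vi a (η x, w x, u x)‖ₑ ^ 2)⁻¹)
      ((volume.restrict (closedBall (0:Y) 1)).prod (volume.restrict T)) :=
    (hQ.comp_snd).mul hVm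
  have hm' : AEMeasurable (fun a : Y => ∫⁻ x in T, Q x * (‖Vi a (η x, w x, u x)‖ₑ ^ 2)⁻¹) (volume.restrict (closedBall (0:Y) 1)) :=
    hm.lintegral_prod_right'
  obtain ⟨a, ha, hle⟩ := exists_le_setLAverage hv0 hv.ne hm'
  refine ⟨a, by simpa using ha, hle.trans ?_⟩
  rw [setLAverage_eq, lintegral_lintegral_swap hm]
  rw [ENNReal.coe_div (by simpa [ENNReal.toNNReal_eq_zero_iff] using ⟨hv0, hv.ne⟩), ENNReal.coe_toNNReal hv.ne, ENNReal.div_eq_inv_mul, ENNReal.div_eq_inv_mul, mul_assoc]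
  gcongr
  rw [← lintegral_const_mul'' _ hQ]
  refine lintegral_mono_ae ?_
  filter_upwards [hw1, hu1] with x h1 h2
  have hc : Measurable (fun a : Y => (‖Vi a (η x, w x, u x)‖ₑ ^ 2)⁻¹) := by
    have : Continuous (fun a : Y => Vi a (η x, w x, u x)) := by unfold Vi; fun_prop
    exact (this.measurable.enorm.pow_const _).inv
  rw [lintegral_const_mul _ hc, mul_comm]
  gcongr
  exact hC _ _ _ (hη1 x).1 (hη1 x).2 h1 h2

end Avg
end CT

namespace CT
set_option linter.unusedSectionVars false
open scoped ENNReal Topology Convolution NNReal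

section Glue
variable {X : Type*} [NormedAddCommGroup X] [InnerProductSpace ℝ X] [FiniteDimensional ℝ X]
  [MeasurableSpace X] [BorelSpace X]
variable {Y : Type*} [NormedAddCommGroup Y] [InnerProductSpace ℝ Y] [FiniteDimensional ℝ Y]
variable {ι : Type*} [Fintype ι]

lemma GM.lint_lt {b : OrthonormalBasis ι ℝ X} {Ω : Set X} {u : X → Y} {D : ι → X → Y} (h : GM b Ω u D)
    {K : Set X} (hK : K ⊆ Ω) (hc : IsCompact K) : ∫⁻ x in K, ENNReal.ofReal (ed D x) < ∞ :=
  (h.ed_int hK hc).lintegral_lt_top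

lemma Mz.lint {b : OrthonormalBasis ι ℝ X} {Ω : Set X} {u : X → Y} {D : ι → X → Y} (h : Mz b Ω u D)
    {y : X} {ρ : ℝ} (hρ : 0 < ρ) (hb : closedBall y ρ ⊆ Ω) {w : X → Y} {Dw : ι → X → Y} (hw : GM b Ω w Dw)
    (hs : ∃ σ : ℝ, σ < ρ ∧ ∀ᵐ x ∂volume.restrict (Ω \ ball y σ), w x = u x) :
    ∫⁻ x in ball y ρ, ENNReal.ofReal (ed D x) ≤ ∫⁻ x in ball y ρ, ENNReal.ofReal (ed Dw x) := by
  have i1 := (h.1.ed_int hb (isCompact_closedBall y ρ)).mono_set ball_subset_closedBall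
  have i2 := (hw.ed_int hb (isCompact_closedBall y ρ)).mono_set ball_subset_closedBall
  rw [← ofReal_integral_eq_lintegral_ofReal i1 (ae_of_all _ fun x => ed_nonneg _ x),
    ← ofReal_integral_eq_lintegral_ofReal i2 (ae_of_all _ fun x => ed_nonneg _ x)]
  exact ENNReal.ofReal_le_ofReal (h.2 y ρ hρ hb w Dw hw hs)

lemma q_sum_le (n1 n2 : ι → ℝ) (s : ℝ) :
    ∑ i, (2 * (n1 i + n2 i + s)) ^ 2 ≤ 12 * (∑ i, n1 i ^ 2 + ∑ i, n2 i ^ 2 + Fintype.card ι * s ^ 2) := by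
  calc ∑ i, (2 * (n1 i + n2 i + s)) ^ 2 ≤ ∑ i, 12 * (n1 i ^ 2 + n2 i ^ 2 + s ^ 2) := by
        refine Finset.sum_le_sum fun i _ => ?_
        nlinarith [sq_nonneg (n1 i - n2 i), sq_nonneg (n1 i - s), sq_nonneg (n2 i - s)]
    _ = _ := by
        rw [← Finset.mul_sum, Finset.sum_add_distrib, Finset.sum_add_distrib]; simp

variable [MeasurableSpace Y] [BorelSpace Y]

lemma glue_core [Nonempty ι] {b : OrthonormalBasis ι ℝ X} {Ω : Set X} (hΩ : IsOpen Ω) {C : ℝ≥0}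
    (hC : ∀ (T : Set X) (η : X → ℝ) (w u : X → Y) (Q : X → ℝ≥0∞),
      Continuous η → (∀ x, 0 ≤ η x ∧ η x ≤ 1) → AEStronglyMeasurable w (volume.restrict T) →
      AEStronglyMeasurable u (volume.restrict T) → (∀ᵐ x ∂(volume.restrict T), ‖w x‖ = 1) →
      (∀ᵐ x ∂(volume.restrict T), ‖u x‖ = 1) → AEMeasurable Q (volume.restrict T) →
      ∃ a : Y, ‖a‖ ≤ 1 ∧ ∫⁻ x in T, Q x * (‖Vi a (η x, w x, u x)‖ₑ ^ 2)⁻¹ ≤ C * ∫⁻ x in T, Q x)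
    {y : X} {r1 r2 ρ : ℝ} (hr1 : 0 < r1) (hr2 : r1 < r2) (hr : r2 < ρ) (hb : closedBall y ρ ⊆ Ω)
    {η : X → ℝ} (hη : ContDiff ℝ 1 η) (hη1 : ∀ x, 0 ≤ η x ∧ η x ≤ 1) {m : ℝ} (hm0 : 0 ≤ m)
    (hm : ∀ x i, |fderiv ℝ η x (b i)| ≤ m) (he0 : ∀ x ∈ closedBall y r1, η x = 0) (he1 : ∀ x ∉ ball y r2, η x = 1)
    {u : X → Y} {D : ι → X → Y} {w : X → Y} {Dw : ι → X → Y} (hu : Mz b Ω u D) (hw : GM b Ω w Dw) {δ : ℝ} (hδ : 0 < δ) :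
    ∫⁻ x in ball y r2, ENNReal.ofReal (ed D x) ≤ (∫⁻ x in closedBall y r1, ENNReal.ofReal (ed Dw x)) +
      C * ∫⁻ x in ball y r2 \ closedBall y r1, ENNReal.ofReal (∑ i, (2 * (‖Dw i x‖ + ‖D i x‖ + m * ‖w x - u x‖)) ^ 2 + δ) := by
  set T := ball y r2 \ closedBall y r1 with hT
  have hTm : MeasurableSet T := measurableSet_ball.diff measurableSet_closedBall
  have hTK : T ⊆ closedBall y ρ := fun x hx => (ball_subset_closedBall.trans (closedBall_subset_closedBall hr.le)) hx.1
  have hTΩ : T ⊆ Ω := hTK.trans hb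
  have hcomp := isCompact_closedBall y ρ
  have mres : (volume.restrict T : Measure X) ≤ volume.restrict (closedBall y ρ) := Measure.restrict_mono hTK le_rfl
  have i0 : ι := Classical.arbitrary ι
  have Lw : LL Ω w := (hw.1 i0).1
  have Lu : LL Ω u := (hu.1.1 i0).1
  have hηc := hη.continuous
  have gz : ∀ x ∉ T, ∀ i, fderiv ℝ η x (b i) = 0 := by
    intro x hx i
    have : fderiv ℝ η x = 0 := by
      by_cases h : x ∈ closedBall y r1
      · refine IsLocalMin.fderiv_eq_zero (Eventually.of_forall fun z => ?_)
        rw [he0 x h]; exact (hη1 z).1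
      · have h2 : x ∉ ball y r2 := fun h2 => hx ⟨h2, h⟩
        refine IsLocalMax.fderiv_eq_zero (Eventually.of_forall fun z => ?_)
        rw [he1 x h2]; exact (hη1 z).2
    simp [this]
  have aeM : ∀ {Z : Type _} [NormedAddCommGroup Z] {f : X → Z}, LL Ω f → AEStronglyMeasurable f (volume.restrict T) :=
    fun h => (h _ hb hcomp).1.mono_measure mres
  set q : X → ℝ := fun x => ∑ i, (2 * (‖Dw i x‖ + ‖D i x‖ + m * ‖w x - u x‖)) ^ 2 + δ with hq
  have hq0 : ∀ x, 0 < q x := fun x => by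
    have : 0 ≤ ∑ i, (2 * (‖Dw i x‖ + ‖D i x‖ + m * ‖w x - u x‖)) ^ 2 := Finset.sum_nonneg fun _ _ => by positivity
    simp only [hq]; linarith
  have hqm : AEStronglyMeasurable q (volume.restrict T) := by
    refine AEStronglyMeasurable.add ?_ aestronglyMeasurable_const
    refine Finset.aestronglyMeasurable_fun_sum _ fun i _ => ?_
    exact ((((aeM (hw.1 i).2.1).norm.add (aeM (hu.1.1 i).2.1).norm).add
      (((aeM Lw).sub (aeM Lu)).norm.const_mul m)).const_mul 2).pow 2
  obtain ⟨a, ha, hle⟩ := hC T η w u (fun x => ENNReal.ofReal (q x)) hηc hη1 (aeM Lw) (aeM Lu)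
    (ae_restrict_of_ae_restrict_of_subset hTΩ hw.2) (ae_restrict_of_ae_restrict_of_subset hTΩ hu.1.2)
    hqm.aemeasurable.ennreal_ofReal
  set v : X → Y := fun x => Vi a (η x, w x, u x) with hv
  set H : ι → X → Y := fun i x => fderiv ℝ (Vi a) (η x, w x, u x) (fderiv ℝ η x (b i), Dw i x, D i x) with hH
  have hvin : ∀ x ∈ closedBall y r1, v x = w x := fun x hx => by simp [hv, Vi, he0 x hx]
  have hvout : ∀ x ∉ ball y r2, v x = u x := fun x hx => by simp [hv, Vi, he1 x hx]
  have hHin : ∀ x ∈ closedBall y r1, ∀ i, H i x = Dw i x := fun x hx i => by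
    have hx' : x ∉ T := fun h => h.2 hx
    simp [hH, Vi_fderiv, he0 x hx, gz x hx']
  have hHout : ∀ x ∉ ball y r2, ∀ i, H i x = D i x := fun x hx i => by
    have hx' : x ∉ T := fun h => hx h.1
    simp [hH, Vi_fderiv, he1 x hx, gz x hx']
  have hWD : ∀ i, WD Ω (b i) v (H i) := by
    intro i
    refine WD.chain hΩ (WD.prodMk (WD.of_C1 hη (b i)) (WD.prodMk (hw.1 i) (hu.1.1 i))) (R := 1) ?_ (Vi_contDiff a)
    filter_upwards [hw.2, hu.1.2] with x h1 h2
    rw [Prod.norm_mk, Prod.norm_mk, h1, h2, Real.norm_of_nonneg (hη1 x).1]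
    simpa using (hη1 x).2
  -- finiteness
  have hqf : ∫⁻ x in T, ENNReal.ofReal (q x) < ∞ := by
    have hint : IntegrableOn (fun x => 12 * (ed Dw x + ed D x + Fintype.card ι * (m ^ 2 * ‖w x - u x‖ ^ 2)) + δ) (closedBall y ρ) := by
      refine Integrable.add (Integrable.const_mul (Integrable.add ((hw.ed_int hb hcomp).add (hu.1.ed_int hb hcomp)) ?_) _) ?_
      · exact (Integrable.const_mul (Integrable.const_mul (((Lw _ hb hcomp).sub (Lu _ hb hcomp)).integrable_norm_pow two_ne_zero) _) _)
      · exact integrableOn_const hcomp.measure_lt_top.ne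
    refine lt_of_le_of_lt ?_ (hint.mono_set hTK).lintegral_lt_top
    refine lintegral_mono fun x => ENNReal.ofReal_le_ofReal ?_
    have := q_sum_le (fun i => ‖Dw i x‖) (fun i => ‖D i x‖) (m * ‖w x - u x‖)
    simp only [hq, ed]
    rw [mul_pow] at this
    linarith
  have hQf : ∫⁻ x in T, ENNReal.ofReal (q x) * (‖v x‖ₑ ^ 2)⁻¹ < ∞ :=
    hle.trans_lt (ENNReal.mul_lt_top (by simp) hqf)
  have hvm : AEStronglyMeasurable v (volume.restrict T) := aeM (hWD i0).1
  have hvT : ∀ᵐ x ∂(volume.restrict T), v x ≠ 0 := by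
    have hmm : AEMeasurable (fun x => ENNReal.ofReal (q x) * (‖v x‖ₑ ^ 2)⁻¹) (volume.restrict T) :=
      hqm.aemeasurable.ennreal_ofReal.mul (hvm.enorm.pow_const _).inv
    filter_upwards [ae_lt_top' hmm hQf.ne] with x hx h0
    rw [h0] at hx
    simp [hq0 x] at hx
  have hdecomp : ∀ P : X → Prop, (∀ᵐ x ∂(volume.restrict T), P x) → (∀ᵐ x ∂(volume.restrict Ω), x ∉ T → P x) →
      ∀ᵐ x ∂(volume.restrict Ω), P x := by
    intro P h1 h2
    filter_upwards [h2, ae_restrict_of_ae ((ae_restrict_iff' hTm).1 h1)] with x h3 h4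
    by_cases h : x ∈ T
    · exact h4 h
    · exact h3 h
  have hout : ∀ x ∉ T, x ∈ closedBall y r1 ∨ x ∉ ball y r2 := fun x hx => by
    by_contra h; push Not at h; exact hx ⟨h.2, h.1⟩
  have hv0 : ∀ᵐ x ∂(volume.restrict Ω), v x ≠ 0 := by
    refine hdecomp _ hvT ?_
    filter_upwards [hw.2, hu.1.2] with x h1 h2 hx
    rw [← norm_ne_zero_iff]
    rcases hout x hx with h | h
    · rw [hvin x h, h1]; exact one_ne_zero
    · rw [hvout x h, h2]; exact one_ne_zero
  set P : X → ℝ≥0∞ := fun x => T.indicator (fun x => ENNReal.ofReal (q x) * (‖v x‖ₑ ^ 2)⁻¹) x +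
    ((closedBall y r1).indicator (fun x => ENNReal.ofReal (ed Dw x)) x + (ball y r2)ᶜ.indicator (fun x => ENNReal.ofReal (ed D x)) x) with hP
  have hPb : ∀ᵐ x ∂(volume.restrict Ω), ENNReal.ofReal (∑ i, (‖H i x‖ / ‖v x‖) ^ 2) ≤ P x := by
    refine hdecomp _ ?_ ?_
    · filter_upwards [hvT, ae_restrict_mem hTm, ae_restrict_of_ae_restrict_of_subset hTΩ hw.2,
        ae_restrict_of_ae_restrict_of_subset hTΩ hu.1.2] with x h1 h2 h3 h4
      refine le_trans ?_ le_self_add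
      rw [indicator_of_mem h2]
      have hn : 0 < ‖v x‖ := norm_pos_iff.2 h1
      rw [← ofReal_norm, ← ENNReal.ofReal_pow hn.le, ← ENNReal.ofReal_inv_of_pos (by positivity), ← ENNReal.ofReal_mul (hq0 x).le]
      refine ENNReal.ofReal_le_ofReal ?_
      simp only [div_pow]
      rw [← Finset.sum_div, div_eq_mul_inv]
      gcongr
      refine le_trans (Finset.sum_le_sum fun i _ => ?_) (le_add_of_nonneg_right hδ.le)
      gcongr
      refine (Vi_fderiv_le ha (hη1 x).1 (hη1 x).2 h3 h4 _ _ _).trans ?_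
      gcongr
      exact hm x i
    · filter_upwards [hw.2, hu.1.2] with x h1 h2 hx
      refine le_trans ?_ le_add_self
      rcases hout x hx with h | h
      · refine le_trans ?_ le_self_add
        rw [indicator_of_mem h, hvin x h, h1]
        simp [hHin x h, ed]
      · refine le_trans ?_ le_add_self
        rw [indicator_of_mem (show x ∈ (ball y r2)ᶜ from h), hvout x h, h2]
        simp [hHout x h, ed]
  have mQ : AEMeasurable (T.indicator (fun x => ENNReal.ofReal (q x) * (‖v x‖ₑ ^ 2)⁻¹)) volume :=
    (aemeasurable_indicator_iff hTm).2 (hqm.aemeasurable.ennreal_ofReal.mul (hvm.enorm.pow_const _).inv)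
  have hPint : ∀ K, MeasurableSet K → K ⊆ Ω → ∫⁻ x in K, P x ≤ (∫⁻ x in T, ENNReal.ofReal (q x) * (‖v x‖ₑ ^ 2)⁻¹) +
      ((∫⁻ x in closedBall y r1, ENNReal.ofReal (ed Dw x)) + ∫⁻ x in K \ ball y r2, ENNReal.ofReal (ed D x)) := by
    intro K hKm hK
    rw [lintegral_add_left' mQ.restrict]
    refine add_le_add ?_ ?_
    · rw [lintegral_indicator hTm]
      exact lintegral_mono' (Measure.restrict_mono' (ae_of_all _ fun x h => h) Measure.restrict_le_self) le_rfl
    · rw [lintegral_add_left']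
      · refine add_le_add ?_ ?_
        · rw [lintegral_indicator measurableSet_closedBall]
          exact lintegral_mono' (Measure.restrict_mono' (ae_of_all _ fun x h => h) Measure.restrict_le_self) le_rfl
        · rw [lintegral_indicator measurableSet_ball.compl, Measure.restrict_restrict measurableSet_ball.compl,
            inter_comm, ← sdiff_eq]
      · refine (aemeasurable_indicator_iff measurableSet_closedBall).2 ?_ |>.restrict
        have hs : closedBall y r1 ⊆ Ω := (closedBall_subset_closedBall (hr2.trans hr).le).trans hb
        exact (hw.ed_int hs (isCompact_closedBall _ _)).1.aemeasurable.ennreal_ofReal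
  have hL : ∀ i, LL Ω (fun x => ‖H i x‖ / ‖v x‖) := by
    intro i K hK hc
    refine ⟨(((hWD i).2.1 K hK hc).1.norm.aemeasurable.div ((hWD i).1 K hK hc).1.norm.aemeasurable).aestronglyMeasurable, ?_⟩
    have h1 : eLpNorm (fun x => ‖H i x‖ / ‖v x‖) 2 (volume.restrict K) ^ 2 < ∞ := by
      rw [eLpNorm_two_sq]
      calc _ ≤ ∫⁻ x in K, P x := by
            refine lintegral_mono_ae ?_
            filter_upwards [ae_restrict_of_ae_restrict_of_subset hK hPb] with x hx
            refine le_trans ?_ hx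
            rw [← ofReal_norm, ← ENNReal.ofReal_pow (norm_nonneg _), norm_div, norm_norm, norm_norm]
            exact ENNReal.ofReal_le_ofReal (Finset.single_le_sum (f := fun i => (‖H i x‖ / ‖v x‖) ^ 2) (fun _ _ => by positivity) (Finset.mem_univ i))
        _ ≤ _ := hPint K hc.measurableSet hK
        _ < ∞ := by
            have hs : closedBall y r1 ⊆ Ω := (closedBall_subset_closedBall (hr2.trans hr).le).trans hb
            refine ENNReal.add_lt_top.2 ⟨hQf, ENNReal.add_lt_top.2 ⟨hw.lint_lt hs (isCompact_closedBall _ _), ?_⟩⟩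
            exact (lintegral_mono_set sdiff_subset).trans_lt (hu.1.lint_lt hK hc)
    by_contra h
    rw [not_lt, top_le_iff] at h
    rw [h] at h1
    simp at h1
  have hGM : GM b Ω (fun x => ‖v x‖⁻¹ • v x) (fun i x => Lr (v x) (H i x)) := by
    refine ⟨fun i => WD.normalize hΩ (hWD i) (R := 2) ?_ hv0 (hL i), ?_⟩
    · filter_upwards [hw.2, hu.1.2] with x h1 h2
      have ht := hη1 x
      have h3 : ‖w x - u x‖ ≤ 2 := (norm_sub_le _ _).trans (by rw [h1, h2]; norm_num)
      have h5 : ‖(1 - η x) • w x + η x • u x‖ ≤ 1 := by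
        refine (norm_add_le _ _).trans ?_
        rw [norm_smul, norm_smul, h1, h2, Real.norm_of_nonneg ht.1, Real.norm_of_nonneg (by linarith [ht.2])]
        linarith
      have h6 : ‖(1 / 2 * (η x * (1 - η x)) * ‖w x - u x‖ ^ 2) • a‖ ≤ 1 := by
        have h7 : η x * (1 - η x) ≤ 1 / 4 := by nlinarith [sq_nonneg (η x - 1/2)]
        have h8 : 0 ≤ η x * (1 - η x) := mul_nonneg ht.1 (by linarith [ht.2])
        have h9 : ‖w x - u x‖ ^ 2 ≤ 4 := by nlinarith [norm_nonneg (w x - u x)]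
        rw [norm_smul, Real.norm_of_nonneg (by positivity)]
        refine (mul_le_of_le_one_right (by positivity) ha).trans ?_
        nlinarith [sq_nonneg (‖w x - u x‖)]
      refine (norm_add_le _ _).trans ?_
      linarith
    · filter_upwards [hv0] with x hx
      rw [norm_smul, norm_inv, norm_norm, inv_mul_cancel₀ (norm_ne_zero_iff.2 hx)]
  have hmin := hu.lint (hr1.trans (hr2.trans hr)) hb hGM ⟨r2, hr, by
    filter_upwards [ae_restrict_of_ae_restrict_of_subset sdiff_subset hu.1.2, ae_restrict_mem (hΩ.measurableSet.diff measurableSet_ball)] with x h1 h2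
    rw [hvout x h2.2, h1]; simp⟩
  have hub : ∫⁻ x in ball y ρ, ENNReal.ofReal (ed (fun i x => Lr (v x) (H i x)) x) ≤ ∫⁻ x in ball y ρ, P x := by
    refine lintegral_mono_ae ?_
    have hbΩ : ball y ρ ⊆ Ω := ball_subset_closedBall.trans hb
    filter_upwards [ae_restrict_of_ae_restrict_of_subset hbΩ hPb, ae_restrict_of_ae_restrict_of_subset hbΩ hv0] with x h1 h2
    refine le_trans (ENNReal.ofReal_le_ofReal (Finset.sum_le_sum fun i _ => ?_)) h1
    exact pow_le_pow_left₀ (norm_nonneg _) (Lr_le _ _ h2) 2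
  have hfin := hmin.trans (hub.trans (hPint _ measurableSet_ball (ball_subset_closedBall.trans hb)))
  have hsplit : ∫⁻ x in ball y ρ, ENNReal.ofReal (ed D x) = (∫⁻ x in ball y r2, ENNReal.ofReal (ed D x)) + ∫⁻ x in ball y ρ \ ball y r2, ENNReal.ofReal (ed D x) := by
    rw [← lintegral_inter_add_sdiff _ (ball y ρ) (measurableSet_ball (x := y) (ε := r2)), inter_eq_right.2 (ball_subset_ball hr.le)]
  rw [hsplit, ← add_assoc] at hfin
  have hlt : ∫⁻ x in ball y ρ \ ball y r2, ENNReal.ofReal (ed D x) ≠ ∞ :=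
    ((lintegral_mono_set (sdiff_subset.trans ball_subset_closedBall)).trans_lt (hu.1.lint_lt hb hcomp)).ne
  have hfin2 := (ENNReal.add_le_add_iff_right hlt).1 hfin
  refine hfin2.trans ?_
  rw [add_comm]
  gcongr

end Glue
end CT

namespace CT
set_option linter.unusedSectionVars false
open scoped ENNReal Topology Convolution NNReal

section Star
variable {X : Type*} [NormedAddCommGroup X] [InnerProductSpace ℝ X] [FiniteDimensional ℝ X]
  [MeasurableSpace X] [BorelSpace X]
variable {Y : Type*} [NormedAddCommGroup Y] [InnerProductSpace ℝ Y] [FiniteDimensional ℝ Y]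
variable {ι : Type*} [Fintype ι]

lemma exists_cut (b : OrthonormalBasis ι ℝ X) (y : X) {r1 r2 : ℝ} (h1 : 0 < r1) (h2 : r1 < r2) :
    ∃ (η : X → ℝ) (m : ℝ), ContDiff ℝ 1 η ∧ (∀ x, 0 ≤ η x ∧ η x ≤ 1) ∧ 0 ≤ m ∧ (∀ x i, |fderiv ℝ η x (b i)| ≤ m) ∧
      (∀ x ∈ closedBall y r1, η x = 0) ∧ (∀ x ∉ ball y r2, η x = 1) := by
  set f : ContDiffBump y := ⟨r1, r2, h1, h2⟩
  have hf : ContDiff ℝ 1 f := f.contDiff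
  obtain ⟨m, hm⟩ := (f.hasCompactSupport.fderiv (𝕜 := ℝ)).exists_bound_of_continuous (hf.continuous_fderiv (by simp))
  refine ⟨fun x => 1 - f x, m, contDiff_const.sub hf, fun x => ⟨by linarith [f.le_one (x := x)], by linarith [f.nonneg (x := x)]⟩,
    (norm_nonneg _).trans (hm y), fun x i => ?_, fun x hx => ?_, fun x hx => ?_⟩
  · have : fderiv ℝ (fun x => 1 - f x) x = - fderiv ℝ f x := by
      rw [fderiv_const_sub]
    rw [this, neg_apply, abs_neg, ← Real.norm_eq_abs]
    refine ((fderiv ℝ f x).le_opNorm _).trans ?_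
    rw [b.norm_eq_one, mul_one]; exact hm x
  · show 1 - f x = 0
    rw [f.one_of_mem_closedBall hx, sub_self]
  · show 1 - f x = 1
    rw [f.zero_of_le_dist (by simpa using hx), sub_zero]

variable [MeasurableSpace Y] [BorelSpace Y]

lemma star (h3 : 3 ≤ Module.finrank ℝ Y) [Nonempty ι] {b : OrthonormalBasis ι ℝ X} {Ω : Set X} (hΩ : IsOpen Ω)
    {u : ℕ → X → Y} {D : ℕ → ι → X → Y} (hu : ∀ j, Mz b Ω (u j) (D j)) {u0 w : X → Y} {Dw : ι → X → Y}
    (hw : GM b Ω w Dw) {y : X} {σ σ' ρ' ρ : ℝ} (h0 : 0 < σ') (hσ : σ ≤ σ') (hρ' : σ' < ρ') (hρ : ρ' < ρ)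
    (hb : closedBall y ρ ⊆ Ω) (hwu : ∀ᵐ x ∂volume.restrict (Ω \ ball y σ), w x = u0 x) {Λ : ℝ≥0}
    (hΛ : ∀ j, ∫⁻ x in closedBall y ρ, ENNReal.ofReal (ed (D j) x) ≤ Λ)
    (hc : Tendsto (fun j => ∫⁻ x in closedBall y ρ, ‖u j x - u0 x‖ₑ ^ 2) atTop (𝓝 0)) {ε : ℝ≥0∞} (hε : ε ≠ 0) :
    ∀ᶠ j in atTop, ∫⁻ x in ball y σ', ENNReal.ofReal (ed (D j) x) ≤ (∫⁻ x in ball y ρ', ENNReal.ofReal (ed Dw x)) + ε := by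
  obtain ⟨C, hC⟩ := avg_choose (X := X) h3
  have hcomp := isCompact_closedBall y ρ
  set Λ' : ℝ≥0∞ := (∫⁻ x in closedBall y ρ, ENNReal.ofReal (ed Dw x)) + Λ with hΛ'
  have hΛ'f : Λ' ≠ ∞ := (ENNReal.add_lt_top.2 ⟨hw.lint_lt hb hcomp, ENNReal.coe_lt_top⟩).ne
  have hε3 : ε / 3 ≠ 0 := by simp [hε]
  obtain ⟨N, hN⟩ := ENNReal.exists_nat_mul_gt hε3 (ENNReal.mul_ne_top (ENNReal.mul_ne_top (ENNReal.coe_ne_top (r := C)) (ENNReal.ofNat_ne_top (n := 12))) hΛ'f)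
  have hN0 : 0 < N := by
    rcases Nat.eq_zero_or_pos N with h | h
    · rw [h] at hN; simp at hN
    · exact h
  obtain ⟨δ, hδ, hδl⟩ := ENNReal.exists_nnreal_pos_mul_lt (ENNReal.mul_ne_top (ENNReal.coe_ne_top (r := C)) (hcomp.measure_lt_top (μ := volume)).ne) hε3
  set r : ℕ → ℝ := fun i => σ' + (ρ' - σ') * i / N with hr
  have hNr : (0:ℝ) < N := by exact_mod_cast hN0
  have hd : 0 < ρ' - σ' := sub_pos.2 hρ'
  have rm : StrictMono r := by
    intro i k hik
    have : (i:ℝ) < k := by exact_mod_cast hik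
    simp only [hr]; gcongr
  have r0 : ∀ i, σ' ≤ r i := fun i => by
    have : 0 ≤ (ρ' - σ') * i / N := by positivity
    simp only [hr]; linarith
  have rN : r N = ρ' := by simp only [hr]; field_simp; ring
  have hcut : ∀ i, ∃ (η : X → ℝ) (m : ℝ), ContDiff ℝ 1 η ∧ (∀ x, 0 ≤ η x ∧ η x ≤ 1) ∧ 0 ≤ m ∧ (∀ x i, |fderiv ℝ η x (b i)| ≤ m) ∧
      (∀ x ∈ closedBall y (r i), η x = 0) ∧ (∀ x ∉ ball y (r (i+1)), η x = 1) := fun i =>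
    exists_cut b y (h0.trans_le (r0 i)) (rm (Nat.lt_succ_self i))
  choose η m hη1 hη2 hm0 hm1 he0 he1 using hcut
  set M : ℝ := ∑ i ∈ Finset.range N, Fintype.card ι * m i ^ 2 with hM
  have hM0 : 0 ≤ M := Finset.sum_nonneg fun _ _ => by positivity
  set s : ℕ → ℝ≥0∞ := fun j => ∫⁻ x in closedBall y ρ, ‖u j x - u0 x‖ₑ ^ 2 with hs
  have hs0 : Tendsto (fun j => C * 12 * ENNReal.ofReal M * s j) atTop (𝓝 0) := by
    have := ENNReal.Tendsto.const_mul hc (Or.inr (ENNReal.mul_ne_top (ENNReal.mul_ne_top (ENNReal.coe_ne_top (r := C)) (ENNReal.ofNat_ne_top (n := 12))) (ENNReal.ofReal_ne_top (r := M))))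
    simpa using this
  filter_upwards [hs0.eventually (Iio_mem_nhds (pos_iff_ne_zero.2 hε3))] with j hj
  have hj : C * 12 * ENNReal.ofReal M * s j < ε / 3 := hj
  set T : ℕ → Set X := fun i => ball y (r (i+1)) \ closedBall y (r i) with hT
  have hTm : ∀ i, MeasurableSet (T i) := fun i => measurableSet_ball.diff measurableSet_closedBall
  have rle : ∀ i < N, r (i+1) ≤ ρ' := fun i hi => rN ▸ rm.monotone (Nat.succ_le_of_lt hi)
  have hTK : ∀ i < N, T i ⊆ closedBall y ρ := fun i hi x hx =>
    closedBall_subset_closedBall ((rle i hi).trans hρ.le) (ball_subset_closedBall hx.1)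
  set G : X → ℝ≥0∞ := fun x => ENNReal.ofReal (ed Dw x) + ENNReal.ofReal (ed (D j) x) with hG
  have aeD : AEMeasurable (fun x => ENNReal.ofReal (ed Dw x)) (volume.restrict (closedBall y ρ)) :=
    (hw.ed_int hb hcomp).1.aemeasurable.ennreal_ofReal
  have hGΛ : ∫⁻ x in closedBall y ρ, G x ≤ Λ' := by
    rw [lintegral_add_left' aeD]
    exact add_le_add le_rfl (hΛ j)
  have hsum : ∑ i ∈ Finset.range N, ∫⁻ x in T i, G x ≤ Λ' := by
    have hdis : PairwiseDisjoint (↑(Finset.range N)) T := by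
      intro i hi' k hk' hik
      wlog h : i < k generalizing i k
      · exact (this hk' hi' hik.symm (by omega)).symm
      refine Set.disjoint_left.2 fun x hx hx' => hx'.2 ?_
      exact closedBall_subset_closedBall (rm.monotone h) (ball_subset_closedBall hx.1)
    rw [← lintegral_biUnion_finset hdis (fun i _ => hTm i)]
    refine (lintegral_mono_set ?_).trans hGΛ
    refine iUnion₂_subset fun i hi => hTK i (Finset.mem_range.1 hi)
  obtain ⟨i, hiN, hi⟩ : ∃ i < N, N * ∫⁻ x in T i, G x ≤ Λ' := by
    by_contra hcon
    push Not at hcon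
    have h4 := ENNReal.sum_lt_sum_of_nonempty (s := Finset.range N) ⟨0, Finset.mem_range.2 hN0⟩ (f := fun _ => Λ') (g := fun i => N * ∫⁻ x in T i, G x)
      (fun i hi => hcon i (Finset.mem_range.1 hi))
    rw [← Finset.mul_sum, Finset.sum_const, Finset.card_range, nsmul_eq_mul] at h4
    exact absurd h4 (not_lt.2 (by gcongr))
  have hg := glue_core hΩ hC (h0.trans_le (r0 i)) (rm (Nat.lt_succ_self i)) ((rle i hiN).trans_lt hρ) hb (hη1 i) (hη2 i) (hm0 i) (hm1 i) (he0 i) (he1 i)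
    (hu j) hw (δ := δ) (by exact_mod_cast hδ)
  refine (lintegral_mono_set (ball_subset_ball (r0 (i+1)))).trans (hg.trans (add_le_add (lintegral_mono_set fun x hx => ?_) ?_))
  · exact mem_ball.2 ((mem_closedBall.1 hx).trans_lt ((rm (Nat.lt_succ_self i)).trans_le (rle i hiN)))
  have hTae : ∀ᵐ x ∂volume.restrict (T i), w x = u0 x := by
    refine ae_restrict_of_ae_restrict_of_subset (t := Ω \ ball y σ) (fun x hx => ⟨hb (hTK i hiN hx), fun h => hx.2 ?_⟩) hwu
    exact closedBall_subset_closedBall (hσ.trans (r0 i)) (ball_subset_closedBall h)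
  have hmM : Fintype.card ι * m i ^ 2 ≤ M := Finset.single_le_sum (f := fun i => Fintype.card ι * m i ^ 2) (fun _ _ => by positivity) (Finset.mem_range.2 hiN)
  have hqle : ∫⁻ x in T i, ENNReal.ofReal (∑ k, (2 * (‖Dw k x‖ + ‖D j k x‖ + m i * ‖w x - u j x‖)) ^ 2 + δ) ≤
      12 * (∫⁻ x in T i, G x) + 12 * ENNReal.ofReal M * s j + δ * volume (closedBall y ρ) := by
    calc _ ≤ ∫⁻ x in T i, (12 * G x + (12 * ENNReal.ofReal M * ‖u j x - u0 x‖ₑ ^ 2 + δ)) := by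
          refine lintegral_mono_ae ?_
          filter_upwards [hTae] with x hx
          have h5 := q_sum_le (fun k => ‖Dw k x‖) (fun k => ‖D j k x‖) (m i * ‖w x - u j x‖)
          have h6 : Fintype.card ι * (m i * ‖w x - u j x‖) ^ 2 ≤ M * ‖u j x - u0 x‖ ^ 2 := by
            rw [hx, norm_sub_rev, mul_pow, ← mul_assoc]; gcongr
          have h7 : ∑ k, (2 * (‖Dw k x‖ + ‖D j k x‖ + m i * ‖w x - u j x‖)) ^ 2 + (δ:ℝ) ≤ 12 * (ed Dw x + ed (D j) x) + (12 * M * ‖u j x - u0 x‖ ^ 2 + δ) := by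
            simp only [ed]; linarith
          refine (ENNReal.ofReal_le_ofReal h7).trans (le_of_eq ?_)
          have e1 := ed_nonneg Dw x
          have e2 := ed_nonneg (D j) x
          rw [ENNReal.ofReal_add (by positivity) (by positivity), ENNReal.ofReal_add (by positivity) (by positivity), ENNReal.ofReal_mul (by positivity), ENNReal.ofReal_add e1 e2,
            ENNReal.ofReal_mul (by positivity), ENNReal.ofReal_mul (by positivity), ENNReal.ofReal_pow (by positivity), ofReal_norm]
          simp [hG]
      _ = 12 * (∫⁻ x in T i, G x) + (∫⁻ x in T i, 12 * ENNReal.ofReal M * ‖u j x - u0 x‖ₑ ^ 2) + δ * volume (T i) := by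
          have aG : AEMeasurable G (volume.restrict (T i)) :=
            (aeD.add (((hu j).1.ed_int hb hcomp).1.aemeasurable.ennreal_ofReal)).mono_measure (Measure.restrict_mono (hTK i hiN) le_rfl)
          rw [lintegral_add_left' (aG.const_mul _), lintegral_const_mul'' _ aG, lintegral_add_right _ measurable_const]
          simp [add_assoc]
      _ ≤ _ := by
          rw [lintegral_const_mul' _ _ (ENNReal.mul_ne_top (ENNReal.ofNat_ne_top (n := 12)) ENNReal.ofReal_ne_top)]
          gcongr
          · exact lintegral_mono_set (hTK i hiN)
          · exact hTK i hiN
  calc _ ≤ (C:ℝ≥0∞) * (12 * (∫⁻ x in T i, G x) + 12 * ENNReal.ofReal M * s j + δ * volume (closedBall y ρ)) := by gcongr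
    _ = C * 12 * (∫⁻ x in T i, G x) + C * 12 * ENNReal.ofReal M * s j + δ * (C * volume (closedBall y ρ)) := by ring
    _ ≤ ε / 3 + ε / 3 + ε / 3 := by
        refine add_le_add (add_le_add ?_ hj.le) hδl.le
        have hN' : (N:ℝ≥0∞) ≠ 0 := by exact_mod_cast hN0.ne'
        rw [← ENNReal.mul_le_mul_iff_right hN' (ENNReal.natCast_ne_top N)]
        calc (N:ℝ≥0∞) * (C * 12 * ∫⁻ x in T i, G x) = C * 12 * (N * ∫⁻ x in T i, G x) := by ring
          _ ≤ C * 12 * Λ' := by gcongr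
          _ ≤ _ := hN.le
    _ = ε := ENNReal.add_thirds ε

end Star
end CT

namespace CT
set_option linter.unusedSectionVars false
open scoped ENNReal Topology Convolution NNReal

section Wk
variable {X : Type*} [NormedAddCommGroup X] [InnerProductSpace ℝ X] [FiniteDimensional ℝ X]
  [MeasurableSpace X] [BorelSpace X]
variable {ι κ : Type*} [Fintype ι] [Fintype κ]

lemma ed_sub_eq (D D0 : ι → X → EuclideanSpace ℝ κ) (x : X) :
    ed (fun i x => D i x - D0 i x) x = ed D x - 2 * (∑ i, ∑ a, D0 i x a * D i x a) + ed D0 x := by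
  simp only [ed]
  rw [Finset.mul_sum, ← Finset.sum_sub_distrib, ← Finset.sum_add_distrib]
  refine Finset.sum_congr rfl fun i _ => ?_
  rw [norm_sub_sq_real]
  congr 3

lemma wk {b : OrthonormalBasis ι ℝ X} {Ω : Set X} {u : ℕ → X → EuclideanSpace ℝ κ} {D : ℕ → ι → X → EuclideanSpace ℝ κ}
    {u0 : X → EuclideanSpace ℝ κ} {D0 : ι → X → EuclideanSpace ℝ κ} (hu : ∀ j, GM b Ω (u j) (D j)) (h0 : GM b Ω u0 D0)
    (hW : ∀ i a, WC Ω (fun j x => D j i x a) (fun x => D0 i x a)) {K : Set X} (hK : K ⊆ Ω) (hc : IsCompact K) :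
    Tendsto (fun j => (∫ x in K, ed (fun i x => D j i x - D0 i x) x) - ∫ x in K, ed (D j) x) atTop (𝓝 (- ∫ x in K, ed D0 x)) := by
  have mD : ∀ i a, MemLp (fun x => D0 i x a) 2 (volume.restrict K) := fun i a => ((h0.1 i).comp_a a).2.1 K hK hc
  have mDj : ∀ j i a, MemLp (fun x => D j i x a) 2 (volume.restrict K) := fun j i a => (((hu j).1 i).comp_a a).2.1 K hK hc
  have hpi : ∀ j i a, Integrable (fun x => D0 i x a * D j i x a) (volume.restrict K) := fun j i a => (mD i a).integrable_mul (mDj j i a)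
  have hps : ∀ j, Integrable (fun x => ∑ i, ∑ a, D0 i x a * D j i x a) (volume.restrict K) := fun j =>
    integrable_finsetSum _ fun i _ => integrable_finsetSum _ fun a _ => hpi j i a
  have e1 : ∀ j, (∫ x in K, ed (fun i x => D j i x - D0 i x) x) - ∫ x in K, ed (D j) x =
      - 2 * (∑ i, ∑ a, ∫ x in K, D0 i x a * D j i x a) + ∫ x in K, ed D0 x := by
    intro j
    simp only [ed_sub_eq]
    rw [integral_add, integral_sub ((hu j).ed_int hK hc) ((hps j).const_mul 2), integral_const_mul, integral_finsetSum]
    · simp_rw [integral_finsetSum Finset.univ (fun a _ => hpi j _ a)]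
      ring
    · exact fun i _ => integrable_finsetSum _ fun a _ => hpi j i a
    · exact ((hu j).ed_int hK hc).sub ((hps j).const_mul 2)
    · exact h0.ed_int hK hc
  simp only [e1]
  have t1 : Tendsto (fun j => ∑ i, ∑ a, ∫ x in K, D0 i x a * D j i x a) atTop (𝓝 (∑ i, ∑ a, ∫ x in K, D0 i x a * D0 i x a)) :=
    tendsto_finsetSum _ fun i _ => tendsto_finsetSum _ fun a _ => (hW i a).2 K hK hc _ (mD i a)
  have e2 : ∑ i, ∑ a, ∫ x in K, D0 i x a * D0 i x a = ∫ x in K, ed D0 x := by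
    have hpi0 : ∀ i a, Integrable (fun x => D0 i x a * D0 i x a) (volume.restrict K) := fun i a => (mD i a).integrable_mul (mD i a)
    have : ∀ x, ed D0 x = ∑ i, ∑ a, D0 i x a * D0 i x a := fun x => by
      simp only [ed, EuclideanSpace.real_norm_sq_eq]
      simp only [pow_two]
    simp only [this]
    rw [integral_finsetSum _ fun i _ => integrable_finsetSum _ fun a _ => hpi0 i a]
    simp_rw [integral_finsetSum Finset.univ (fun a _ => hpi0 _ a)]
  rw [e2] at t1
  have := (t1.const_mul (-2)).add_const (∫ x in K, ed D0 x)
  refine this.trans (le_of_eq ?_)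
  congr 1; ring

lemma ed_int_sub {b : OrthonormalBasis ι ℝ X} {Ω : Set X} {u u0 : X → EuclideanSpace ℝ κ} {D D0 : ι → X → EuclideanSpace ℝ κ}
    (hu : GM b Ω u D) (h0 : GM b Ω u0 D0) {K : Set X} (hK : K ⊆ Ω) (hc : IsCompact K) :
    IntegrableOn (ed (fun i x => D i x - D0 i x)) K volume :=
  integrable_finsetSum _ fun i _ => (((hu.1 i).2.1 K hK hc).sub ((h0.1 i).2.1 K hK hc)).integrable_norm_pow two_ne_zero

lemma lsc {b : OrthonormalBasis ι ℝ X} {Ω : Set X} {u : ℕ → X → EuclideanSpace ℝ κ} {D : ℕ → ι → X → EuclideanSpace ℝ κ}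
    {u0 : X → EuclideanSpace ℝ κ} {D0 : ι → X → EuclideanSpace ℝ κ} (hu : ∀ j, GM b Ω (u j) (D j)) (h0 : GM b Ω u0 D0)
    (hW : ∀ i a, WC Ω (fun j x => D j i x a) (fun x => D0 i x a)) {K : Set X} (hK : K ⊆ Ω) (hc : IsCompact K)
    {A : ℝ} (hA : ∀ᶠ j in atTop, ∫ x in K, ed (D j) x ≤ A) : ∫ x in K, ed D0 x ≤ A := by
  have h := wk hu h0 hW hK hc
  refine neg_le_neg_iff.1 (ge_of_tendsto h ?_)
  filter_upwards [hA] with j hj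
  have : 0 ≤ ∫ x in K, ed (fun i x => D j i x - D0 i x) x := integral_nonneg fun x => ed_nonneg _ x
  linarith

lemma strong_of_limsup {b : OrthonormalBasis ι ℝ X} {Ω : Set X} {u : ℕ → X → EuclideanSpace ℝ κ} {D : ℕ → ι → X → EuclideanSpace ℝ κ}
    {u0 : X → EuclideanSpace ℝ κ} {D0 : ι → X → EuclideanSpace ℝ κ} (hu : ∀ j, GM b Ω (u j) (D j)) (h0 : GM b Ω u0 D0)
    (hW : ∀ i a, WC Ω (fun j x => D j i x a) (fun x => D0 i x a)) {K : Set X} (hK : K ⊆ Ω) (hc : IsCompact K)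
    (hA : ∀ ε > 0, ∀ᶠ j in atTop, ∫ x in K, ed (D j) x ≤ (∫ x in K, ed D0 x) + ε) :
    Tendsto (fun j => ∫ x in K, ed (fun i x => D j i x - D0 i x) x) atTop (𝓝 0) := by
  have h := wk hu h0 hW hK hc
  have hn : ∀ j, 0 ≤ ∫ x in K, ed (fun i x => D j i x - D0 i x) x := fun j => integral_nonneg fun x => ed_nonneg _ x
  rw [Metric.tendsto_atTop'] 
  intro ε hε
  have h1 := (hA (ε/2) (by positivity)).and (h.eventually (Iio_mem_nhds (show - ∫ x in K, ed D0 x < - (∫ x in K, ed D0 x) + ε/2 by linarith)))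
  obtain ⟨n, hn'⟩ := eventually_atTop.1 h1
  refine ⟨n, fun j hj => ?_⟩
  obtain ⟨h2, h3⟩ := hn' j hj.le
  have h3 : _ < _ := h3
  rw [Real.dist_eq, sub_zero, abs_of_nonneg (hn j)]
  linarith

lemma bigger_ball {Ω : Set X} (hΩ : IsOpen Ω) {y : X} {ρ : ℝ} (hρ : 0 < ρ) (h : closedBall y ρ ⊆ Ω) :
    ∃ ρ1 > ρ, closedBall y ρ1 ⊆ Ω := by
  obtain ⟨δ, hδ, hs⟩ := (isCompact_closedBall y ρ).exists_cthickening_subset_open hΩ h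
  refine ⟨ρ + δ, by linarith, ?_⟩
  rwa [cthickening_closedBall hδ.le hρ.le, add_comm] at hs

lemma cont_above {y : X} {ρ ρ1 : ℝ} (h1 : ρ < ρ1) {f : X → ℝ≥0∞} (hf : ∫⁻ x in closedBall y ρ1, f x ≠ ∞) {ε : ℝ≥0∞} (hε : ε ≠ 0) :
    ∃ ρ', ρ < ρ' ∧ ρ' < ρ1 ∧ ∫⁻ x in ball y ρ', f x ≤ (∫⁻ x in closedBall y ρ, f x) + ε := by
  set μ := (volume.restrict (closedBall y ρ1)).withDensity f
  have hμ : ∀ s, MeasurableSet s → s ⊆ closedBall y ρ1 → μ s = ∫⁻ x in s, f x := fun s hs hss => by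
    rw [withDensity_apply _ hs, Measure.restrict_restrict hs, inter_eq_left.2 hss]
  set r : ℕ → ℝ := fun n => ρ + (ρ1 - ρ) / (n + 2) with hr
  have hd : 0 < ρ1 - ρ := sub_pos.2 h1
  have hr0 : ∀ n, ρ < r n := fun n => by simp only [hr]; linarith [show 0 < (ρ1 - ρ) / (n + 2 : ℝ) by positivity]
  have hr1 : ∀ n, r n < ρ1 := fun n => by
    have : (ρ1 - ρ) / (n + 2 : ℝ) < ρ1 - ρ := div_lt_self hd (by linarith [show (0:ℝ) ≤ n by positivity])
    simp only [hr]; linarith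
  have ra : Antitone r := fun i k hik => by
    have : (i:ℝ) ≤ k := by exact_mod_cast hik
    simp only [hr]; gcongr
  have rt : Tendsto r atTop (𝓝 ρ) := by
    have := (tendsto_const_nhds (x := ρ1 - ρ)).div_atTop (tendsto_atTop_add_const_right _ (2:ℝ) tendsto_natCast_atTop_atTop)
    simpa [hr] using this.const_add ρ
  have hI : ⋂ n, ball y (r n) = closedBall y ρ := by
    ext x
    simp only [mem_iInter, mem_ball, mem_closedBall]
    exact ⟨fun h => ge_of_tendsto' rt fun n => (h n).le, fun h n => h.trans_lt (hr0 n)⟩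
  have ht := tendsto_measure_iInter_atTop (μ := μ) (s := fun n => ball y (r n)) (fun n => measurableSet_ball.nullMeasurableSet)
    (fun i k hik => ball_subset_ball (ra hik)) ⟨0, by
      rw [hμ _ measurableSet_ball (ball_subset_closedBall.trans (closedBall_subset_closedBall (hr1 0).le))]
      exact ((lintegral_mono_set (ball_subset_closedBall.trans (closedBall_subset_closedBall (hr1 0).le))).trans_lt (lt_top_iff_ne_top.2 hf)).ne⟩
  rw [hI, hμ _ measurableSet_closedBall (closedBall_subset_closedBall h1.le)] at ht
  have hfin : ∫⁻ x in closedBall y ρ, f x ≠ ∞ := ((lintegral_mono_set (closedBall_subset_closedBall h1.le)).trans_lt (lt_top_iff_ne_top.2 hf)).ne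
  obtain ⟨n, hn⟩ := (ht.eventually (Iio_mem_nhds (ENNReal.lt_add_right hfin hε))).exists
  refine ⟨r n, hr0 n, hr1 n, ?_⟩
  rw [← hμ _ measurableSet_ball (ball_subset_closedBall.trans (closedBall_subset_closedBall (hr1 n).le))]
  exact le_of_lt hn

lemma sup_balls {y : X} {σ ρ : ℝ} (h1 : σ < ρ) {f : X → ℝ≥0∞} {A : ℝ≥0∞}
    (h : ∀ s, σ < s → s < ρ → ∫⁻ x in closedBall y s, f x ≤ A) : ∫⁻ x in ball y ρ, f x ≤ A := by
  set r : ℕ → ℝ := fun n => ρ - (ρ - σ) / (n + 2) with hr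
  have hd : 0 < ρ - σ := sub_pos.2 h1
  have hr0 : ∀ n, r n < ρ := fun n => by simp only [hr]; linarith [show 0 < (ρ - σ) / (n + 2 : ℝ) by positivity]
  have hr1 : ∀ n, σ < r n := fun n => by
    have : (ρ - σ) / (n + 2 : ℝ) < ρ - σ := div_lt_self hd (by linarith [show (0:ℝ) ≤ n by positivity])
    simp only [hr]; linarith
  have ra : Monotone r := fun i k hik => by
    have : (i:ℝ) ≤ k := by exact_mod_cast hik
    simp only [hr]; gcongr
  have rt : Tendsto r atTop (𝓝 ρ) := by
    have := (tendsto_const_nhds (x := ρ - σ)).div_atTop (tendsto_atTop_add_const_right _ (2:ℝ) tendsto_natCast_atTop_atTop)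
    simpa [hr] using this.const_sub ρ
  have hI : ball y ρ = ⋃ n, closedBall y (r n) := by
    ext x
    simp only [mem_iUnion, mem_ball, mem_closedBall]
    exact ⟨fun h => ((rt.eventually (Ioi_mem_nhds h)).exists).imp fun n hn => le_of_lt hn, fun ⟨n, hn⟩ => hn.trans_lt (hr0 n)⟩
  rw [hI, setLIntegral_iUnion_of_directed _ (Monotone.directed_le fun i k hik => closedBall_subset_closedBall (ra hik))]
  exact iSup_le fun n => h _ (hr1 n) (hr0 n)

lemma lint_eq {D : ι → X → EuclideanSpace ℝ κ} {K : Set X} (h : IntegrableOn (ed D) K volume) :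
    ∫⁻ x in K, ENNReal.ofReal (ed D x) = ENNReal.ofReal (∫ x in K, ed D x) :=
  (ofReal_integral_eq_lintegral_ofReal h (ae_of_all _ fun x => ed_nonneg _ x)).symm

lemma main3 (h3 : 3 ≤ Fintype.card κ) [Nonempty ι] {b : OrthonormalBasis ι ℝ X} {Ω : Set X} (hΩ : IsOpen Ω)
    {u : ℕ → X → EuclideanSpace ℝ κ} {D : ℕ → ι → X → EuclideanSpace ℝ κ}
    {u0 : X → EuclideanSpace ℝ κ} {D0 : ι → X → EuclideanSpace ℝ κ} (hu : ∀ j, Mz b Ω (u j) (D j)) (h0 : GM b Ω u0 D0)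
    (hW : ∀ i a, WC Ω (fun j x => D j i x a) (fun x => D0 i x a))
    (hS : ∀ K ⊆ Ω, IsCompact K → Tendsto (fun j => eLpNorm (u j - u0) 2 (volume.restrict K)) atTop (𝓝 0))
    (hbd : ∀ K ⊆ Ω, IsCompact K → ∃ C : ℝ≥0, ∀ j, ∫⁻ x in K, ENNReal.ofReal (ed (D j) x) ≤ C) :
    Mz b Ω u0 D0 ∧ ∀ (y : X) (ρ : ℝ), 0 < ρ → closedBall y ρ ⊆ Ω →
      Tendsto (fun j => ∫ x in closedBall y ρ, ed (fun i x => D j i x - D0 i x) x) atTop (𝓝 0) := by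
  have h3' : 3 ≤ Module.finrank ℝ (EuclideanSpace ℝ κ) := by simpa using h3
  have hu' := fun j => (hu j).1
  have hS' : ∀ K ⊆ Ω, IsCompact K → Tendsto (fun j => ∫⁻ x in K, ‖u j x - u0 x‖ₑ ^ 2) atTop (𝓝 0) := by
    intro K hK hc
    have := ENNReal.Tendsto.pow (n := 2) (hS K hK hc)
    simp only [eLpNorm_two_sq] at this
    simpa using this
  constructor
  · refine ⟨h0, fun y ρ hρ hb w Dw hw hs => ?_⟩
    obtain ⟨σ, hσ, hwu⟩ := hs
    have hcomp := isCompact_closedBall y ρ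
    obtain ⟨Λ, hΛ⟩ := hbd _ hb hcomp
    have key : ∫⁻ x in ball y ρ, ENNReal.ofReal (ed D0 x) ≤ ∫⁻ x in ball y ρ, ENNReal.ofReal (ed Dw x) := by
      refine sup_balls (σ := max σ (ρ / 2)) (max_lt hσ (by linarith)) fun s hs1 hs2 => ?_
      have hs3 := (le_max_left σ (ρ/2)).trans_lt hs1
      have hs4 := (le_max_right σ (ρ/2)).trans_lt hs1
      have hsK : closedBall y s ⊆ Ω := (closedBall_subset_closedBall hs2.le).trans hb
      have hfin : ∫⁻ x in ball y ρ, ENNReal.ofReal (ed Dw x) ≠ ∞ :=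
        ((lintegral_mono_set ball_subset_closedBall).trans_lt (hw.lint_lt hb hcomp)).ne
      rw [lint_eq (h0.ed_int hsK (isCompact_closedBall _ _))]
      refine ENNReal.le_of_forall_pos_le_add fun ε hε _ => ?_
      have hst := star h3' hΩ hu hw (σ := σ) (σ' := (s + (s + ρ) / 2) / 2) (ρ' := (s + ρ) / 2) (by linarith) (by linarith) (by linarith) (by linarith) hb hwu hΛ (hS' _ hb hcomp) (ε := ε) (by exact_mod_cast hε.ne')
      refine (ENNReal.ofReal_le_iff_le_toReal (ENNReal.add_ne_top.2 ⟨hfin, ENNReal.coe_ne_top⟩)).2 ?_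
      refine lsc hu' h0 hW hsK (isCompact_closedBall _ _) ?_
      filter_upwards [hst] with j hj
      rw [← ENNReal.ofReal_le_iff_le_toReal (ENNReal.add_ne_top.2 ⟨hfin, ENNReal.coe_ne_top⟩), ← lint_eq ((hu' j).ed_int hsK (isCompact_closedBall _ _))]
      refine le_trans (lintegral_mono_set ?_) (hj.trans (add_le_add (lintegral_mono_set (ball_subset_ball (by linarith))) le_rfl))
      exact closedBall_subset_ball (by linarith)
    have i1 := (h0.ed_int hb hcomp).mono_set ball_subset_closedBall
    have i2 := (hw.ed_int hb hcomp).mono_set ball_subset_closedBall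
    rw [lint_eq i1, lint_eq i2] at key
    exact (ENNReal.ofReal_le_ofReal_iff (integral_nonneg fun x => ed_nonneg _ x)).1 key
  · intro y ρ hρ hb
    obtain ⟨ρ1, hρ1, hb1⟩ := bigger_ball hΩ hρ hb
    have hcomp := isCompact_closedBall y ρ1
    obtain ⟨Λ, hΛ⟩ := hbd _ hb1 hcomp
    refine strong_of_limsup hu' h0 hW hb (isCompact_closedBall _ _) fun ε hε => ?_
    have hε2 : ENNReal.ofReal (ε / 2) ≠ 0 := by simpa using hε
    obtain ⟨ρ', h1, h2, h4⟩ := cont_above hρ1 (f := fun x => ENNReal.ofReal (ed D0 x)) (h0.lint_lt hb1 hcomp).ne hε2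
    have hst := star h3' hΩ hu h0 (u0 := u0) (σ := ρ) (σ' := (ρ + ρ') / 2) (ρ' := ρ') (by linarith) (by linarith) (by linarith) h2 hb1 (ae_of_all _ fun _ => rfl) hΛ (hS' _ hb1 hcomp) hε2
    filter_upwards [hst] with j hj
    have h5 := (lintegral_mono_set (closedBall_subset_ball (by linarith : ρ < (ρ + ρ') / 2))).trans (hj.trans (add_le_add h4 le_rfl))
    rw [lint_eq ((hu' j).ed_int hb (isCompact_closedBall _ _)), lint_eq (h0.ed_int hb (isCompact_closedBall _ _))] at h5
    have hI0 : 0 ≤ ∫ x in closedBall y ρ, ed D0 x := integral_nonneg fun x => ed_nonneg _ x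
    rw [← ENNReal.ofReal_add hI0 (by positivity), ← ENNReal.ofReal_add (by positivity) (by positivity), ENNReal.ofReal_le_ofReal_iff (by positivity)] at h5
    linarith

end Wk
end CT

namespace CT
set_option linter.unusedSectionVars false
open scoped ENNReal Topology Convolution NNReal

section CD
variable {X : Type*} [NormedAddCommGroup X] [InnerProductSpace ℝ X] [FiniteDimensional ℝ X]
  [MeasurableSpace X] [BorelSpace X]
variable {ι : Type*} [Fintype ι]

lemma cd_fderiv {f : X → ℝ} (hf : ContDiff ℝ (⊤ : ℕ∞) f) (a : X) : ContDiff ℝ (⊤ : ℕ∞) (fun x => fderiv ℝ f x a) :=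
  (hf.fderiv_right (m := (⊤ : ℕ∞)) (by simp)).clm_apply contDiff_const

lemma cs_fderiv {f : X → ℝ} (hf : HasCompactSupport f) (a : X) : HasCompactSupport (fun x => fderiv ℝ f x a) :=
  hf.mono' ((subset_tsupport _).trans (tsupport_fderiv_sub f a))

lemma symm2 {f : X → ℝ} (hf : ContDiff ℝ (⊤ : ℕ∞) f) (x a c : X) :
    fderiv ℝ (fun y => fderiv ℝ f y a) x c = fderiv ℝ (fun y => fderiv ℝ f y c) x a := by
  have hd : DifferentiableAt ℝ (fderiv ℝ f) x := (hf.fderiv_right (m := 1) (by norm_cast)).differentiable (by simp) x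
  have h := (hf.contDiffAt (x := x)).isSymmSndFDerivAt (by simp; norm_cast)
  have e : ∀ a c, fderiv ℝ (fun y => fderiv ℝ f y a) x c = fderiv ℝ (fderiv ℝ f) x c a := fun a c => by
    rw [fderiv_clm_apply hd (differentiableAt_const a)]; simp
  rw [e, e]; exact h c a

def CDF (b : OrthonormalBasis ι ℝ X) (O : Set X) (F : ι → X → ℝ) : Prop :=
  ∀ φ : X → ℝ, ContDiff ℝ (⊤ : ℕ∞) φ → HasCompactSupport φ → tsupport φ ⊆ O →
    (∀ i k, ∫ x, fderiv ℝ φ x (b k) * F i x = ∫ x, fderiv ℝ φ x (b i) * F k x) ∧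
    ∑ i, ∫ x, fderiv ℝ φ x (b i) * F i x = 0

lemma mol_CDF {b : OrthonormalBasis ι ℝ X} {O : Set X} {F : ι → X → ℝ} (H : CDF b O F)
    (hF : ∀ i, LocallyIntegrable (F i) volume) {k : ℕ} {x : X} (hx : closedBall x (dl k) ⊆ O) :
    (∀ i l, fderiv ℝ (mol k (F i)) x (b l) = fderiv ℝ (mol k (F l)) x (b i)) ∧
      ∑ i, fderiv ℝ (mol k (F i)) x (b i) = 0 := by
  simp only [mol_fderiv k (hF _)]
  have hd : ∀ t e, fderiv ℝ (fun t => ker k (x - t)) t e = - fderiv ℝ (ker k) (x - t) e := by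
    intro t e
    have h1 : HasFDerivAt (fun t => x - t) (-(ContinuousLinearMap.id ℝ X)) t := by
      simpa using (hasFDerivAt_id t).const_sub x
    have h2 := (((ker_contDiff k).differentiable (by simp)) (x - t)).hasFDerivAt
    have h3 := (h2.comp t h1).fderiv
    have : (fun t => ker k (x - t)) = (ker k) ∘ (fun t => x - t) := rfl
    rw [this, h3]; simp
  have hts : tsupport (fun t => ker k (x - t)) ⊆ closedBall x (dl k) := by
    apply closure_minimal _ isClosed_closedBall
    intro t ht
    by_contra hcon
    apply ht
    apply ker_eq_zero
    simpa [dist_eq_norm, norm_sub_rev] using hcon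
  have := H (fun t => ker k (x - t)) ((ker_contDiff k).comp (contDiff_const.sub contDiff_id))
    (HasCompactSupport.of_support_subset_isCompact (isCompact_closedBall x (dl k))
      ((subset_tsupport _).trans hts))
    (hts.trans hx)
  simp only [hd, neg_mul, integral_neg, neg_inj, Finset.sum_neg_distrib, neg_eq_zero] at this
  exact ⟨fun i l => this.1 i l, this.2⟩

lemma smooth_id {b : OrthonormalBasis ι ℝ X} {F : ι → X → ℝ} (hF : ∀ i, ContDiff ℝ (⊤ : ℕ∞) (F i)) {V : Set X}
    (hV : IsOpen V) (hcd : ∀ x ∈ V, (∀ i l, fderiv ℝ (F i) x (b l) = fderiv ℝ (F l) x (b i)) ∧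
      ∑ i, fderiv ℝ (F i) x (b i) = 0) {θ : X → ℝ} (hθ : ContDiff ℝ (⊤ : ℕ∞) θ) (hc : HasCompactSupport θ)
    (hs : tsupport θ ⊆ V) (l : ι) :
    ∑ i, ∫ x, θ x * fderiv ℝ (F l) x (b i) ^ 2 =
      1 / 2 * ∑ i, ∫ x, fderiv ℝ (fun y => fderiv ℝ θ y (b i)) x (b i) * F l x ^ 2 := by
  have hd : ∀ i x, DifferentiableAt ℝ (F i) x := fun i x => (hF i).differentiable (by simp) x
  have hg : ∀ i e, ContDiff ℝ (⊤ : ℕ∞) (fun x => fderiv ℝ (F i) x e) := fun i e => cd_fderiv (hF i) e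
  have hgd : ∀ i e x, DifferentiableAt ℝ (fun x => fderiv ℝ (F i) x e) x := fun i e x => (hg i e).differentiable (by simp) x
  have lap : ∀ x ∈ V, ∑ i, fderiv ℝ (fun y => fderiv ℝ (F l) y (b i)) x (b i) = 0 := by
    intro x hx
    have e1 : ∀ i, fderiv ℝ (fun y => fderiv ℝ (F l) y (b i)) x (b i) = fderiv ℝ (fun y => fderiv ℝ (F i) y (b i)) x (b l) := by
      intro i
      rw [← symm2 (hF i)]
      congr 1
      exact Filter.EventuallyEq.fderiv_eq (by filter_upwards [hV.mem_nhds hx] with y hy using (hcd y hy).1 l i)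
    simp only [e1]
    have e2 : ∑ i, fderiv ℝ (fun y => fderiv ℝ (F i) y (b i)) x (b l) = fderiv ℝ (fun y => ∑ i, fderiv ℝ (F i) y (b i)) x (b l) := by
      rw [fderiv_fun_sum fun i _ => hgd i (b i) x]; simp
    rw [e2, Filter.EventuallyEq.fderiv_eq (f := fun _ => (0:ℝ)) (by filter_upwards [hV.mem_nhds hx] with y hy using (hcd y hy).2)]
    simp
  have A : ∀ i, ∫ x, fderiv ℝ θ x (b i) * (F l x * fderiv ℝ (F l) x (b i)) =
      - ((∫ x, θ x * fderiv ℝ (F l) x (b i) ^ 2) + ∫ x, θ x * (F l x * fderiv ℝ (fun y => fderiv ℝ (F l) y (b i)) x (b i))) := by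
    intro i
    have h1 := ibp_C1 (f := fun x => F l x * fderiv ℝ (F l) x (b i)) (((hF l).mul (hg l (b i))).of_le (by simp)) hθ hc (b i)
    simp only [smul_eq_mul] at h1
    rw [h1, ← integral_add]
    · congr 2; funext x
      rw [fderiv_fun_mul (hd l x) (hgd l _ x)]
      simp; ring
    · exact Continuous.integrable_of_hasCompactSupport (hθ.continuous.mul ((hg l _).continuous.pow 2)) hc.mul_right
    · exact Continuous.integrable_of_hasCompactSupport (hθ.continuous.mul ((hF l).continuous.mul (cd_fderiv (hg l _) _).continuous)) hc.mul_right
  have B : ∀ i, ∫ x, fderiv ℝ (fun y => fderiv ℝ θ y (b i)) x (b i) * F l x ^ 2 =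
      - (2 * ∫ x, fderiv ℝ θ x (b i) * (F l x * fderiv ℝ (F l) x (b i))) := by
    intro i
    have h1 := ibp_C1 (f := fun x => F l x ^ 2) (((hF l).pow 2).of_le (by simp)) (cd_fderiv hθ (b i)) (cs_fderiv hc (b i)) (b i)
    simp only [smul_eq_mul] at h1
    rw [h1, ← integral_const_mul]
    congr 2; funext x
    rw [fderiv_fun_pow _ (hd l x)]
    simp; ring
  have Z : ∑ i, ∫ x, θ x * (F l x * fderiv ℝ (fun y => fderiv ℝ (F l) y (b i)) x (b i)) = 0 := by
    rw [← integral_finsetSum]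
    · refine integral_eq_zero_of_ae (ae_of_all _ fun x => ?_)
      simp only [← Finset.mul_sum]
      by_cases hx : x ∈ tsupport θ
      · simp [lap x (hs hx)]
      · simp [image_eq_zero_of_notMem_tsupport hx]
    · intro i _
      exact Continuous.integrable_of_hasCompactSupport (hθ.continuous.mul ((hF l).continuous.mul (cd_fderiv (hg l _) _).continuous)) hc.mul_right
  simp only [B, A, Finset.sum_neg_distrib, ← Finset.mul_sum, Finset.sum_add_distrib, Z]
  ring

end CD
end CT

namespace CT
set_option linter.unusedSectionVars false
open scoped ENNReal Topology Convolution NNReal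

section CD
variable {X : Type*} [NormedAddCommGroup X] [InnerProductSpace ℝ X] [FiniteDimensional ℝ X]
  [MeasurableSpace X] [BorelSpace X]
variable {ι : Type*} [Fintype ι]

lemma cacc (b : OrthonormalBasis ι ℝ X) {θ : X → ℝ} (hθ : ContDiff ℝ (⊤ : ℕ∞) θ) (hc : HasCompactSupport θ) (h0 : ∀ x, 0 ≤ θ x)
    {A : Set X} (hA : MeasurableSet A) (h1 : ∀ x ∈ A, θ x = 1) :
    ∃ C : ℝ≥0, ∀ (V : Set X) (F : ι → X → ℝ), IsOpen V → tsupport θ ⊆ V → (∀ i, ContDiff ℝ (⊤ : ℕ∞) (F i)) →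
      (∀ x ∈ V, (∀ i l, fderiv ℝ (F i) x (b l) = fderiv ℝ (F l) x (b i)) ∧ ∑ i, fderiv ℝ (F i) x (b i) = 0) →
      ∀ l, ∫⁻ x in A, ∑ i, ‖fderiv ℝ (F l) x (b i)‖ₑ ^ 2 ≤ C * ∫⁻ x, ‖F l x‖ₑ ^ 2 := by
  have hcont : ∀ i, Continuous (fun x => fderiv ℝ (fun y => fderiv ℝ θ y (b i)) x (b i)) := fun i =>
    (cd_fderiv (cd_fderiv hθ _) _).continuous
  have hcs : ∀ i, HasCompactSupport (fun x => fderiv ℝ (fun y => fderiv ℝ θ y (b i)) x (b i)) := fun i =>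
    cs_fderiv (cs_fderiv hc _) _
  choose M hM using fun i => (hcs i).exists_bound_of_continuous (hcont i)
  have hM0 : ∀ i, 0 ≤ M i := fun i => (norm_nonneg _).trans (hM i 0)
  have hS0 : 0 ≤ ∑ i, M i := Finset.sum_nonneg fun i _ => hM0 i
  refine ⟨Real.toNNReal (∑ i, M i + 1), fun V F hV hs hF hcd l => ?_⟩
  by_cases hfin : ∫⁻ x, ‖F l x‖ₑ ^ 2 = ∞
  · rw [hfin, ENNReal.mul_top (by simp only [ne_eq, ENNReal.coe_eq_zero, Real.toNNReal_eq_zero, not_le]; linarith)]; exact le_top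
  have e0 : ∀ x, ‖F l x‖ₑ ^ 2 = ENNReal.ofReal (F l x ^ 2) := fun x => by
    rw [Real.enorm_eq_ofReal_abs, ← ENNReal.ofReal_pow (abs_nonneg _), sq_abs]
  have iF : Integrable (fun x => F l x ^ 2) volume := by
    refine ⟨((hF l).continuous.pow 2).aestronglyMeasurable, ?_⟩
    rw [hasFiniteIntegral_iff_ofReal (ae_of_all _ fun x => by positivity)]
    simp only [← e0]; exact lt_top_iff_ne_top.2 hfin
  have ci : ∀ i, Integrable (fun x => θ x * fderiv ℝ (F l) x (b i) ^ 2) volume := fun i =>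
    Continuous.integrable_of_hasCompactSupport (hθ.continuous.mul ((cd_fderiv (hF l) _).continuous.pow 2)) hc.mul_right
  have hid := smooth_id hF hV hcd hθ hc hs l
  have hle : ∑ i, ∫ x, θ x * fderiv ℝ (F l) x (b i) ^ 2 ≤ (∑ i, M i + 1) * ∫ x, F l x ^ 2 := by
    have hI0 : 0 ≤ ∫ x, F l x ^ 2 := integral_nonneg fun x => by positivity
    have hi : ∀ i, ∫ x, fderiv ℝ (fun y => fderiv ℝ θ y (b i)) x (b i) * F l x ^ 2 ≤ M i * ∫ x, F l x ^ 2 := by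
      intro i
      rw [← integral_const_mul]
      refine integral_mono (Continuous.integrable_of_hasCompactSupport ((hcont i).mul ((hF l).continuous.pow 2)) (hcs i).mul_right)
        (iF.const_mul _) fun x => ?_
      exact mul_le_mul_of_nonneg_right ((le_abs_self _).trans (hM i x)) (by positivity)
    rw [hid]
    have := Finset.sum_le_sum fun i (_ : i ∈ Finset.univ) => hi i
    rw [← Finset.sum_mul] at this
    nlinarith [mul_nonneg hS0 hI0]
  calc ∫⁻ x in A, ∑ i, ‖fderiv ℝ (F l) x (b i)‖ₑ ^ 2
      ≤ ∫⁻ x in A, ENNReal.ofReal (∑ i, θ x * fderiv ℝ (F l) x (b i) ^ 2) := by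
        refine setLIntegral_mono' hA fun x hx => ?_
        rw [ENNReal.ofReal_sum_of_nonneg fun i _ => by have := h0 x; positivity]
        refine Finset.sum_le_sum fun i _ => ?_
        rw [h1 x hx, one_mul, Real.enorm_eq_ofReal_abs, ← ENNReal.ofReal_pow (abs_nonneg _), sq_abs]
    _ ≤ ∫⁻ x, ENNReal.ofReal (∑ i, θ x * fderiv ℝ (F l) x (b i) ^ 2) := setLIntegral_le_lintegral _ _
    _ = ENNReal.ofReal (∑ i, ∫ x, θ x * fderiv ℝ (F l) x (b i) ^ 2) := by
        rw [← integral_finsetSum _ fun i _ => ci i, ofReal_integral_eq_lintegral_ofReal (integrable_finsetSum _ fun i _ => ci i)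
          (ae_of_all _ fun x => Finset.sum_nonneg fun i _ => by have := h0 x; positivity)]
    _ ≤ ENNReal.ofReal ((∑ i, M i + 1) * ∫ x, F l x ^ 2) := ENNReal.ofReal_le_ofReal hle
    _ = _ := by
        rw [ENNReal.ofReal_mul (by linarith), ofReal_integral_eq_lintegral_ofReal iF (ae_of_all _ fun x => by positivity)]
        simp only [e0]; rfl

lemma trans_CD {b : OrthonormalBasis ι ℝ X} {O : Set X} (hO : IsOpen O) {θ : X → ℝ} (hθ : ContDiff ℝ (⊤ : ℕ∞) θ)
    (hc : HasCompactSupport θ) (h0 : ∀ x, 0 ≤ θ x) (hs : tsupport θ ⊆ O)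
    {A' : Set X} (hA' : MeasurableSet A') (h1 : ∀ x ∈ A', θ x = 1) :
    ∃ C : ℝ≥0, ∀ G : ι → X → ℝ, (∀ i, MemLp (G i) 2 (volume : Measure X)) → CDF b O G →
      ∀ (k : ℕ) (A : Set X), MeasurableSet A → (∀ x ∈ A, closedBall x (dl k) ⊆ A') → ∀ l,
      eLpNorm (mol k (G l) - G l) 2 (volume.restrict A) ≤ ENNReal.ofReal (dl k) * (C * ∫⁻ x, ‖G l x‖ₑ ^ 2) ^ (1/2 : ℝ) := by
  obtain ⟨C, hC⟩ := cacc b hθ hc h0 hA' h1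
  obtain ⟨K, Kc, hK1, hK2⟩ := exists_compact_between hc hO hs
  refine ⟨C, fun G hG hcd k A hA hAA l => ?_⟩
  set f := G l with hfdef
  have hf := hG l
  have lG : ∀ i, LocallyIntegrable (G i) volume := fun i => memLp_locallyIntegrable (hG i)
  have lf := lG l
  have mc : ∀ m, Continuous (mol m f) := fun m => (mol_contDiff m lf).continuous
  have lm : ∀ m, LocallyIntegrable (mol m f) volume := fun m => (mc m).locallyIntegrable
  have key : ∀ᶠ m in atTop, eLpNorm (mol k (mol m f) - mol m f) 2 (volume.restrict A) ≤
      ENNReal.ofReal (dl k) * (C * ∫⁻ x, ‖f x‖ₑ ^ 2) ^ (1/2 : ℝ) := by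
    filter_upwards [exists_dl Kc hO hK2] with m hm
    have h1 := trans_C1 b ((mol_contDiff m lf).of_le (by simp)) k hA hA' hAA
    have h2 : ∫⁻ x in A', ∑ i, ‖fderiv ℝ (mol m f) x (b i)‖ₑ ^ 2 ≤ C * ∫⁻ x, ‖f x‖ₑ ^ 2 := by
      refine (hC (interior K) (fun i => mol m (G i)) isOpen_interior hK1 (fun i => mol_contDiff m (lG i))
        (fun x hx => mol_CDF hcd lG (hm x (interior_subset hx))) l).trans (mul_le_mul_right ?_ _)
      have := mol_lint_le m hf.1 MeasurableSet.univ MeasurableSet.univ (fun x _ => subset_univ _)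
      simpa using this
    have h3 : eLpNorm (mol k (mol m f) - mol m f) 2 (volume.restrict A) ^ 2 ≤
       (ENNReal.ofReal (dl k) * (C * ∫⁻ x, ‖f x‖ₑ ^ 2) ^ (1/2 : ℝ)) ^ 2 := by
      rw [eLpNorm_two_sq, mul_pow, ← ENNReal.rpow_natCast (_ ^ (1/2 : ℝ)), ← ENNReal.rpow_mul]
      norm_num
      exact h1.trans (mul_le_mul_right h2 _)
    exact (ENNReal.pow_le_pow_left_iff two_ne_zero).1 h3
  set C := ENNReal.ofReal (dl k) * (C * ∫⁻ x, ‖f x‖ₑ ^ 2) ^ (1/2 : ℝ)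
  have hT := mol_tendsto_L2 hf
  have hlim : Tendsto (fun m => eLpNorm (mol m f - f) 2 volume + C + eLpNorm (mol m f - f) 2 volume) atTop (𝓝 C) := by
    have := (hT.add (tendsto_const_nhds (x := C))).add hT
    simpa using this
  refine ge_of_tendsto hlim ?_
  filter_upwards [key] with m hm
  have e1 : mol k f - f = (mol k (f - mol m f)) + (mol k (mol m f) - mol m f) + (mol m f - f) := by
    rw [mol_sub k lf (lm m)]; abel
  have s1 : AEStronglyMeasurable (mol k (f - mol m f)) (volume.restrict A) :=
    (mol_contDiff k (lf.sub (lm m))).continuous.aestronglyMeasurable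
  have s2 : AEStronglyMeasurable (mol k (mol m f) - mol m f) (volume.restrict A) :=
    ((mol_contDiff k (lm m)).continuous.sub (mc m)).aestronglyMeasurable
  have s3 : AEStronglyMeasurable (mol m f - f) volume := (mc m).aestronglyMeasurable.sub hf.1
  rw [e1]
  refine (eLpNorm_add_le (s1.add s2) s3.restrict (by norm_num)).trans ?_
  refine add_le_add ((eLpNorm_add_le s1 s2 (by norm_num)).trans (add_le_add ?_ hm))
    (eLpNorm_mono_measure _ Measure.restrict_le_self)
  have := mol_eLp_le k (f := f - mol m f) (hf.1.sub (mc m).aestronglyMeasurable) hA MeasurableSet.univ (fun x _ => subset_univ _)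
  rw [Measure.restrict_univ, eLpNorm_sub_comm] at this
  exact this

/-- strong convergence of curl-free and divergence-free fields -/
lemma strong_CD {b : OrthonormalBasis ι ℝ X} {y : X} {r ρ : ℝ} (hr : 0 < r) (hrρ : r < ρ) {f : ℕ → ι → X → ℝ} {f0 : ι → X → ℝ}
    (H : ∀ j, CDF b (ball y ρ) (f j)) {C : ℝ≥0}
    (hL : ∀ j i, LL (ball y ρ) (f j i))
    (hb : ∀ j i, ∫⁻ x in ball y ρ, ‖f j i x‖ₑ ^ 2 ≤ C)
    (hw : ∀ i, WC (ball y ρ) (fun j => f j i) (f0 i)) (i : ι) :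
    Tendsto (fun j => eLpNorm (f j i - f0 i) 2 (volume.restrict (closedBall y r))) atTop (𝓝 0) := by
  obtain ⟨r1, h1, h1'⟩ := exists_between hrρ
  obtain ⟨r2, h2, h2'⟩ := exists_between h1'
  obtain ⟨r3, h3, h3'⟩ := exists_between h2'
  set θ : ContDiffBump y := ⟨r1, r2, hr.trans h1, h2⟩ with hθ
  have hK2 : closedBall y r3 ⊆ ball y ρ := closedBall_subset_ball h3'
  have K2c := isCompact_closedBall y r3
  set K2 := closedBall y r3 with hK2d
  obtain ⟨C', hC'⟩ := trans_CD (b := b) (O := ball y r3) isOpen_ball (θ := θ) θ.contDiff θ.hasCompactSupport (fun x => θ.nonneg)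
    (by rw [θ.tsupport_eq]; exact closedBall_subset_ball h3) (A' := closedBall y r1) measurableSet_closedBall
    (fun x hx => θ.one_of_mem_closedBall hx)
  have mf : ∀ j i, MemLp (K2.indicator (f j i)) 2 volume := fun j i => (hL j i).indicator hK2 K2c
  have bi : ∀ j, ∫⁻ x, ‖K2.indicator (f j i) x‖ₑ ^ 2 ≤ C := fun j => by
    refine le_trans (le_of_eq ?_) ((lintegral_mono_set hK2).trans (hb j i))
    rw [← lintegral_indicator K2c.measurableSet]
    congr 1; funext x
    by_cases hx : x ∈ K2 <;> simp [hx]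
  have cdI : ∀ j, CDF b (ball y r3) (fun i => K2.indicator (f j i)) := by
    intro j φ hφ hφc hφs
    have e : ∀ i e, ∫ x, fderiv ℝ φ x e * K2.indicator (f j i) x = ∫ x, fderiv ℝ φ x e * f j i x := by
      intro i e
      congr 1; funext x
      by_cases hx : x ∈ K2
      · simp [hx]
      · have : x ∉ tsupport (fun x => fderiv ℝ φ x e) := fun h => hx (ball_subset_closedBall (hφs (tsupport_fderiv_sub φ e h)))
        rw [image_eq_zero_of_notMem_tsupport this]; simp
    simp only [e]
    exact H j φ hφ hφc (hφs.trans (ball_subset_ball h3'.le))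
  have key := strong_of_weak (f := fun j => K2.indicator (f j i)) (f0 := K2.indicator (f0 i)) (fun j => mf j i)
    ((hw i).1.indicator hK2 K2c) (C := (C : ℝ≥0∞) + 1) (by simp) (fun j => ?_) (fun ψ hψ => ?_) (A := closedBall y r)
    (isCompact_closedBall y r).measure_lt_top.ne
    (c := fun k => ENNReal.ofReal (dl k) * (C' * C) ^ (1/2 : ℝ)) ?_ ?_
  · refine key.congr fun j => eLpNorm_congr_ae ?_
    refine (ae_restrict_iff' measurableSet_closedBall).2 (ae_of_all _ fun x hx => ?_)
    have : x ∈ K2 := closedBall_subset_closedBall ((h1.trans h2).trans h3).le hx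
    simp [this]
  · have h1 : eLpNorm (K2.indicator (f j i)) 2 volume ^ 2 ≤ C := by
      rw [eLpNorm_two_sq]; exact bi j
    refine (ENNReal.pow_le_pow_left_iff two_ne_zero).1 (h1.trans ?_)
    have : (1:ℝ≥0∞) ≤ (C:ℝ≥0∞) + 1 := le_add_self
    calc (C:ℝ≥0∞) ≤ (C + 1) * 1 := by rw [mul_one]; exact le_self_add
      _ ≤ (C+1) * (C+1) := mul_le_mul_right this _
      _ = _ := by ring
  · have z0 : ∀ G : X → ℝ, ∫ x, ψ x * K2.indicator G x = ∫ x in K2, ψ x * G x := by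
      intro G
      rw [← integral_indicator K2c.measurableSet]
      congr 1; funext x
      by_cases hx : x ∈ K2 <;> simp [hx]
    simp only [z0]
    exact (hw i).2 K2 hK2 K2c ψ (hψ.restrict _)
  · have h1 : Tendsto (fun k => ENNReal.ofReal (dl k)) atTop (𝓝 0) := by
      simpa using ENNReal.tendsto_ofReal dl_tendsto
    have := ENNReal.Tendsto.mul_const (b := ((C' : ℝ≥0∞) * C) ^ (1/2 : ℝ)) h1
      (Or.inr (ENNReal.rpow_ne_top_of_nonneg (by norm_num) (ENNReal.mul_ne_top (by simp) (by simp))))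
    simpa using this
  · filter_upwards [exists_dl (isCompact_closedBall y r) isOpen_ball (closedBall_subset_ball h1)] with k hk j
    refine (hC' _ (mf j) (cdI j) k _ measurableSet_closedBall (fun x hx => (hk x hx).trans ball_subset_closedBall) i).trans ?_
    exact mul_le_mul_right (ENNReal.rpow_le_rpow (mul_le_mul_right (bi j) _) (by norm_num)) _

end CD
end CT

namespace CT
set_option linter.unusedSectionVars false
open scoped ENNReal Topology Convolution NNReal

section S1
variable {X : Type*} [NormedAddCommGroup X] [InnerProductSpace ℝ X] [FiniteDimensional ℝ X]
  [MeasurableSpace X] [BorelSpace X]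
variable {ι : Type*} [Fintype ι]

abbrev Y2 := EuclideanSpace ℝ (Fin 2)

lemma perp {Y : Type*} [NormedAddCommGroup Y] [InnerProductSpace ℝ Y] [FiniteDimensional ℝ Y]
    {b : OrthonormalBasis ι ℝ X} {Ω : Set X} (hΩ : IsOpen Ω) {u : X → Y} {D : ι → X → Y} (h : GM b Ω u D) (i : ι) :
    ∀ᵐ x ∂(volume.restrict Ω), inner ℝ (u x) (D i x) = 0 := by
  have hch := (h.1 i).chain hΩ (R := 1) (h.2.mono fun x hx => hx.le) (F := fun v => ‖v‖ ^ 2) (contDiff_norm_sq ℝ)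
  have e : ∀ x, fderiv ℝ (fun v : Y => ‖v‖ ^ 2) (u x) (D i x) = 2 * inner ℝ (u x) (D i x) := fun x => by
    rw [(hasStrictFDerivAt_norm_sq (u x)).hasFDerivAt.fderiv]; simp
  simp only [e] at hch
  have LD := hch.2.1
  have hli : LocallyIntegrableOn (fun x => 2 * inner ℝ (u x) (D i x)) Ω volume :=
    (locallyIntegrableOn_iff hΩ.isLocallyClosed).2 fun K hK hc => LD.integrableOn hK hc
  have z := IsOpen.ae_eq_zero_of_integral_contDiff_smul_eq_zero hΩ hli (fun φ hφ hc hs => by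
    have h1 := hch.2.2 φ hφ hc hs
    have h2 : ∫ x, fderiv ℝ φ x (b i) • ‖u x‖ ^ 2 = ∫ x, fderiv ℝ φ x (b i) • (1:ℝ) :=
      integral_smul_congr hΩ.measurableSet (h.2.mono fun x hx => by simp [hx]) ((tsupport_fderiv_sub φ (b i)).trans hs)
    have h3 := ibp_C1 (f := fun _ : X => (1:ℝ)) contDiff_const hφ hc (b i)
    simp only [fderiv_fun_const, Pi.zero_apply, zero_apply, smul_zero, integral_zero, neg_zero] at h3
    rw [h2, h3] at h1
    linarith)
  refine (ae_restrict_iff' hΩ.measurableSet).2 ?_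
  filter_upwards [z] with x hx hxΩ
  have := hx hxΩ
  simp at this; exact this

lemma WD.mul {Ω : Set X} (hΩ : IsOpen Ω) {e : X} {f h f' h' : X → ℝ} (H : WD Ω e f h) (H' : WD Ω e f' h')
    (hf : ∀ᵐ x ∂(volume.restrict Ω), |f x| ≤ 1) (hf' : ∀ᵐ x ∂(volume.restrict Ω), |f' x| ≤ 1) :
    WD Ω e (fun x => f x * f' x) (fun x => h x * f' x + f x * h' x) := by
  have := (H.prodMk H').chain hΩ (R := 1) (F := fun p : ℝ × ℝ => p.1 * p.2) (by
    filter_upwards [hf, hf'] with x h1 h2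
    simp [Prod.norm_def, h1, h2]) (contDiff_fst.mul contDiff_snd)
  have e : ∀ x, fderiv ℝ (fun p : ℝ × ℝ => p.1 * p.2) (f x, f' x) (h x, h' x) = h x * f' x + f x * h' x := fun x => by
    rw [fderiv_fun_mul differentiableAt_fst differentiableAt_snd]
    simp [fderiv_fst, fderiv_snd]; ring
  simpa only [e] using this

def mul2 (a c : Y2) : Y2 := !₂[a 0 * c 0 - a 1 * c 1, a 0 * c 1 + a 1 * c 0]
def conj2 (a : Y2) : Y2 := !₂[a 0, - a 1]
def jf (u : X → Y2) (D : ι → X → Y2) (i : ι) (x : X) : ℝ := u x 0 * D i x 1 - u x 1 * D i x 0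

@[simp] lemma mul2_0 (a c : Y2) : mul2 a c 0 = a 0 * c 0 - a 1 * c 1 := rfl
@[simp] lemma mul2_1 (a c : Y2) : mul2 a c 1 = a 0 * c 1 + a 1 * c 0 := rfl
@[simp] lemma conj2_0 (a : Y2) : conj2 a 0 = a 0 := rfl
@[simp] lemma conj2_1 (a : Y2) : conj2 a 1 = - a 1 := rfl

lemma nsq (a : Y2) : ‖a‖ ^ 2 = a 0 ^ 2 + a 1 ^ 2 := by
  rw [EuclideanSpace.real_norm_sq_eq]; simp

lemma nsq1 {a : Y2} (h : ‖a‖ = 1) : a 0 ^ 2 + a 1 ^ 2 = 1 := by rw [← nsq, h]; norm_num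

lemma norm1 {a : Y2} (h : a 0 ^ 2 + a 1 ^ 2 = 1) : ‖a‖ = 1 := by
  rw [← nsq] at h
  exact (pow_eq_one_iff_of_nonneg (norm_nonneg a) two_ne_zero).1 h

lemma comp_le {a : Y2} (h : ‖a‖ = 1) (k : Fin 2) : |a k| ≤ 1 := by
  rw [← h]; exact PiLp.norm_apply_le a k

lemma GM.mul2 {b : OrthonormalBasis ι ℝ X} {Ω : Set X} (hΩ : IsOpen Ω) {u w : X → Y2} {D E : ι → X → Y2} (hu : GM b Ω u D)
    (hw : GM b Ω w E) : GM b Ω (fun x => mul2 (u x) (w x)) (fun i x => mul2 (D i x) (w x) + mul2 (u x) (E i x)) := by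
  constructor
  · intro i
    have cu : ∀ k, ∀ᵐ x ∂(volume.restrict Ω), |u x k| ≤ 1 := fun k => hu.2.mono fun x hx => comp_le hx k
    have cw : ∀ k, ∀ᵐ x ∂(volume.restrict Ω), |w x k| ≤ 1 := fun k => hw.2.mono fun x hx => comp_le hx k
    have m := fun k l => WD.mul hΩ ((hu.1 i).comp_a k) ((hw.1 i).comp_a l) (cu k) (cw l)
    refine WD.of_comp fun k => ?_
    match k with
    | 0 =>
      have := (m 0 0).add ((m 1 1).clm (-ContinuousLinearMap.id ℝ ℝ))
      refine this.congr hΩ.measurableSet (ae_of_all _ fun x => ?_) (ae_of_all _ fun x => ?_)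
      · simp; ring
      · simp; ring
    | 1 =>
      have := (m 0 1).add (m 1 0)
      refine this.congr hΩ.measurableSet (ae_of_all _ fun x => ?_) (ae_of_all _ fun x => ?_)
      · simp
      · simp; ring
  · filter_upwards [hu.2, hw.2] with x h1 h2
    refine norm1 ?_
    have := nsq1 h1; have := nsq1 h2
    simp only [mul2_0, mul2_1]
    linear_combination (u x 0 ^ 2 + u x 1 ^ 2) * nsq1 h2 + nsq1 h1

lemma GM.conj2 {b : OrthonormalBasis ι ℝ X} {Ω : Set X} (hΩ : IsOpen Ω) {u : X → Y2} {D : ι → X → Y2} (hu : GM b Ω u D) :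
    GM b Ω (fun x => conj2 (u x)) (fun i x => conj2 (D i x)) := by
  constructor
  · intro i
    refine WD.of_comp fun k => ?_
    match k with
    | 0 => exact (hu.1 i).comp_a 0
    | 1 => 
      refine (((hu.1 i).comp_a 1).clm (-ContinuousLinearMap.id ℝ ℝ)).congr hΩ.measurableSet (ae_of_all _ fun x => ?_) (ae_of_all _ fun x => ?_)
      · simp
      · simp
  · filter_upwards [hu.2] with x h1
    refine norm1 ?_
    simp [nsq1 h1]

lemma jf_mul {u w : X → Y2} {D E : ι → X → Y2} {x : X} (h1 : ‖u x‖ = 1) (h2 : ‖w x‖ = 1) (i : ι) :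
    jf (fun x => CT.mul2 (u x) (w x)) (fun i x => CT.mul2 (D i x) (w x) + CT.mul2 (u x) (E i x)) i x = jf u D i x + jf w E i x := by
  simp only [jf, mul2_0, mul2_1, PiLp.add_apply]
  linear_combination (u x 0 * D i x 1 - u x 1 * D i x 0) * nsq1 h2 + (w x 0 * E i x 1 - w x 1 * E i x 0) * nsq1 h1

lemma jf_conj (u : X → Y2) (D : ι → X → Y2) (x : X) (i : ι) :
    jf (fun x => CT.conj2 (u x)) (fun i x => CT.conj2 (D i x)) i x = - jf u D i x := by
  simp only [jf, conj2_0, conj2_1]; ring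

lemma inner2 (a c : Y2) : inner ℝ a c = a 0 * c 0 + a 1 * c 1 := by
  simp [PiLp.inner_apply]; ring

lemma comp_jf {b : OrthonormalBasis ι ℝ X} {Ω : Set X} (hΩ : IsOpen Ω) {u : X → Y2} {D : ι → X → Y2} (hu : GM b Ω u D) :
    ∀ᵐ x ∂(volume.restrict Ω), ∀ i, D i x 0 = - u x 1 * jf u D i x ∧ D i x 1 = u x 0 * jf u D i x := by
  filter_upwards [ae_all_iff.2 fun i => perp hΩ hu i, hu.2] with x h1 h2 i
  have := h1 i
  rw [inner2] at this
  simp only [jf]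
  constructor
  · linear_combination u x 0 * this - D i x 0 * nsq1 h2
  · linear_combination u x 1 * this - D i x 1 * nsq1 h2

lemma ed_jf {b : OrthonormalBasis ι ℝ X} {Ω : Set X} (hΩ : IsOpen Ω) {u : X → Y2} {D : ι → X → Y2} (hu : GM b Ω u D) :
    ∀ᵐ x ∂(volume.restrict Ω), ed D x = ∑ i, jf u D i x ^ 2 := by
  filter_upwards [comp_jf hΩ hu, hu.2] with x h1 h2
  refine Finset.sum_congr rfl fun i _ => ?_
  rw [nsq, (h1 i).1, (h1 i).2]
  linear_combination jf u D i x ^ 2 * nsq1 h2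

lemma jf_le {b : OrthonormalBasis ι ℝ X} {Ω : Set X} (hΩ : IsOpen Ω) {u : X → Y2} {D : ι → X → Y2} (hu : GM b Ω u D) (i : ι) :
    ∀ᵐ x ∂(volume.restrict Ω), |jf u D i x| ≤ ‖D i x‖ := by
  filter_upwards [comp_jf hΩ hu, hu.2] with x h1 h2
  refine abs_le_of_sq_le_sq ?_ (norm_nonneg _)
  rw [nsq, (h1 i).1, (h1 i).2]
  exact le_of_eq (by linear_combination - jf u D i x ^ 2 * nsq1 h2)

lemma jf_LL {b : OrthonormalBasis ι ℝ X} {Ω : Set X} (hΩ : IsOpen Ω) {u : X → Y2} {D : ι → X → Y2} (hu : GM b Ω u D) (i : ι) :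
    LL Ω (jf u D i) := by
  refine LL.of_le (hu.1 i).2.1 (C := 1) (fun K hK hc => ?_) (by simpa using jf_le hΩ hu i)
  have m1 := fun k => (((hu.1 i).comp_a k).1 K hK hc).1
  have m2 := fun k => (((hu.1 i).comp_a k).2.1 K hK hc).1
  exact ((m1 0).mul (m2 1)).sub ((m1 1).mul (m2 0))

lemma mz_var {b : OrthonormalBasis ι ℝ X} {Ω : Set X} (hΩ : IsOpen Ω) {u w : X → Y2} {D E : ι → X → Y2} (hu : Mz b Ω u D)
    (hw : GM b Ω w E) {y : X} {σ ρ : ℝ} (hρ : 0 < ρ) (hb : closedBall y ρ ⊆ Ω) (hσ : σ < ρ)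
    (h1 : ∀ᵐ x ∂volume.restrict (Ω \ ball y σ), w x = !₂[1, 0]) :
    0 ≤ ∫ x in ball y ρ, (2 * (∑ i, jf u D i x * jf w E i x) + ∑ i, jf w E i x ^ 2) := by
  have hg := hu.1.mul2 hΩ hw
  have hm := hu.2 y ρ hρ hb _ _ hg ⟨σ, hσ, by
    filter_upwards [h1] with x hx
    rw [hx]; ext k; fin_cases k <;> simp⟩
  have hB : ball y ρ ⊆ Ω := ball_subset_closedBall.trans hb
  have i1 := (hu.1.ed_int hb (isCompact_closedBall y ρ)).mono_set ball_subset_closedBall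
  have i2 := (hg.ed_int hb (isCompact_closedBall y ρ)).mono_set ball_subset_closedBall
  have mr : (volume.restrict (ball y ρ) : Measure X) ≤ volume.restrict Ω := Measure.restrict_mono hB le_rfl
  rw [← sub_nonneg, ← integral_sub i2 i1] at hm
  refine hm.trans (le_of_eq (integral_congr_ae (ae_mono mr ?_)))
  filter_upwards [ed_jf hΩ hu.1, ed_jf hΩ hg, hu.1.2, hw.2] with x e1 e2 e3 e4
  rw [e1, e2]
  simp only [jf_mul e3 e4]
  rw [Finset.mul_sum, ← Finset.sum_sub_distrib, ← Finset.sum_add_distrib]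
  exact Finset.sum_congr rfl fun i _ => by ring

end S1
end CT

namespace CT
set_option linter.unusedSectionVars false
open scoped ENNReal Topology Convolution NNReal

section S1
variable {X : Type*} [NormedAddCommGroup X] [InnerProductSpace ℝ X] [FiniteDimensional ℝ X]
  [MeasurableSpace X] [BorelSpace X]
variable {ι : Type*} [Fintype ι]

def ex (t : ℝ) (φ : X → ℝ) (x : X) : Y2 := !₂[Real.cos (t * φ x), Real.sin (t * φ x)]
def dex (b : OrthonormalBasis ι ℝ X) (t : ℝ) (φ : X → ℝ) (i : ι) (x : X) : Y2 :=
  !₂[- Real.sin (t * φ x) * (t * fderiv ℝ φ x (b i)), Real.cos (t * φ x) * (t * fderiv ℝ φ x (b i))]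

lemma GM.ex {b : OrthonormalBasis ι ℝ X} {Ω : Set X} (t : ℝ) {φ : X → ℝ} (hφ : ContDiff ℝ (⊤ : ℕ∞) φ) :
    GM b Ω (ex t φ) (dex b t φ) := by
  have h1 : ContDiff ℝ 1 (fun x => t * φ x) := contDiff_const.mul (hφ.of_le (by simp))
  have hd : ∀ x, HasFDerivAt (fun x => t * φ x) (t • fderiv ℝ φ x) x := fun x =>
    ((hφ.differentiable (by simp) x).hasFDerivAt).const_mul t
  constructor
  · intro i
    refine WD.of_comp fun k => ?_
    match k with
    | 0 =>
      have := WD.of_C1 (Ω := Ω) h1.cos (b i)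
      have e : ∀ x, fderiv ℝ (fun x => Real.cos (t * φ x)) x (b i) = - Real.sin (t * φ x) * (t * fderiv ℝ φ x (b i)) := fun x => by
        rw [(hd x).cos.fderiv]; simp
      simp only [e] at this
      exact this
    | 1 =>
      have := WD.of_C1 (Ω := Ω) h1.sin (b i)
      have e : ∀ x, fderiv ℝ (fun x => Real.sin (t * φ x)) x (b i) = Real.cos (t * φ x) * (t * fderiv ℝ φ x (b i)) := fun x => by
        rw [(hd x).sin.fderiv]; simp
      simp only [e] at this
      exact this
  · refine ae_of_all _ fun x => norm1 ?_
    simp [CT.ex]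

lemma jf_ex (b : OrthonormalBasis ι ℝ X) (t : ℝ) (φ : X → ℝ) (i : ι) (x : X) :
    jf (ex t φ) (dex b t φ) i x = t * fderiv ℝ φ x (b i) := by
  simp only [jf, ex, dex]
  simp
  linear_combination (t * fderiv ℝ φ x (b i)) * Real.sin_sq_add_cos_sq (t * φ x)

lemma lin_zero {A B : ℝ} (h : ∀ t : ℝ, 0 ≤ t * A + t ^ 2 * B) : A = 0 := by
  by_contra hA
  have hB : 0 ≤ B := by
    have h1 := h 1; have h2 := h (-1); nlinarith
  have := h (-A / (B + 1))
  have e : -A / (B + 1) * A + (-A / (B + 1)) ^ 2 * B = - (A ^ 2 / (B + 1) ^ 2) := by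
    field_simp; ring
  rw [e] at this
  have : 0 < A ^ 2 / (B + 1) ^ 2 := by positivity
  linarith

lemma divfree {b : OrthonormalBasis ι ℝ X} {Ω : Set X} (hΩ : IsOpen Ω) {u : X → Y2} {D : ι → X → Y2} (hu : Mz b Ω u D)
    {y : X} {ρ : ℝ} (hρ : 0 < ρ) (hb : closedBall y ρ ⊆ Ω) {φ : X → ℝ} (hφ : ContDiff ℝ (⊤ : ℕ∞) φ) (hc : HasCompactSupport φ)
    (hs : tsupport φ ⊆ ball y ρ) : ∑ i, ∫ x, fderiv ℝ φ x (b i) * jf u D i x = 0 := by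
  obtain ⟨σ, hσ, hsσ⟩ := exists_lt_subset_ball (isClosed_tsupport φ) hs
  have hB : ball y ρ ⊆ Ω := ball_subset_closedBall.trans hb
  have ii : ∀ i, Integrable (fun x => fderiv ℝ φ x (b i) * jf u D i x) := fun i =>
    (jf_LL hΩ hu.1 i).integrable_fderiv_smul hφ hc (hs.trans hB) (b i)
  have iq : ∀ i, Integrable (fun x => fderiv ℝ φ x (b i) ^ 2) := fun i =>
    Continuous.integrable_of_hasCompactSupport ((cd_fderiv hφ _).continuous.pow 2) ((cs_fderiv hc (b i)).comp_left (g := fun s => s ^ 2) (by simp))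
  have e0 : ∫ x in ball y ρ, (∑ i, fderiv ℝ φ x (b i) * jf u D i x) = ∑ i, ∫ x, fderiv ℝ φ x (b i) * jf u D i x := by
    rw [setIntegral_eq_integral_of_forall_compl_eq_zero, integral_finsetSum _ fun i _ => ii i]
    intro x hx
    refine Finset.sum_eq_zero fun i _ => ?_
    have : x ∉ tsupport (fun x => fderiv ℝ φ x (b i)) := fun h => hx (hs (tsupport_fderiv_sub φ _ h))
    rw [image_eq_zero_of_notMem_tsupport this]; simp
  have key : ∀ t : ℝ, 0 ≤ t * (2 * ∑ i, ∫ x, fderiv ℝ φ x (b i) * jf u D i x) +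
      t ^ 2 * ∫ x in ball y ρ, ∑ i, fderiv ℝ φ x (b i) ^ 2 := by
    intro t
    have := mz_var hΩ hu (GM.ex (b := b) t hφ) hρ hb hσ (by
      refine (ae_restrict_iff' (hΩ.measurableSet.diff measurableSet_ball)).2 (ae_of_all _ fun x hx => ?_)
      have : φ x = 0 := image_eq_zero_of_notMem_tsupport fun h => hx.2 (hsσ h)
      simp [ex, this])
    simp only [jf_ex] at this
    refine this.trans (le_of_eq ?_)
    rw [← e0, ← integral_const_mul, ← integral_const_mul, ← integral_const_mul, ← integral_add]
    · congr 1; funext x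
      rw [Finset.mul_sum, Finset.mul_sum, Finset.mul_sum, Finset.mul_sum]
      congr 1
      · exact Finset.sum_congr rfl fun i _ => by ring
      · exact Finset.sum_congr rfl fun i _ => by ring
    · exact (((integrable_finsetSum _ fun i _ => ii i).const_mul 2).const_mul t).integrableOn
    · exact ((integrable_finsetSum _ fun i _ => iq i).const_mul (t ^ 2)).integrableOn
  have := lin_zero key
  linarith

/-- integrals against strongly L2 convergent sequences -/
lemma int_tendsto {K : Set X} {f : ℕ → X → ℝ} {f0 : X → ℝ} (hf : ∀ k, MemLp (f k) 2 (volume.restrict K))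
    (hf0 : MemLp f0 2 (volume.restrict K)) (h : Tendsto (fun k => eLpNorm (f k - f0) 2 (volume.restrict K)) atTop (𝓝 0))
    {g : X → ℝ} (hg : MemLp g 2 (volume.restrict K)) :
    Tendsto (fun k => ∫ x in K, g x * f k x) atTop (𝓝 (∫ x in K, g x * f0 x)) := by
  rw [tendsto_iff_norm_sub_tendsto_zero]
  have hle : ∀ k, ‖(∫ x in K, g x * f k x) - ∫ x in K, g x * f0 x‖ ≤
      (eLpNorm g 2 (volume.restrict K) * eLpNorm (f k - f0) 2 (volume.restrict K)).toReal := by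
    intro k
    have a1 : Integrable (fun x => g x * f k x) (volume.restrict K) := hg.integrable_mul (hf k)
    have a2 : Integrable (fun x => g x * f0 x) (volume.restrict K) := hg.integrable_mul hf0
    rw [← integral_sub a1 a2]
    have h1 : eLpNorm (g • (f k - f0)) 1 (volume.restrict K) ≤ eLpNorm g 2 (volume.restrict K) * eLpNorm (f k - f0) 2 (volume.restrict K) :=
      eLpNorm_smul_le_mul_eLpNorm (p := 2) (q := 2) (r := 1) ((hf k).sub hf0).1 hg.1
    have e : ∀ x, g x * f k x - g x * f0 x = (g • (f k - f0)) x := fun x => by simp [mul_sub]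
    simp only [e]
    refine (norm_integral_le_lintegral_norm _).trans ?_
    refine ENNReal.toReal_mono (ENNReal.mul_ne_top hg.2.ne ((hf k).sub hf0).2.ne) ?_
    simp only [ofReal_norm]
    rw [← eLpNorm_one_eq_lintegral_enorm]
    exact h1
  have lim : Tendsto (fun k => (eLpNorm g 2 (volume.restrict K) * eLpNorm (f k - f0) 2 (volume.restrict K)).toReal) atTop (𝓝 0) := by
    have := ENNReal.Tendsto.const_mul (a := eLpNorm g 2 (volume.restrict K)) h (Or.inr hg.2.ne)
    rw [mul_zero] at this
    have t := (ENNReal.tendsto_toReal ENNReal.zero_ne_top).comp this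
    rw [ENNReal.toReal_zero] at t
    exact t
  exact squeeze_zero (fun k => norm_nonneg _) hle lim

end S1
end CT

namespace CT
set_option linter.unusedSectionVars false
open scoped ENNReal Topology Convolution NNReal

section S1
variable {X : Type*} [NormedAddCommGroup X] [InnerProductSpace ℝ X] [FiniteDimensional ℝ X]
  [MeasurableSpace X] [BorelSpace X]
variable {ι : Type*} [Fintype ι]

lemma curl0 {Ω : Set X} {a c : X} {g ga gc : X → ℝ} (Ha : WD Ω a g ga) (Hc : WD Ω c g gc)
    {ψ : X → ℝ} (hφ : ContDiff ℝ (⊤ : ℕ∞) ψ) (hc : HasCompactSupport ψ) (hs : tsupport ψ ⊆ Ω) :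
    ∫ x, fderiv ℝ ψ x c * ga x = ∫ x, fderiv ℝ ψ x a * gc x := by
  have h1 := Ha.2.2 _ (cd_fderiv hφ c) (cs_fderiv hc c) ((tsupport_fderiv_sub ψ c).trans hs)
  have h2 := Hc.2.2 _ (cd_fderiv hφ a) (cs_fderiv hc a) ((tsupport_fderiv_sub ψ a).trans hs)
  simp only [symm2 hφ _ c a] at h1
  rw [h1] at h2
  simpa using h2

lemma LL.mul_cont {Ω : Set X} {f : X → ℝ} (hf : LL Ω f) {φ : X → ℝ} (hφ : Continuous φ) : LL Ω (fun x => φ x * f x) := by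
  intro K hK hc
  obtain ⟨C, hC⟩ := hc.exists_bound_of_continuousOn hφ.continuousOn
  refine (hf K hK hc).of_le_mul (c := C) (hφ.aestronglyMeasurable.mul (hf K hK hc).1) ?_
  refine (ae_restrict_iff' hc.measurableSet).2 (ae_of_all _ fun x hx => ?_)
  rw [norm_mul]; exact mul_le_mul_of_nonneg_right (hC x hx) (norm_nonneg _)

lemma curl1 {Ω : Set X} (hΩ : IsOpen Ω) {a c : X} {f fa fc g ga gc : X → ℝ} (Fa : WD Ω a f fa) (Fc : WD Ω c f fc)
    (Ha : WD Ω a g ga) (Hc : WD Ω c g gc) (hr : ∀ᵐ x ∂(volume.restrict Ω), fc x * ga x = fa x * gc x)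
    {φ : X → ℝ} (hφ : ContDiff ℝ (⊤ : ℕ∞) φ) (hc : HasCompactSupport φ) (hs : tsupport φ ⊆ Ω) :
    ∫ x in tsupport φ, (fderiv ℝ φ x c * ga x - fderiv ℝ φ x a * gc x) * f x = 0 := by
  obtain ⟨K, hK, hSK, hKΩ⟩ := exists_compact_between hc hΩ hs
  set S := tsupport φ with hS
  have hfK := Fa.1.indicator hKΩ hK
  have cS := fun e => (cd_fderiv hφ e).continuous
  set cm := fun m => mol m (K.indicator f) with hcm
  have hcs : ∀ m, ContDiff ℝ (⊤ : ℕ∞) (cm m) := fun m => mol_contDiff m (memLp_locallyIntegrable hfK)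
  have SK : S ⊆ K := hSK.trans interior_subset
  have conv : ∀ h : X → ℝ, LL Ω h → Tendsto (fun m => eLpNorm (mol m (K.indicator h) - h) 2 (volume.restrict S)) atTop (𝓝 0) := by
    intro h hh
    refine tendsto_of_tendsto_of_tendsto_of_le_of_le tendsto_const_nhds (mol_tendsto_L2 (hh.indicator hKΩ hK)) (fun m => bot_le) (fun m => ?_)
    have : eLpNorm (mol m (K.indicator h) - h) 2 (volume.restrict S) = eLpNorm (mol m (K.indicator h) - K.indicator h) 2 (volume.restrict S) := by
      refine eLpNorm_congr_ae ((ae_restrict_iff' hc.measurableSet).2 (ae_of_all _ fun x hx => ?_))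
      simp [indicator_of_mem (SK hx)]
    rw [this]
    exact eLpNorm_mono_measure _ Measure.restrict_le_self
  have mem : ∀ h : X → ℝ, LL Ω h → ∀ m, MemLp (mol m (K.indicator h)) 2 (volume.restrict S) := fun h hh m =>
    LL.of_continuous (Ω := univ) (mol_contDiff m (memLp_locallyIntegrable (hh.indicator hKΩ hK))).continuous S (subset_univ _) hc
  have LG : LL Ω (fun x => fderiv ℝ φ x c * ga x - fderiv ℝ φ x a * gc x) := by
    have := (Ha.2.1.mul_cont (cS c)).add ((Hc.2.1.mul_cont (cS a)).clm (-ContinuousLinearMap.id ℝ ℝ))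
    simpa [sub_eq_add_neg] using this
  have t1 := int_tendsto (mem f Fa.1) (Fa.1 S hs hc) (conv f Fa.1) (LG S hs hc)
  have t2 := int_tendsto (mem fc Fc.2.1) (Fc.2.1 S hs hc) (conv fc Fc.2.1) (Ha.2.1.mul_cont hφ.continuous S hs hc)
  have t3 := int_tendsto (mem fa Fa.2.1) (Fa.2.1 S hs hc) (conv fa Fa.2.1) (Hc.2.1.mul_cont hφ.continuous S hs hc)
  have t4 := (t1.add t2).sub t3
  have z : ∀ᶠ m in atTop, (∫ x in S, (fderiv ℝ φ x c * ga x - fderiv ℝ φ x a * gc x) * mol m (K.indicator f) x) +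
      (∫ x in S, φ x * ga x * mol m (K.indicator fc) x) - (∫ x in S, φ x * gc x * mol m (K.indicator fa) x) = 0 := by
    filter_upwards [exists_dl hc isOpen_interior hSK] with m hm
    have ts : tsupport (fun x => cm m x * φ x) ⊆ S := tsupport_mul_subset_right
    have csψ : HasCompactSupport (fun x => cm m x * φ x) := hc.mul_left
    have cdψ : ContDiff ℝ (⊤ : ℕ∞) (fun x => cm m x * φ x) := (hcs m).mul hφ
    have k := curl0 Ha Hc cdψ csψ (ts.trans hs)
    have toS : ∀ e (q : X → ℝ), ∫ x, fderiv ℝ (fun x => cm m x * φ x) x e * q x = ∫ x in S, fderiv ℝ (fun x => cm m x * φ x) x e * q x := by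
      intro e q
      rw [setIntegral_eq_integral_of_forall_compl_eq_zero]
      intro x hx
      have : x ∉ tsupport (fun x => fderiv ℝ (fun x => cm m x * φ x) x e) := fun h => hx (ts (tsupport_fderiv_sub _ _ h))
      rw [image_eq_zero_of_notMem_tsupport this]; simp
    rw [toS, toS, ← sub_eq_zero] at k
    have iA : Integrable (fun x => fderiv ℝ (fun x => cm m x * φ x) x c * ga x) (volume.restrict S) :=
      (Ha.2.1.mul_cont (cd_fderiv cdψ c).continuous).integrableOn hs hc
    have iC : Integrable (fun x => fderiv ℝ (fun x => cm m x * φ x) x a * gc x) (volume.restrict S) :=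
      (Hc.2.1.mul_cont (cd_fderiv cdψ a).continuous).integrableOn hs hc
    rw [← integral_sub iA iC] at k
    have i1 : Integrable (fun x => (fderiv ℝ φ x c * ga x - fderiv ℝ φ x a * gc x) * mol m (K.indicator f) x) (volume.restrict S) :=
      (LG S hs hc).integrable_mul (mem f Fa.1 m)
    have i2 : Integrable (fun x => φ x * ga x * mol m (K.indicator fc) x) (volume.restrict S) :=
      (Ha.2.1.mul_cont hφ.continuous S hs hc).integrable_mul (mem fc Fc.2.1 m)
    have i3 : Integrable (fun x => φ x * gc x * mol m (K.indicator fa) x) (volume.restrict S) :=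
      (Hc.2.1.mul_cont hφ.continuous S hs hc).integrable_mul (mem fa Fa.2.1 m)
    have i12 : Integrable (fun x => (fderiv ℝ φ x c * ga x - fderiv ℝ φ x a * gc x) * mol m (K.indicator f) x + φ x * ga x * mol m (K.indicator fc) x) (volume.restrict S) := i1.add i2
    rw [← integral_add i1 i2, ← integral_sub i12 i3, ← k]
    refine setIntegral_congr_fun hc.measurableSet fun x hx => ?_
    have d1 := (hcs m).differentiable (by simp) x
    have d2 := hφ.differentiable (by simp) x
    have e1 : fderiv ℝ (cm m) x a = mol m (K.indicator fa) x := mol_WD (Fa.indicator hKΩ) (memLp_locallyIntegrable hfK) (hm x hx)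
    have e2 : fderiv ℝ (cm m) x c = mol m (K.indicator fc) x := mol_WD (Fc.indicator hKΩ) (memLp_locallyIntegrable hfK) (hm x hx)
    simp only [fderiv_fun_mul d1 d2, ← e1, ← e2]
    simp [hcm]
    ring
  have lim := tendsto_nhds_unique t4 (tendsto_const_nhds.congr' (z.mono fun m hm => hm.symm))
  have eq : ∫ x in S, φ x * ga x * fc x = ∫ x in S, φ x * gc x * fa x := by
    refine integral_congr_ae (ae_mono (Measure.restrict_mono hs le_rfl) ?_)
    filter_upwards [hr] with x hx
    linear_combination φ x * hx
  rw [eq] at lim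
  linarith

lemma curlfree {b : OrthonormalBasis ι ℝ X} {Ω : Set X} (hΩ : IsOpen Ω) {u : X → Y2} {D : ι → X → Y2} (hu : GM b Ω u D)
    {φ : X → ℝ} (hφ : ContDiff ℝ (⊤ : ℕ∞) φ) (hc : HasCompactSupport φ) (hs : tsupport φ ⊆ Ω) (i k : ι) :
    ∫ x, fderiv ℝ φ x (b k) * jf u D i x = ∫ x, fderiv ℝ φ x (b i) * jf u D k x := by
  have W := fun i l => (hu.1 i).comp_a l
  have h1 := curl1 hΩ (W i 0) (W k 0) (W i 1) (W k 1) (by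
    filter_upwards [comp_jf hΩ hu] with x hx
    rw [(hx i).1, (hx i).2, (hx k).1, (hx k).2]; ring) hφ hc hs
  have h2 := curl1 hΩ (W i 1) (W k 1) (W i 0) (W k 0) (by
    filter_upwards [comp_jf hΩ hu] with x hx
    rw [(hx i).1, (hx i).2, (hx k).1, (hx k).2]; ring) hφ hc hs
  have ii : ∀ i e, Integrable (fun x => fderiv ℝ φ x e * jf u D i x) := fun i e =>
    (jf_LL hΩ hu i).integrable_fderiv_smul hφ hc hs e
  rw [← sub_eq_zero, ← integral_sub (ii i _) (ii k _), ← setIntegral_eq_integral_of_forall_compl_eq_zero (s := tsupport φ)]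
  · have LG : ∀ l, LL Ω (fun x => fderiv ℝ φ x (b k) * D i x l - fderiv ℝ φ x (b i) * D k x l) := fun l => by
      have := ((W i l).2.1.mul_cont (cd_fderiv hφ (b k)).continuous).add (((W k l).2.1.mul_cont (cd_fderiv hφ (b i)).continuous).clm (-ContinuousLinearMap.id ℝ ℝ))
      simpa [sub_eq_add_neg] using this
    have j1 : ∀ l m, Integrable (fun x => (fderiv ℝ φ x (b k) * D i x l - fderiv ℝ φ x (b i) * D k x l) * u x m) (volume.restrict (tsupport φ)) := 
      fun l m => (LG l _ hs hc).integrable_mul ((W i m).1 _ hs hc)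
    have e := integral_sub (j1 1 0) (j1 0 1)
    rw [h1, h2, sub_zero] at e
    rw [← e]
    congr 1; funext x
    simp only [jf]; ring
  · intro x hx
    have : ∀ e, fderiv ℝ φ x e = 0 := fun e => by
      have : x ∉ tsupport (fun x => fderiv ℝ φ x e) := fun h => hx ((tsupport_fderiv_sub _ _ h))
      exact image_eq_zero_of_notMem_tsupport (f := fun x => fderiv ℝ φ x e) this
    simp [this]

lemma mz_CDF {b : OrthonormalBasis ι ℝ X} {Ω : Set X} (hΩ : IsOpen Ω) {u : X → Y2} {D : ι → X → Y2} (hu : Mz b Ω u D)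
    {y : X} {ρ : ℝ} (hρ : 0 < ρ) (hb : closedBall y ρ ⊆ Ω) : CDF b (ball y ρ) (jf u D) := fun _ hφ hc hs =>
  ⟨fun i k => curlfree hΩ hu.1 hφ hc (hs.trans (ball_subset_closedBall.trans hb)) i k, divfree hΩ hu hρ hb hφ hc hs⟩

end S1
end CT

namespace CT
set_option linter.unusedSectionVars false
open scoped ENNReal Topology Convolution NNReal

section S1
variable {X : Type*} [NormedAddCommGroup X] [InnerProductSpace ℝ X] [FiniteDimensional ℝ X]
  [MeasurableSpace X] [BorelSpace X]
variable {ι : Type*} [Fintype ι]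

lemma sq_lim {x : ℕ → ℝ≥0∞} (h : Tendsto (fun n => x n ^ 2) atTop (𝓝 0)) : Tendsto x atTop (𝓝 0) := by
  have := ((ENNReal.continuous_rpow_const (y := (1/2 : ℝ))).tendsto 0).comp h
  rw [ENNReal.zero_rpow_of_pos (by norm_num)] at this
  refine this.congr fun n => ?_
  simp only [Function.comp]
  rw [← ENNReal.rpow_natCast, ← ENNReal.rpow_mul]; norm_num

lemma dctL2 {μ : Measure X} {ψ : X → ℝ} (hψ : MemLp ψ 2 μ) {v : ℕ → X → ℝ} {v0 : X → ℝ}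
    (hv : ∀ j, AEStronglyMeasurable (v j) μ) (hv0 : AEStronglyMeasurable v0 μ)
    (b : ∀ j, ∀ᵐ x ∂μ, |v j x| ≤ 1) (b0 : ∀ᵐ x ∂μ, |v0 x| ≤ 1)
    (h : Tendsto (fun j => eLpNorm (v j - v0) 2 μ) atTop (𝓝 0)) :
    Tendsto (fun j => eLpNorm (ψ • (v j - v0)) 2 μ) atTop (𝓝 0) := by
  apply sq_lim
  refine tendsto_of_subseq_tendsto fun ns hns => ?_
  obtain ⟨ms, hms, hae⟩ := (tendstoInMeasure_of_tendsto_eLpNorm (p := 2) (by norm_num) (fun j => hv (ns j)) hv0 (h.comp hns)).exists_seq_tendsto_ae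
  refine ⟨ms, ?_⟩
  simp only [eLpNorm_two_sq]
  have := tendsto_lintegral_of_dominated_convergence' (μ := μ) (F := fun j x => ‖(ψ • (v (ns (ms j)) - v0)) x‖ₑ ^ 2) (f := fun _ => 0)
    (fun x => ‖ψ x‖ₑ ^ 2 * 4) (fun j => ((hψ.1.smul ((hv _).sub hv0)).enorm.pow_const 2)) (fun j => by
      filter_upwards [b (ns (ms j)), b0] with x h1 h2
      simp only [Pi.smul_apply', Pi.sub_apply, smul_eq_mul, enorm_mul, mul_pow]
      gcongr
      have : ‖v (ns (ms j)) x - v0 x‖ₑ ≤ 2 := by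
        rw [← ofReal_norm, Real.norm_eq_abs]
        refine (ENNReal.ofReal_le_ofReal ((abs_sub _ _).trans (add_le_add h1 h2))).trans (le_of_eq ?_)
        norm_num
      calc ‖v (ns (ms j)) x - v0 x‖ₑ ^ 2 ≤ 2 ^ 2 := by gcongr
        _ = 4 := by norm_num) (by
      rw [lintegral_mul_const' _ _ (by norm_num), ← eLpNorm_two_sq]
      exact ENNReal.mul_ne_top (ENNReal.pow_ne_top hψ.2.ne) (by norm_num)) (by
      filter_upwards [hae] with x hx
      have h1 : Tendsto (fun j => ψ x * (v (ns (ms j)) x - v0 x)) atTop (𝓝 0) := by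
        have := (hx.sub_const (v0 x)).const_mul (ψ x)
        simpa using this
      have h2 := ENNReal.Tendsto.pow (n := 2) h1.enorm
      simpa using h2)
  simpa using this

lemma WC.mul {Ω : Set X} {v : ℕ → X → ℝ} {v0 : X → ℝ} (hv : ∀ j, LL Ω (v j)) (hv0 : LL Ω v0)
    (b : ∀ j, ∀ᵐ x ∂(volume.restrict Ω), |v j x| ≤ 1) (b0 : ∀ᵐ x ∂(volume.restrict Ω), |v0 x| ≤ 1)
    (h : ∀ K ⊆ Ω, IsCompact K → Tendsto (fun j => eLpNorm (v j - v0) 2 (volume.restrict K)) atTop (𝓝 0))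
    {f : ℕ → X → ℝ} {f0 : X → ℝ} (hf : ∀ j, LL Ω (f j)) (hW : WC Ω f f0)
    (hb : ∀ K ⊆ Ω, IsCompact K → ∃ C : ℝ≥0, ∀ j, eLpNorm (f j) 2 (volume.restrict K) ≤ C) :
    WC Ω (fun j x => v j x * f j x) (fun x => v0 x * f0 x) := by
  refine ⟨LL.of_le hW.1 (C := 1) (fun K hK hc => (hv0 K hK hc).1.mul (hW.1 K hK hc).1) ?_, fun K hK hc ψ hψ => ?_⟩
  · filter_upwards [b0] with x hx
    rw [norm_mul]; exact mul_le_mul_of_nonneg_right hx (norm_nonneg _)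
  · have mr : (volume.restrict K : Measure X) ≤ volume.restrict Ω := Measure.restrict_mono hK le_rfl
    have d := dctL2 hψ (fun j => (hv j K hK hc).1) (hv0 K hK hc).1 (fun j => ae_mono mr (b j)) (ae_mono mr b0) (h K hK hc)
    obtain ⟨C, hC⟩ := hb K hK hc
    have m0 : MemLp (fun x => ψ x * v0 x) 2 (volume.restrict K) := hψ.of_le (hψ.1.mul (hv0 K hK hc).1) (by
      filter_upwards [ae_mono mr b0] with x hx
      rw [norm_mul]; exact mul_le_of_le_one_right (norm_nonneg _) hx)
    have mj : ∀ j, MemLp (ψ • (v j - v0)) 2 (volume.restrict K) := fun j => hψ.of_le_mul (c := 2) (hψ.1.smul ((hv j K hK hc).1.sub (hv0 K hK hc).1)) (by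
      filter_upwards [ae_mono mr b0, ae_mono mr (b j)] with x h1 h2
      simp only [Pi.smul_apply', Pi.sub_apply, smul_eq_mul, norm_mul, Real.norm_eq_abs]
      rw [mul_comm]
      gcongr
      exact (abs_sub _ _).trans (by linarith))
    have t1 := hW.2 K hK hc _ m0
    have t2 : Tendsto (fun j => ∫ x in K, (ψ • (v j - v0)) x * f j x) atTop (𝓝 0) := by
      rw [tendsto_zero_iff_norm_tendsto_zero]
      have hle : ∀ j, ‖∫ x in K, (ψ • (v j - v0)) x * f j x‖ ≤
          (eLpNorm (ψ • (v j - v0)) 2 (volume.restrict K) * C).toReal := by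
        intro j
        have h1 : eLpNorm ((ψ • (v j - v0)) • f j) 1 (volume.restrict K) ≤ eLpNorm (ψ • (v j - v0)) 2 (volume.restrict K) * eLpNorm (f j) 2 (volume.restrict K) :=
          eLpNorm_smul_le_mul_eLpNorm (p := 2) (q := 2) (r := 1) (hf j K hK hc).1 (mj j).1
        refine (norm_integral_le_lintegral_norm _).trans ?_
        refine ENNReal.toReal_mono (ENNReal.mul_ne_top (mj j).2.ne ENNReal.coe_ne_top) ?_
        simp only [ofReal_norm]
        rw [← eLpNorm_one_eq_lintegral_enorm]
        exact h1.trans (by gcongr; exact hC j)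
      have lim : Tendsto (fun j => (eLpNorm (ψ • (v j - v0)) 2 (volume.restrict K) * C).toReal) atTop (𝓝 0) := by
        have := ENNReal.Tendsto.mul_const (b := (C : ℝ≥0∞)) d (Or.inr ENNReal.coe_ne_top)
        rw [zero_mul] at this
        have t := (ENNReal.tendsto_toReal ENNReal.zero_ne_top).comp this
        rw [ENNReal.toReal_zero] at t
        exact t
      exact squeeze_zero (fun k => norm_nonneg _) hle lim
    have t3 := t1.add t2
    rw [add_zero] at t3
    refine (t3.congr fun j => ?_).trans (le_of_eq ?_)
    · have a1 : Integrable (fun x => ψ x * v0 x * f j x) (volume.restrict K) := m0.integrable_mul (hf j K hK hc)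
      have a2 : Integrable (fun x => (ψ • (v j - v0)) x * f j x) (volume.restrict K) := (mj j).integrable_mul (hf j K hK hc)
      rw [← integral_add a1 a2]
      congr 1; funext x; simp; ring
    · congr 2; funext x; ring

lemma WC.sub {Ω : Set X} {f g : ℕ → X → ℝ} {f0 g0 : X → ℝ} (hf : ∀ j, LL Ω (f j)) (hg : ∀ j, LL Ω (g j)) (h : WC Ω f f0) (h' : WC Ω g g0) :
    WC Ω (fun j x => f j x - g j x) (fun x => f0 x - g0 x) := by
  refine ⟨fun K hK hc => (h.1 K hK hc).sub (h'.1 K hK hc), fun K hK hc ψ hψ => ?_⟩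
  have e : ∀ {p q : X → ℝ}, LL Ω p → LL Ω q → ∫ x in K, ψ x * (p x - q x) = (∫ x in K, ψ x * p x) - ∫ x in K, ψ x * q x := by
    intro p q hp hq
    have a1 : Integrable (fun x => ψ x * p x) (volume.restrict K) := hψ.integrable_mul (hp K hK hc)
    have a2 : Integrable (fun x => ψ x * q x) (volume.restrict K) := hψ.integrable_mul (hq K hK hc)
    rw [← integral_sub a1 a2]
    congr 1; funext x; ring
  rw [e h.1 h'.1]
  simp only [e (hf _) (hg _)]
  exact (h.2 K hK hc ψ hψ).sub (h'.2 K hK hc ψ hψ)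

lemma enorm_comp_le (v : Y2) (a : Fin 2) : ‖v a‖ₑ ≤ ‖v‖ₑ := by
  rw [← ofReal_norm, ← ofReal_norm]; exact ENNReal.ofReal_le_ofReal (PiLp.norm_apply_le v a)

lemma jf_WC {b : OrthonormalBasis ι ℝ X} {Ω : Set X}
    {u : ℕ → X → Y2} {D : ℕ → ι → X → Y2}
    {u0 : X → Y2} {D0 : ι → X → Y2} (hu : ∀ j, GM b Ω (u j) (D j)) (h0 : GM b Ω u0 D0)
    (hW : ∀ i a, WC Ω (fun j x => D j i x a) (fun x => D0 i x a))
    (hS : ∀ K ⊆ Ω, IsCompact K → Tendsto (fun j => eLpNorm (u j - u0) 2 (volume.restrict K)) atTop (𝓝 0))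
    (hbd : ∀ K ⊆ Ω, IsCompact K → ∃ C : ℝ≥0, ∀ j, ∫⁻ x in K, ENNReal.ofReal (ed (D j) x) ≤ C) (i : ι) :
    WC Ω (fun j => jf (u j) (D j) i) (jf u0 D0 i) := by
  have key : ∀ l m : Fin 2, WC Ω (fun j x => u j x l * D j i x m) (fun x => u0 x l * D0 i x m) := by
    intro l m
    refine WC.mul (fun j => (((hu j).1 i).comp_a l).1) ((h0.1 i).comp_a l).1 (fun j => (hu j).2.mono fun x hx => comp_le hx l)
      (h0.2.mono fun x hx => comp_le hx l) (fun K hK hc => ?_) (fun j => (((hu j).1 i).comp_a m).2.1) (hW i m) (fun K hK hc => ?_)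
    · refine tendsto_of_tendsto_of_tendsto_of_le_of_le tendsto_const_nhds (hS K hK hc) (fun m => bot_le) (fun j => ?_)
      refine eLpNorm_mono_enorm fun x => ?_
      exact enorm_comp_le (u j x - u0 x) l
    · obtain ⟨C, hC⟩ := hbd K hK hc
      refine ⟨C + 1, fun j => ?_⟩
      by_contra hcon
      push Not at hcon
      have h1 : eLpNorm (fun x => D j i x m) 2 (volume.restrict K) ^ 2 ≤ C := by
        rw [eLpNorm_two_sq]
        refine (lintegral_mono fun x => ?_).trans (hC j)
        exact (pow_le_pow_left' (enorm_comp_le _ m) 2).trans (enorm_sq_le_ed (D j) i x)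
      have h2 : ((C + 1 : ℝ≥0) : ℝ≥0∞) ^ 2 ≤ C := (pow_le_pow_left' hcon.le 2).trans h1
      norm_cast at h2
      have : C < (C + 1) ^ 2 := by
        have : (C:ℝ) < (C + 1) ^ 2 := by nlinarith [C.2]
        exact_mod_cast this
      exact absurd h2 (not_le.2 this)
  have L : ∀ j (l m : Fin 2), LL Ω (fun x => u j x l * D j i x m) := fun j l m => by
    refine LL.of_le (((hu j).1 i).comp_a m).2.1 (C := 1) (fun K hK hc => ((((hu j).1 i).comp_a l).1 K hK hc).1.mul ((((hu j).1 i).comp_a m).2.1 K hK hc).1) ?_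
    filter_upwards [(hu j).2] with x hx
    rw [norm_mul]; exact mul_le_mul_of_nonneg_right (comp_le hx l) (norm_nonneg _)
  exact (key 0 1).sub (fun j => L j 0 1) (fun j => L j 1 0) (key 1 0)

end S1
end CT

namespace CT
set_option linter.unusedSectionVars false
open scoped ENNReal Topology Convolution NNReal

section S1
variable {X : Type*} [NormedAddCommGroup X] [InnerProductSpace ℝ X] [FiniteDimensional ℝ X]
  [MeasurableSpace X] [BorelSpace X]
variable {ι : Type*} [Fintype ι]

lemma int_sq {E : Type*} [NormedAddCommGroup E] {μ : Measure X} {f : X → E} (hf : AEStronglyMeasurable f μ) :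
    ∫ x, ‖f x‖ ^ 2 ∂μ = (eLpNorm f 2 μ ^ 2).toReal := by
  have : eLpNorm f 2 μ ^ 2 = ∫⁻ x, ENNReal.ofReal (‖f x‖ ^ 2) ∂μ := by
    rw [← ENNReal.rpow_natCast, eLpNorm_eq_lintegral_rpow_enorm_toReal (by norm_num) (by norm_num), ← ENNReal.rpow_mul]
    norm_num
  have m : AEStronglyMeasurable (fun x => ‖f x‖ ^ 2) μ := hf.norm.pow 2
  rw [this, integral_eq_lintegral_of_nonneg_ae (ae_of_all _ fun x => by positivity) m]

lemma int_sq_lim {E : Type*} [NormedAddCommGroup E] {μ : Measure X} {f : ℕ → X → E} (hf : ∀ j, AEStronglyMeasurable (f j) μ)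
    (h : Tendsto (fun j => eLpNorm (f j) 2 μ) atTop (𝓝 0)) : Tendsto (fun j => ∫ x, ‖f j x‖ ^ 2 ∂μ) atTop (𝓝 0) := by
  have := ENNReal.Tendsto.pow (n := 2) h
  rw [zero_pow two_ne_zero] at this
  have t := (ENNReal.tendsto_toReal ENNReal.zero_ne_top).comp this
  rw [ENNReal.toReal_zero] at t
  exact t.congr fun j => (int_sq (hf j)).symm

lemma main2_min {b : OrthonormalBasis ι ℝ X} {Ω : Set X} (hΩ : IsOpen Ω)
    {u : ℕ → X → Y2} {D : ℕ → ι → X → Y2}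
    {u0 : X → Y2} {D0 : ι → X → Y2} (hu : ∀ j, Mz b Ω (u j) (D j)) (h0 : GM b Ω u0 D0)
    (hJ : ∀ i, WC Ω (fun j => jf (u j) (D j) i) (jf u0 D0 i)) : Mz b Ω u0 D0 := by
  refine ⟨h0, fun y ρ hρ hB w Dw hw => ?_⟩
  rintro ⟨σ, hσ, hs⟩
  set z := fun x => mul2 (w x) (conj2 (u0 x)) with hz
  set E := fun i x => mul2 (Dw i x) (conj2 (u0 x)) + mul2 (w x) (conj2 (D0 i x)) with hE
  have gz : GM b Ω z E := hw.mul2 hΩ (h0.conj2 hΩ)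
  have h1 : ∀ᵐ x ∂volume.restrict (Ω \ ball y σ), z x = !₂[1, 0] := by
    filter_upwards [hs, ae_mono (Measure.restrict_mono sdiff_subset le_rfl) h0.2] with x hx hn
    have := nsq1 hn
    simp only [hz, hx]
    ext k; fin_cases k
    · simp; linarith
    · simp; ring
  have eF : ∀ᵐ x ∂volume.restrict Ω, ∀ i, jf z E i x = jf w Dw i x - jf u0 D0 i x := by
    filter_upwards [hw.2, (h0.conj2 hΩ).2] with x a1 a2 i
    have := jf_mul (u := w) (w := fun x => conj2 (u0 x)) (x := x) (D := Dw) (E := fun i x => CT.conj2 (D0 i x)) a1 a2 i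
    rw [jf_conj] at this
    rw [sub_eq_add_neg, ← this]
  have hBB : ball y ρ ⊆ Ω := ball_subset_closedBall.trans hB
  have cK := isCompact_closedBall y ρ
  have mB : ∀ {f : X → ℝ}, LL Ω f → MemLp f 2 (volume.restrict (ball y ρ)) := fun hf =>
    (hf _ hB cK).mono_measure (Measure.restrict_mono ball_subset_closedBall le_rfl)
  have LF := fun i => jf_LL hΩ gz i
  have iF : Integrable (fun x => ∑ i, jf z E i x ^ 2) (volume.restrict (ball y ρ)) :=
    integrable_finsetSum _ fun i _ => (mB (LF i)).integrable_sq
  have split : ∀ f : ι → X → ℝ, (∀ i, LL Ω (f i)) →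
      ∫ x in ball y ρ, (2 * (∑ i, f i x * jf z E i x) + ∑ i, jf z E i x ^ 2) =
      2 * (∑ i, ∫ x in ball y ρ, f i x * jf z E i x) + ∫ x in ball y ρ, ∑ i, jf z E i x ^ 2 := by
    intro f hf
    have i1 : ∀ i, Integrable (fun x => f i x * jf z E i x) (volume.restrict (ball y ρ)) := fun i =>
      (mB (hf i)).integrable_mul (mB (LF i))
    have i2 : Integrable (fun x => 2 * ∑ i, f i x * jf z E i x) (volume.restrict (ball y ρ)) :=
      (integrable_finsetSum _ fun i _ => i1 i).const_mul 2
    rw [integral_add i2 iF, integral_const_mul, integral_finsetSum _ fun i _ => i1 i]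
  have wl : ∀ i, Tendsto (fun j => ∫ x in ball y ρ, jf (u j) (D j) i x * jf z E i x) atTop (𝓝 (∫ x in ball y ρ, jf u0 D0 i x * jf z E i x)) := by
    intro i
    have := (hJ i).2 (closedBall y ρ) hB cK ((ball y ρ).indicator (jf z E i)) ((LF i _ hB cK).indicator measurableSet_ball)
    have e : ∀ f : X → ℝ, ∫ x in closedBall y ρ, (ball y ρ).indicator (jf z E i) x * f x = ∫ x in ball y ρ, f x * jf z E i x := by
      intro f
      have : ∀ x, (ball y ρ).indicator (jf z E i) x * f x = (ball y ρ).indicator (fun x => f x * jf z E i x) x := fun x => by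
        by_cases hx : x ∈ ball y ρ
        · rw [indicator_of_mem hx, indicator_of_mem hx, mul_comm]
        · rw [indicator_of_notMem hx, indicator_of_notMem hx, zero_mul]
      simp only [this]
      rw [setIntegral_indicator measurableSet_ball, inter_eq_right.2 ball_subset_closedBall]
    simpa only [e] using this
  have lim := ((tendsto_finsetSum Finset.univ fun i _ => wl i).const_mul 2).add_const (∫ x in ball y ρ, ∑ i, jf z E i x ^ 2)
  have pos := ge_of_tendsto' lim fun j => by
    rw [← split _ fun i => jf_LL hΩ (hu j).1 i]
    exact mz_var hΩ (hu j) gz hρ hB hσ h1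
  rw [← split _ fun i => jf_LL hΩ h0 i] at pos
  have i1 := (h0.ed_int hB cK).mono_set ball_subset_closedBall
  have i2 := (hw.ed_int hB cK).mono_set ball_subset_closedBall
  rw [← sub_nonneg, ← integral_sub i2 i1]
  refine pos.trans (le_of_eq (integral_congr_ae (ae_mono (Measure.restrict_mono hBB le_rfl) ?_)))
  filter_upwards [ed_jf hΩ h0, ed_jf hΩ hw, eF] with x e1 e2 e3
  rw [e1, e2]
  simp only [e3]
  rw [Finset.mul_sum, ← Finset.sum_sub_distrib, ← Finset.sum_add_distrib]
  exact Finset.sum_congr rfl fun i _ => by ring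

lemma main2 {b : OrthonormalBasis ι ℝ X} {Ω : Set X} (hΩ : IsOpen Ω)
    {u : ℕ → X → Y2} {D : ℕ → ι → X → Y2}
    {u0 : X → Y2} {D0 : ι → X → Y2} (hu : ∀ j, Mz b Ω (u j) (D j)) (h0 : GM b Ω u0 D0)
    (hW : ∀ i a, WC Ω (fun j x => D j i x a) (fun x => D0 i x a))
    (hS : ∀ K ⊆ Ω, IsCompact K → Tendsto (fun j => eLpNorm (u j - u0) 2 (volume.restrict K)) atTop (𝓝 0))
    (hbd : ∀ K ⊆ Ω, IsCompact K → ∃ C : ℝ≥0, ∀ j, ∫⁻ x in K, ENNReal.ofReal (ed (D j) x) ≤ C) :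
    Mz b Ω u0 D0 ∧ ∀ (y : X) (ρ : ℝ), 0 < ρ → closedBall y ρ ⊆ Ω →
      Tendsto (fun j => ∫ x in closedBall y ρ, ed (fun i x => D j i x - D0 i x) x) atTop (𝓝 0) := by
  have hu' := fun j => (hu j).1
  have hJ := fun i => jf_WC hu' h0 hW hS hbd i
  refine ⟨main2_min hΩ hu h0 hJ, fun y ρ hρ hB => ?_⟩
  obtain ⟨ρ1, h1, hB1⟩ := bigger_ball hΩ hρ hB
  have cK := isCompact_closedBall y ρ
  have hbB : ball y ρ1 ⊆ Ω := ball_subset_closedBall.trans hB1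
  obtain ⟨C, hC⟩ := hbd _ hB1 (isCompact_closedBall y ρ1)
  have st := strong_CD hρ h1 (f := fun j => jf (u j) (D j)) (f0 := jf u0 D0) (fun j => mz_CDF hΩ (hu j) (hρ.trans h1) hB1) (C := C)
    (fun j i => (jf_LL hΩ (hu' j) i).mono hbB) (fun j i => by
      refine le_trans ?_ ((lintegral_mono_set ball_subset_closedBall).trans (hC j))
      refine lintegral_mono_ae (ae_mono (Measure.restrict_mono hbB le_rfl) ?_)
      filter_upwards [jf_le hΩ (hu' j) i] with x hx
      refine le_trans ?_ (enorm_sq_le_ed (D j) i x)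
      refine pow_le_pow_left' ?_ 2
      rw [← ofReal_norm, ← ofReal_norm]; exact ENNReal.ofReal_le_ofReal hx)
    (fun i => ⟨(hJ i).1.mono hbB, fun K hK hc ψ hψ => (hJ i).2 K (hK.trans hbB) hc ψ hψ⟩)
  have m0 := fun i => jf_LL hΩ h0 i _ hB cK
  have mj := fun j i => jf_LL hΩ (hu' j) i _ hB cK
  have l1 : ∀ i, Tendsto (fun j => ∫ x in closedBall y ρ, jf (u j) (D j) i x ^ 2) atTop (𝓝 (∫ x in closedBall y ρ, jf u0 D0 i x ^ 2)) := by
    intro i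
    have a := int_sq_lim (fun j => ((mj j i).sub (m0 i)).1) (st i)
    have c := (int_tendsto (fun j => mj j i) (m0 i) (st i) (m0 i)).const_mul 2
    have d := (a.add c).sub_const (∫ x in closedBall y ρ, jf u0 D0 i x ^ 2)
    refine (d.congr fun j => ?_).trans (le_of_eq ?_)
    · have i1 : Integrable (fun x => ‖(jf (u j) (D j) i - jf u0 D0 i) x‖ ^ 2) (volume.restrict (closedBall y ρ)) :=
        ((mj j i).sub (m0 i)).integrable_norm_pow two_ne_zero
      have i2 : Integrable (fun x => 2 * (jf u0 D0 i x * jf (u j) (D j) i x)) (volume.restrict (closedBall y ρ)) :=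
        ((m0 i).integrable_mul (mj j i)).const_mul 2
      have i3 : Integrable (fun x => ‖(jf (u j) (D j) i - jf u0 D0 i) x‖ ^ 2 + 2 * (jf u0 D0 i x * jf (u j) (D j) i x)) (volume.restrict (closedBall y ρ)) := i1.add i2
      rw [← integral_const_mul, ← integral_add i1 i2, ← integral_sub i3 (m0 i).integrable_sq]
      congr 1; funext x
      simp only [Pi.sub_apply, Real.norm_eq_abs, sq_abs]; ring
    · congr 1
      have : ∀ x, jf u0 D0 i x * jf u0 D0 i x = jf u0 D0 i x ^ 2 := fun x => by ring
      simp only [this]; ring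
  have ee : ∀ {v : X → Y2} {B : ι → X → Y2}, GM b Ω v B → ∫ x in closedBall y ρ, ed B x = ∑ i, ∫ x in closedBall y ρ, jf v B i x ^ 2 := by
    intro v B hv
    rw [← integral_finsetSum _ fun i _ => (jf_LL hΩ hv i _ hB cK).integrable_sq]
    exact integral_congr_ae (ae_mono (Measure.restrict_mono hB le_rfl) (ed_jf hΩ hv))
  have l2 : Tendsto (fun j => ∫ x in closedBall y ρ, ed (D j) x) atTop (𝓝 (∫ x in closedBall y ρ, ed D0 x)) := by
    rw [ee h0]
    simp only [ee (hu' _)]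
    exact tendsto_finsetSum _ fun i _ => l1 i
  refine strong_of_limsup hu' h0 hW hB cK fun ε hε => ?_
  exact (l2.eventually (Iio_mem_nhds (lt_add_of_pos_right _ hε))).mono fun j hj => le_of_lt hj

end S1
end CT

/-- The Compactness Theorem (Lemma 1 of the paper) for energy minimizing maps into the
unit sphere: given a sequence `u_j` of energy minimizing maps on `Ω` with locally
uniformly bounded energies, some subsequence `u_{j'}` converges, together with its weak
gradients, in `L²` on every ball with closure in `Ω`, to an energy minimizing map `u`
with weak gradient `g`. -/
theorem compactness_theorem
    (n p : ℕ) (hn : 2 ≤ n) (hp : 2 ≤ p)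
    (Ω : Set (EuclideanSpace ℝ (Fin n))) (hΩ : IsOpen Ω)
    (u : ℕ → EuclideanSpace ℝ (Fin n) → EuclideanSpace ℝ (Fin p))
    (g : ℕ → EuclideanSpace ℝ (Fin n) →
      (EuclideanSpace ℝ (Fin n) →L[ℝ] EuclideanSpace ℝ (Fin p)))
    (hmin : ∀ j, IsEnergyMinimizingToSphere n p Ω (u j) (g j))
    (hbdd : ∀ (y : EuclideanSpace ℝ (Fin n)) (ρ : ℝ), 0 < ρ → closedBall y ρ ⊆ Ω →
      ∃ C : ℝ, ∀ j, ∫ x in ball y ρ, energyDensity n p (g j) x ≤ C) :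
    ∃ φ : ℕ → ℕ, StrictMono φ ∧
      ∃ (ulim : EuclideanSpace ℝ (Fin n) → EuclideanSpace ℝ (Fin p))
        (glim : EuclideanSpace ℝ (Fin n) →
          (EuclideanSpace ℝ (Fin n) →L[ℝ] EuclideanSpace ℝ (Fin p))),
        IsEnergyMinimizingToSphere n p Ω ulim glim ∧
        ∀ (y : EuclideanSpace ℝ (Fin n)) (ρ : ℝ), 0 < ρ → closedBall y ρ ⊆ Ω →
          Tendsto (fun k => ∫ x in ball y ρ, ‖u (φ k) x - ulim x‖ ^ 2)
            atTop (nhds 0) ∧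
          Tendsto (fun k => ∫ x in ball y ρ,
              ∑ i : Fin n, ‖(g (φ k) x - glim x) (EuclideanSpace.single i 1)‖ ^ 2)
            atTop (nhds 0) := by
  have hn0 : 0 < n := by omega
  have : Nonempty (Fin n) := ⟨⟨0, hn0⟩⟩
  have hM := fun j => CT.em_to_Mz hΩ hn0 (hmin j)
  have hG := fun j => (hM j).1
  simp only [CT.ed_eq] at hbdd
  obtain ⟨φ, hφ, u0, D0, h0, hS, hW⟩ := CT.extract hΩ hG hbdd
  have hbd := fun (K : Set (EuclideanSpace ℝ (Fin n))) (hK : K ⊆ Ω) (hc : IsCompact K) =>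
    CT.compact_bound hΩ (fun j => hG (φ j)) (fun y ρ h1 h2 => (hbdd y ρ h1 h2).imp fun C hC j => hC (φ j)) hK hc
  have main : CT.Mz (EuclideanSpace.basisFun (Fin n) ℝ) Ω u0 D0 ∧ ∀ (y : EuclideanSpace ℝ (Fin n)) (ρ : ℝ), 0 < ρ → closedBall y ρ ⊆ Ω →
      Tendsto (fun j => ∫ x in closedBall y ρ, CT.ed (fun i x => g (φ j) x (EuclideanSpace.single i 1) - D0 i x) x) atTop (nhds 0) := by
    rcases Nat.lt_or_ge 2 p with h3 | h2
    · exact CT.main3 (by rw [Fintype.card_fin]; omega) hΩ (fun j => hM (φ j)) h0 hW hS hbd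
    · obtain rfl : p = 2 := le_antisymm h2 hp
      exact CT.main2 hΩ (fun j => hM (φ j)) h0 hW hS hbd
  refine ⟨φ, hφ, u0, CT.mkg D0, CT.Mz_to_em hΩ hn0 main.1, fun y ρ hρ hB => ⟨?_, ?_⟩⟩
  · have cK := isCompact_closedBall y ρ
    have L0 := (h0.1 ⟨0, hn0⟩).1 _ hB cK
    have Lj := fun j => ((hG (φ j)).1 ⟨0, hn0⟩).1 _ hB cK
    have a := CT.int_sq_lim (fun j => ((Lj j).sub L0).1) (hS _ hB cK)
    refine squeeze_zero (fun j => integral_nonneg fun x => by positivity) (fun j => ?_) a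
    exact setIntegral_mono_set (((Lj j).sub L0).integrable_norm_pow two_ne_zero) (ae_of_all _ fun x => by positivity)
      ball_subset_closedBall.eventuallyLE
  · have cK := isCompact_closedBall y ρ
    refine squeeze_zero (fun j => integral_nonneg fun x => by positivity) (fun j => ?_) (main.2 y ρ hρ hB)
    have e : (fun x => ∑ i : Fin n, ‖(g (φ j) x - CT.mkg D0 x) (EuclideanSpace.single i 1)‖ ^ 2) =
        CT.ed (fun i x => g (φ j) x (EuclideanSpace.single i 1) - D0 i x) := by
      funext x
      simp only [CT.ed, sub_apply, CT.mkg_apply]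
    rw [e]
    exact setIntegral_mono_set (CT.ed_int_sub (hG (φ j)) h0 hB cK) (ae_of_all _ fun x => CT.ed_nonneg _ x)
      ball_subset_closedBall.eventuallyLE
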